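/- Let 𝔽 be a field of characteristic 0, R a subring of 𝔽, and T an L-theory (L ⊇ L_0, the language of 𝔽-vector spaces) with quantifier elimination and elimination of ∃^∞, all of whose models are 𝔽-vector spaces, and in which acl equals the 𝔽-linear span. Let T_G be the L_G-theory extending T with the axioms: (A) G is an R-submodule of the universe and P_θ(ā) holds iff ā ∈ G and G ⊨_{R-mod} θ(ā); (B) if λ_1, …, λ_n ∈ 𝔽 are linearly independent over the fraction field of R and g_1, …, g_n ∈ G satisfy λ_1 g_1 + ⋯ + λ_n g_n = 0, then all g_i = 0; (C) for every r ∈ R ∖ {0}, rG is dense: every L-formula φ(x, ā) with infinitely many solutions has a solution in rG; (D) extension/co-density: for L-formulas φ(x, ȳ), ψ(x, ȳ, z̄) and n ≥ 1, whenever φ(x, ȳ) has infinitely many solutions and ψ(x, ȳ, z̄) has at most n solutions in x for all z̄, there is a solution x of φ(x, ȳ) with ¬ψ(x, ȳ, z̄) for all z̄ ∈ G. If T is NATP, then T_G is NATP. -/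

import Mathlib

open FirstOrder FirstOrder.Language

universe u

namespace NATPPaper

/-! ### ATP and NATP -/

section ATP

variable {L : FirstOrder.Language.{u, u}}

def TreeComparable (η ν : List Bool) : Prop := η <+: ν ∨ ν <+: η

def IsTreeAntichain (X : Set (List Bool)) : Prop :=
  ∀ η ∈ X, ∀ ν ∈ X, η ≠ ν → ¬ TreeComparable η ν

def ATPWitness {M : Type u} [L.Structure M] {n m : ℕ}
    (φ : L.Formula (Fin n ⊕ Fin m)) (a : List Bool → Fin m → M) : Prop :=
  (∀ X : Finset (List Bool), IsTreeAntichain ↑X →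
      ∃ b : Fin n → M, ∀ η ∈ X, φ.Realize (Sum.elim b (a η))) ∧
  (∀ η ν : List Bool, η ≠ ν → TreeComparable η ν →
      ¬ ∃ b : Fin n → M, φ.Realize (Sum.elim b (a η)) ∧ φ.Realize (Sum.elim b (a ν)))

def _root_.FirstOrder.Language.Theory.HasATP (T : L.Theory) : Prop :=
  ∃ (M : Theory.ModelType.{u, u, u} T) (n m : ℕ)
    (φ : L.Formula (Fin n ⊕ Fin m)) (a : List Bool → Fin m → M), ATPWitness φ a

def _root_.FirstOrder.Language.Theory.IsNATP (T : L.Theory) : Prop := ¬ T.HasATP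

/-- Model-theoretic algebraic closure. -/
def acl (L : FirstOrder.Language.{u, u}) (M : Type u) [L.Structure M] (A : Set M) : Set M :=
  {x | ∃ (k : ℕ) (φ : L.Formula (Fin 1 ⊕ Fin k)) (c : Fin k → M),
        (∀ j, c j ∈ A) ∧ φ.Realize (Sum.elim (fun _ => x) c) ∧
        {y : M | φ.Realize (Sum.elim (fun _ => y) c)}.Finite}

/-- `T` eliminates quantifiers. -/
def HasQE (T : L.Theory) : Prop :=
  ∀ (n : ℕ) (φ : L.Formula (Fin n)), ∃ ψ : L.Formula (Fin n), BoundedFormula.IsQF ψ ∧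
    ∀ (M : Theory.ModelType.{u, u, u} T) (w : Fin n → M), φ.Realize w ↔ ψ.Realize w

/-- `T` eliminates the quantifier `∃^∞`. -/
def EliminatesExInf (T : L.Theory) : Prop :=
  ∀ (k : ℕ) (φ : L.Formula (Fin 1 ⊕ Fin k)), ∃ N : ℕ,
    ∀ (M : Theory.ModelType.{u, u, u} T) (c : Fin k → M),
      (∃ s : Finset M, N ≤ s.card ∧ ∀ x ∈ s, φ.Realize (Sum.elim (fun _ => x) c)) →
      {x : (M : Type u) | φ.Realize (Sum.elim (fun _ => x) c)}.Infinite

end ATP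

/-! ### The language of vector spaces and its generic expansion -/

/-- Function symbols of the language `L₀ = {+, 0, (λ·)_{λ ∈ 𝔽}}` of `𝔽`-vector spaces. -/
def vsFuncs (𝔽 : Type u) : ℕ → Type u
  | 0 => PUnit
  | 1 => 𝔽
  | 2 => PUnit
  | _ + 3 => PEmpty

/-- The language of `𝔽`-vector spaces. -/
def vsLang (𝔽 : Type u) : FirstOrder.Language.{u, u} := ⟨vsFuncs 𝔽, fun _ => PEmpty⟩

variable (𝔽 : Type u)

def vzeroSym : (vsLang 𝔽).Functions 0 := PUnit.unit
def vaddSym : (vsLang 𝔽).Functions 2 := PUnit.unit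
def vsmulSym (c : 𝔽) : (vsLang 𝔽).Functions 1 := c

section Ops

variable (𝔽 : Type u) (N : Type u) [(vsLang 𝔽).Structure N]

/-- The zero vector. -/
def vzero : N := Structure.funMap (vzeroSym 𝔽) ![]

variable {N}

/-- Vector addition. -/
def vadd (x y : N) : N := Structure.funMap (vaddSym 𝔽) ![x, y]

/-- Scalar multiplication. -/
def vsmul (c : 𝔽) (x : N) : N := Structure.funMap (vsmulSym 𝔽 c) ![x]

/-- Finite sums of vectors. -/
def vsum : ∀ {n : ℕ}, (Fin n → N) → N
  | 0, _ => vzero 𝔽 N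
  | _ + 1, g => vadd 𝔽 (g 0) (vsum (g ∘ Fin.succ))

/-- The `𝔽`-linear span of a subset. -/
def vspan (A : Set N) : Set N :=
  ⋂₀ {S : Set N | A ⊆ S ∧ vzero 𝔽 N ∈ S ∧ (∀ x ∈ S, ∀ y ∈ S, vadd 𝔽 x y ∈ S) ∧
      ∀ (c : 𝔽), ∀ x ∈ S, vsmul 𝔽 c x ∈ S}

variable (N)

/-- `N` is an `𝔽`-vector space with respect to the interpreted symbols. -/
def VSAxioms [Field 𝔽] : Prop :=
  (∀ x y : N, vadd 𝔽 x y = vadd 𝔽 y x) ∧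
  (∀ x y z : N, vadd 𝔽 (vadd 𝔽 x y) z = vadd 𝔽 x (vadd 𝔽 y z)) ∧
  (∀ x : N, vadd 𝔽 x (vzero 𝔽 N) = x) ∧
  (∀ x : N, vadd 𝔽 x (vsmul 𝔽 (-1 : 𝔽) x) = vzero 𝔽 N) ∧
  (∀ x : N, vsmul 𝔽 (1 : 𝔽) x = x) ∧
  (∀ (c d : 𝔽) (x : N), vsmul 𝔽 c (vsmul 𝔽 d x) = vsmul 𝔽 (c * d) x) ∧
  (∀ (c d : 𝔽) (x : N), vsmul 𝔽 (c + d) x = vadd 𝔽 (vsmul 𝔽 c x) (vsmul 𝔽 d x)) ∧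
  (∀ (c : 𝔽) (x y : N), vsmul 𝔽 c (vadd 𝔽 x y) = vadd 𝔽 (vsmul 𝔽 c x) (vsmul 𝔽 c y))

end Ops

variable (L' : FirstOrder.Language.{u, u}) (R : Type u)

/-- The language `L ⊇ L₀`. -/
abbrev fullLang : FirstOrder.Language.{u, u} := (vsLang 𝔽).sum L'

/-- The extra symbols of `L_G`: a unary predicate `G` and, for each `L_{R-mod}`-formula `θ(x̄)`,
a predicate `P_θ` of the arity of `θ`. -/
def genAux : FirstOrder.Language.{u, u} :=
  ⟨fun _ => PEmpty, fun n => ULift (PLift (n = 1)) ⊕ (vsLang R).Formula (Fin n)⟩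

/-- The language `L_G = L ∪ {G} ∪ {P_θ}`. -/
abbrev genLang : FirstOrder.Language.{u, u} := (fullLang 𝔽 L').sum (genAux R)

/-- The predicate symbol `G`. -/
def gSym : (genLang 𝔽 L' R).Relations 1 := Sum.inr (Sum.inl ⟨⟨rfl⟩⟩)

/-- The predicate symbol `P_θ`. -/
def pSym {n : ℕ} (θ : (vsLang R).Formula (Fin n)) : (genLang 𝔽 L' R).Relations n :=
  Sum.inr (Sum.inr θ)

section Structures

variable (𝔽 : Type u) (L' : FirstOrder.Language.{u, u}) (R : Type u)
variable (M : Type u) [(genLang 𝔽 L' R).Structure M]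

/-- The `L`-reduct of an `L_G`-structure. -/
def lOfLG : (fullLang 𝔽 L').Structure M :=
  (LHom.sumInl : fullLang 𝔽 L' →ᴸ genLang 𝔽 L' R).reduct M

/-- The `L₀`-reduct of an `L_G`-structure. -/
def vsOfLG : (vsLang 𝔽).Structure M :=
  ((LHom.sumInl : fullLang 𝔽 L' →ᴸ genLang 𝔽 L' R).comp
    (LHom.sumInl : vsLang 𝔽 →ᴸ fullLang 𝔽 L')).reduct M

/-- The vector space operations of an `L_G`-structure. -/
def vzeroG : M := @vzero 𝔽 M (vsOfLG 𝔽 L' R M)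

def vaddG (x y : M) : M := @vadd 𝔽 M (vsOfLG 𝔽 L' R M) x y

def vsmulG (c : 𝔽) (x : M) : M := @vsmul 𝔽 M (vsOfLG 𝔽 L' R M) c x

def vsumG {n : ℕ} (g : Fin n → M) : M := @vsum 𝔽 M (vsOfLG 𝔽 L' R M) n g

/-- The set `G(M)`. -/
def GSet : Set M := {x | Structure.RelMap (gSym 𝔽 L' R) ![x]}

variable [Field 𝔽]

/-- Given a subring `R ⊆ 𝔽` for which `G` is an `R`-submodule, the induced
`L_{R-mod}`-structure on `G`. -/
def gStructure (Rs : Subring 𝔽)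
    (h0 : vzeroG 𝔽 L' R M ∈ GSet 𝔽 L' R M)
    (hadd : ∀ x ∈ GSet 𝔽 L' R M, ∀ y ∈ GSet 𝔽 L' R M, vaddG 𝔽 L' R M x y ∈ GSet 𝔽 L' R M)
    (hsmul : ∀ r : Rs, ∀ x ∈ GSet 𝔽 L' R M, vsmulG 𝔽 L' R M (r : 𝔽) x ∈ GSet 𝔽 L' R M) :
    (vsLang ↥Rs).Structure ↥(GSet 𝔽 L' R M) where
  funMap {n} f w :=
    match n, f, w with
    | 0, _, _ => ⟨vzeroG 𝔽 L' R M, h0⟩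
    | 1, r, w => ⟨vsmulG 𝔽 L' R M ((show ↥Rs from r) : 𝔽) (w 0).1,
        hsmul (show ↥Rs from r) _ (w 0).2⟩
    | 2, _, w => ⟨vaddG 𝔽 L' R M (w 0).1 (w 1).1, hadd _ (w 0).2 _ (w 1).2⟩
    | _ + 3, f, _ => (show PEmpty from f).elim
  RelMap {n} r _ := (show PEmpty from r).elim

end Structures

section TG

variable {𝔽 : Type u} [Field 𝔽] [CharZero 𝔽] {L' : FirstOrder.Language.{u, u}}
variable (Rs : Subring 𝔽) (T : (fullLang 𝔽 L').Theory)

/-- `λ₁, …, λ_n ∈ 𝔽` are linearly independent over the fraction field of `R` (equivalently,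
over `R`). -/
def RIndep {n : ℕ} (lam : Fin n → 𝔽) : Prop :=
  ∀ c : Fin n → 𝔽, (∀ i, c i ∈ Rs) → ∑ i, c i * lam i = 0 → ∀ i, c i = 0

/-- `M` is a model of the theory `T_G` of axioms (A)–(D): `G` is a generic dense/co-dense
`R`-submodule. -/
structure IsTGModel (M : Type u) [(genLang 𝔽 L' ↥Rs).Structure M] : Prop where
  modelsT : @Theory.Model (fullLang 𝔽 L') M (lOfLG 𝔽 L' ↥Rs M) T
  -- (A) `G` is an `R`-submodule and `P_θ` is interpreted as the `θ`-relation on `G`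
  h0 : vzeroG 𝔽 L' ↥Rs M ∈ GSet 𝔽 L' ↥Rs M
  hadd : ∀ x ∈ GSet 𝔽 L' ↥Rs M, ∀ y ∈ GSet 𝔽 L' ↥Rs M,
    vaddG 𝔽 L' ↥Rs M x y ∈ GSet 𝔽 L' ↥Rs M
  hsmul : ∀ r : Rs, ∀ x ∈ GSet 𝔽 L' ↥Rs M, vsmulG 𝔽 L' ↥Rs M (r : 𝔽) x ∈ GSet 𝔽 L' ↥Rs M
  p_iff : ∀ (n : ℕ) (θ : (vsLang ↥Rs).Formula (Fin n)) (v : Fin n → M),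
    Structure.RelMap (pSym 𝔽 L' ↥Rs θ) v ↔
      ∃ hv : ∀ i, v i ∈ GSet 𝔽 L' ↥Rs M,
        @Formula.Realize (vsLang ↥Rs) ↥(GSet 𝔽 L' ↥Rs M)
          (gStructure 𝔽 L' ↥Rs M Rs h0 hadd hsmul) _ θ (fun i => ⟨v i, hv i⟩)
  -- (B)
  axiomB : ∀ (n : ℕ) (lam : Fin n → 𝔽), RIndep Rs lam →
    ∀ g : Fin n → M, (∀ i, g i ∈ GSet 𝔽 L' ↥Rs M) →
      vsumG 𝔽 L' ↥Rs M (fun i => vsmulG 𝔽 L' ↥Rs M (lam i) (g i)) = vzeroG 𝔽 L' ↥Rs M →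
      ∀ i, g i = vzeroG 𝔽 L' ↥Rs M
  -- (C) density of `rG`
  axiomC : ∀ r : 𝔽, r ∈ Rs → r ≠ 0 →
    ∀ (k : ℕ) (φ : (fullLang 𝔽 L').Formula (Fin 1 ⊕ Fin k)) (c : Fin k → M),
      {x : M | @Formula.Realize _ M (lOfLG 𝔽 L' ↥Rs M) _ φ
          (Sum.elim (fun _ => x) c)}.Infinite →
      ∃ g ∈ GSet 𝔽 L' ↥Rs M, @Formula.Realize _ M (lOfLG 𝔽 L' ↥Rs M) _ φ
        (Sum.elim (fun _ => vsmulG 𝔽 L' ↥Rs M r g) c)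
  -- (D) extension / co-density
  axiomD : ∀ (k l : ℕ) (φ : (fullLang 𝔽 L').Formula (Fin 1 ⊕ Fin k))
      (ψ : (fullLang 𝔽 L').Formula (Fin 1 ⊕ (Fin k ⊕ Fin l))) (nn : ℕ), 1 ≤ nn →
    ∀ b : Fin k → M,
      {x : M | @Formula.Realize _ M (lOfLG 𝔽 L' ↥Rs M) _ φ
          (Sum.elim (fun _ => x) b)}.Infinite →
      (∀ c : Fin l → M,
        {x : M | @Formula.Realize _ M (lOfLG 𝔽 L' ↥Rs M) _ ψ
            (Sum.elim (fun _ => x) (Sum.elim b c))}.Finite ∧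
        {x : M | @Formula.Realize _ M (lOfLG 𝔽 L' ↥Rs M) _ ψ
            (Sum.elim (fun _ => x) (Sum.elim b c))}.ncard ≤ nn) →
      ∃ x : M, @Formula.Realize _ M (lOfLG 𝔽 L' ↥Rs M) _ φ (Sum.elim (fun _ => x) b) ∧
        ∀ c : Fin l → M, (∀ i, c i ∈ GSet 𝔽 L' ↥Rs M) →
          ¬ @Formula.Realize _ M (lOfLG 𝔽 L' ↥Rs M) _ ψ
              (Sum.elim (fun _ => x) (Sum.elim b c))

end TG

set_option linter.unusedVariables false

/-! ### Strong embeddings of the binary tree -/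

section Trees

/-- A map of the binary tree which sends the `b`-successor of a node above the `b`-successor of
its image. -/
def StrongEmb (e : List Bool → List Bool) : Prop := ∀ s b, e s ++ [b] <+: e (s ++ [b])

theorem StrongEmb.comp {e f : List Bool → List Bool} (he : StrongEmb e) (hf : StrongEmb f) :
    StrongEmb (e ∘ f) := by
  have hmono : ∀ u s, e s <+: e (s ++ u) := by
    intro u
    induction u using List.reverseRecOn with
    | nil => intro s; simp
    | append_singleton u b ih =>
      intro s
      rw [← List.append_assoc]
      exact (ih s).trans ((List.prefix_append _ _).trans (he _ _))
  intro s b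
  refine (he (f s) b).trans ?_
  obtain ⟨u, hu⟩ := hf s b
  simp only [Function.comp]
  rw [← hu]
  exact hmono u _

theorem StrongEmb.id : StrongEmb id := fun _ _ => List.prefix_rfl

theorem StrongEmb.mono {e : List Bool → List Bool} (he : StrongEmb e) {s t : List Bool}
    (h : s <+: t) : e s <+: e t := by
  obtain ⟨u, rfl⟩ := h
  induction u using List.reverseRecOn with
  | nil => simp
  | append_singleton u b ih =>
    rw [← List.append_assoc]
    exact ih.trans ((List.prefix_append _ _).trans (he _ _))

theorem StrongEmb.mono_succ {e : List Bool → List Bool} (he : StrongEmb e) {s t : List Bool}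
    {b : Bool} (h : s ++ [b] <+: t) : e s ++ [b] <+: e t :=
  (he s b).trans (he.mono h)

theorem StrongEmb.length_le {e : List Bool → List Bool} (he : StrongEmb e) (s : List Bool) :
    s.length ≤ (e s).length := by
  induction s using List.reverseRecOn with
  | nil => simp
  | append_singleton u b ih =>
    have := (he u b).length_le
    simp at this ⊢
    omega

theorem exists_split_of_not_comparable : ∀ {s t : List Bool}, ¬ TreeComparable s t →
    ∃ p b, p ++ [b] <+: s ∧ p ++ [!b] <+: t
  | [], t, h => absurd (Or.inl (List.nil_prefix)) h
  | s, [], h => absurd (Or.inr (List.nil_prefix)) h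
  | b :: s, c :: t, h => by
    by_cases hbc : b = c
    · subst hbc
      have : ¬ TreeComparable s t := by
        intro h'
        apply h
        rcases h' with h' | h'
        · exact Or.inl (by simpa using h')
        · exact Or.inr (by simpa using h')
      obtain ⟨p, d, h1, h2⟩ := exists_split_of_not_comparable this
      exact ⟨b :: p, d, by simpa using h1, by simpa using h2⟩
    · refine ⟨[], b, by simp, ?_⟩
      have : c = !b := by cases b <;> cases c <;> simp_all
      simp [this]

theorem not_comparable_of_split {s t p : List Bool} {b : Bool} (h1 : p ++ [b] <+: s)
    (h2 : p ++ [!b] <+: t) : ¬ TreeComparable s t := by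
  have key : ∀ u : List Bool, p ++ [b] <+: u → p ++ [!b] <+: u → False := by
    intro u h1 h2
    have := (List.prefix_or_prefix_of_prefix h1 h2)
    rcases this with h | h
    · have := h.eq_of_length (by simp)
      simp at this
    · have := h.eq_of_length (by simp)
      simp at this
  rintro (h | h)
  · exact key t (h1.trans h) h2
  · exact key s h1 (h2.trans h)

theorem StrongEmb.not_comparable {e : List Bool → List Bool} (he : StrongEmb e)
    {s t : List Bool} (h : ¬ TreeComparable s t) : ¬ TreeComparable (e s) (e t) := by
  obtain ⟨p, b, h1, h2⟩ := exists_split_of_not_comparable h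
  exact not_comparable_of_split (he.mono_succ h1) (he.mono_succ h2)

theorem StrongEmb.injective {e : List Bool → List Bool} (he : StrongEmb e) :
    Function.Injective e := by
  intro s t hst
  by_contra hne
  have hlt : ∀ {s t : List Bool}, s <+: t → s ≠ t → e s ≠ e t := by
    intro s t h hne heq
    obtain ⟨u, rfl⟩ := h
    cases u with
    | nil => simp at hne
    | cons b u =>
      have h1 : e s ++ [b] <+: e (s ++ b :: u) := he.mono_succ (by simp)
      have := h1.length_le
      rw [← heq] at this
      simp at this
  by_cases h : TreeComparable s t
  · rcases h with h | h
    · exact hlt h hne hst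
    · exact hlt h (Ne.symm hne) hst.symm
  · exact he.not_comparable h (by rw [hst]; exact Or.inl List.prefix_rfl)

theorem StrongEmb.comparable {e : List Bool → List Bool} (he : StrongEmb e)
    {s t : List Bool} (h : TreeComparable s t) : TreeComparable (e s) (e t) :=
  h.imp he.mono he.mono

theorem StrongEmb.antichain {e : List Bool → List Bool} (he : StrongEmb e)
    {A : Finset (List Bool)} (h : IsTreeAntichain (A : Set (List Bool))) :
    IsTreeAntichain (A.image e : Set (List Bool)) := by
  intro η hη ν hν hne
  simp only [Finset.coe_image, Set.mem_image] at hη hν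
  obtain ⟨s, hs, rfl⟩ := hη
  obtain ⟨t, ht, rfl⟩ := hν
  exact he.not_comparable (h s hs t ht (fun h => hne (by rw [h])))

theorem IsTreeAntichain.mono {A B : Set (List Bool)} (h : A ⊆ B) (hB : IsTreeAntichain B) :
    IsTreeAntichain A := fun η hη ν hν => hB η (h hη) ν (h hν)

theorem strongEmb_cons (b : Bool) : StrongEmb (List.cons b) := fun s c => by simp

theorem strongEmb_append (p : List Bool) : StrongEmb (p ++ ·) := fun s c => by simp

/-- The embedding acting as `f` and `g` above the two successors of the root. -/
def glueEmb (f g : List Bool → List Bool) : List Bool → List Bool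
  | [] => []
  | false :: s => false :: f s
  | true :: s => true :: g s

theorem strongEmb_glue {f g : List Bool → List Bool} (hf : StrongEmb f) (hg : StrongEmb g) :
    StrongEmb (glueEmb f g) := by
  intro s b
  match s with
  | [] => cases b <;> simp [glueEmb]
  | false :: s => simpa [glueEmb] using hf s b
  | true :: s => simpa [glueEmb] using hg s b

/-- The set of nodes of length at most `n`. -/
noncomputable def lev (n : ℕ) : Finset (List Bool) := (List.finite_length_le Bool n).toFinset

@[simp] theorem mem_lev {n : ℕ} {s : List Bool} : s ∈ lev n ↔ s.length ≤ n := by simp [lev]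

variable {κ : Type*}

/-- Finite colourings of deep enough trees are constant on a strong subtree. -/
theorem exists_mono_strongEmb [Finite κ] (n : ℕ) : ∃ N, ∀ c : List Bool → κ, ∃ e, StrongEmb e ∧
    (∀ s, s.length ≤ n → (e s).length ≤ N) ∧ ∃ i, ∀ s, s.length ≤ n → c (e s) = i := by
  classical
  have key : ∀ C : Finset κ, ∃ N, ∀ c : List Bool → κ, (∀ s, s.length ≤ N → c s ∈ C) →
      ∃ e, StrongEmb e ∧
      (∀ s, s.length ≤ n → (e s).length ≤ N) ∧ ∃ i, ∀ s, s.length ≤ n → c (e s) = i := by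
    intro C
    induction C using Finset.induction_on with
    | empty => exact ⟨0, fun c hc => absurd (hc [] (by simp)) (by simp)⟩
    | insert i C _ ih =>
      obtain ⟨N, hN⟩ := ih
      refine ⟨(n + 1) * (N + 1), fun c hc => ?_⟩
      by_cases h : ∃ p : List Bool, p.length + N ≤ (n + 1) * (N + 1) ∧
          ∀ s, s.length ≤ N → c (p ++ s) ≠ i
      · obtain ⟨p, hp, hpi⟩ := h
        obtain ⟨e, he, heN, j, hj⟩ := hN (fun s => c (p ++ s)) (fun s hs => by
          have := hc (p ++ s) (by simp; omega)
          simpa [hpi s hs] using this)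
        exact ⟨_, (strongEmb_append p).comp he, fun s hs => by
          have := heN s hs
          simp; omega, j, hj⟩
      · push Not at h
        have h' : ∀ p : List Bool, ∃ s : List Bool, s.length ≤ N ∧
            (p.length + N ≤ (n + 1) * (N + 1) → c (p ++ s) = i) := by
          intro p
          by_cases hp : p.length + N ≤ (n + 1) * (N + 1)
          · obtain ⟨s, h1, h2⟩ := h p hp
            exact ⟨s, h1, fun _ => h2⟩
          · exact ⟨[], by simp, fun h => absurd h hp⟩
        choose x hx1 hx2 using h'
        let e : List Bool → List Bool := fun s =>
          s.foldl (fun p b => p ++ [b] ++ x (p ++ [b])) ([] ++ x [])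
        have hsucc : ∀ s b, e (s ++ [b]) = e s ++ [b] ++ x (e s ++ [b]) := by
          intro s b; simp [e, List.foldl_append]
        have hlen : ∀ s, (e s).length ≤ s.length * (N + 1) + N := by
          intro s
          induction s using List.reverseRecOn with
          | nil => simpa [e] using hx1 []
          | append_singleton s b ih =>
            rw [hsucc]
            have := hx1 (e s ++ [b])
            simp only [List.length_append, List.length_singleton]
            have h3 : (s.length + 1) * (N + 1) = s.length * (N + 1) + (N + 1) := by ring
            omega
        have hbd : ∀ s : List Bool, s.length ≤ n → s.length * (N + 1) ≤ n * (N + 1) :=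
          fun s hs => Nat.mul_le_mul_right _ hs
        have h4 : (n + 1) * (N + 1) = n * (N + 1) + (N + 1) := by ring
        refine ⟨e, fun s b => by rw [hsucc]; exact List.prefix_append _ _, ?_, i, ?_⟩
        · intro s hs
          have := hlen s
          have := hbd s hs
          omega
        · intro s hs
          induction s using List.reverseRecOn with
          | nil => exact hx2 [] (by simp; omega)
          | append_singleton s b _ =>
            rw [hsucc]
            apply hx2
            have h5 := hlen s
            simp only [List.length_append, List.length_singleton] at hs ⊢
            have h6 : (s.length + 1) * (N + 1) ≤ n * (N + 1) := Nat.mul_le_mul_right _ hs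
            have h3 : (s.length + 1) * (N + 1) = s.length * (N + 1) + (N + 1) := by ring
            omega
  cases nonempty_fintype κ
  obtain ⟨N, hN⟩ := key Finset.univ
  exact ⟨N, fun c => hN c (by simp)⟩

/-- For a finite colouring of sets of nodes there is a strong subtree in which the colour of an
antichain does not change when its elements are pushed upwards. -/
theorem exists_push_strongEmb (n : ℕ) : ∀ (κ : Type*) [Finite κ], ∃ N,
    ∀ c : Finset (List Bool) → κ, ∃ e, StrongEmb e ∧
    (∀ s, s.length ≤ n → (e s).length ≤ N) ∧
    ∀ A : Finset (List Bool), IsTreeAntichain (A : Set (List Bool)) →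
      ∀ ρ : List Bool → List Bool, (∀ s ∈ A, s <+: ρ s ∧ (ρ s).length ≤ n) →
      c (A.image e) = c (A.image (e ∘ ρ)) := by
  classical
  induction n with
  | zero =>
    intro κ _
    refine ⟨0, fun c => ⟨id, StrongEmb.id, by simp, fun A _ ρ hρ => ?_⟩⟩
    congr 1
    apply Finset.image_congr
    intro s hs
    have h1 := (hρ s hs).2
    have h2 := (hρ s hs).1.length_le
    have h3 : ρ s = [] := by simpa using h1
    have h4 : s = [] := by
      rw [h3] at h2; simpa using h2
    subst h4
    simp [h3]
  | succ n ih =>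
    intro κ _
    obtain ⟨NR, hR⟩ := ih ((lev n).powerset → κ)
    obtain ⟨NL, hL⟩ := ih ((lev NR).powerset → κ)
    obtain ⟨N, hN⟩ := exists_mono_strongEmb (κ := κ) (1 + max NL NR)
    refine ⟨N, fun c => ?_⟩
    obtain ⟨e₁, he₁, he₁N, i, hi⟩ := hN (fun s => c {s})
    obtain ⟨eL, heL, heLN, hpL⟩ := hL (fun P Q =>
      c ((P.image (List.cons false) ∪ Q.1.image (List.cons true)).image e₁))
    obtain ⟨eR, heR, heRN, hpR⟩ := hR (fun Q P =>
      c ((P.1.image (List.cons false ∘ eL) ∪ Q.image (List.cons true)).image e₁))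
    have hglue : ∀ s, s.length ≤ n + 1 → (glueEmb eL eR s).length ≤ 1 + max NL NR := by
      intro s hs
      match s with
      | [] => simp [glueEmb]
      | false :: s =>
        have := heLN s (by simpa using hs)
        simp only [glueEmb, List.length_cons]; omega
      | true :: s =>
        have := heRN s (by simpa using hs)
        simp only [glueEmb, List.length_cons]; omega
    refine ⟨e₁ ∘ glueEmb eL eR, he₁.comp (strongEmb_glue heL heR), fun s hs =>
      he₁N _ (hglue s hs), fun A hA ρ hρ => ?_⟩
    by_cases hnil : [] ∈ A
    · have hAe : A = {[]} := by
        ext s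
        simp only [Finset.mem_singleton]
        refine ⟨fun hs => ?_, fun hs => hs ▸ hnil⟩
        by_contra hne
        exact hA s hs [] hnil hne (Or.inr List.nil_prefix)
      subst hAe
      have h1 := hi (glueEmb eL eR []) (hglue _ (by simp))
      have h2 := hi (glueEmb eL eR (ρ [])) (hglue _ (hρ [] (by simp)).2)
      simpa using h1.trans h2.symm
    · have hinj : ∀ b : Bool, Function.Injective (List.cons b) := fun b => List.cons_injective
      let P := A.preimage (List.cons false) (hinj _).injOn
      let Q := A.preimage (List.cons true) (hinj _).injOn
      have hAPQ : A = P.image (List.cons false) ∪ Q.image (List.cons true) := by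
        ext s
        match s with
        | [] => simp [hnil]
        | false :: s => simp [P]
        | true :: s => simp [Q]
      have hPa : IsTreeAntichain (P : Set (List Bool)) := by
        intro s hs t ht hne hcomp
        simp only [P, Finset.coe_preimage, Set.mem_preimage] at hs ht
        exact hA _ hs _ ht (by simpa using hne) ((strongEmb_cons false).comparable hcomp)
      have hQa : IsTreeAntichain (Q : Set (List Bool)) := by
        intro s hs t ht hne hcomp
        simp only [Q, Finset.coe_preimage, Set.mem_preimage] at hs ht
        exact hA _ hs _ ht (by simpa using hne) ((strongEmb_cons true).comparable hcomp)
      let ρ₀ : List Bool → List Bool := fun s => (ρ (false :: s)).tail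
      let ρ₁ : List Bool → List Bool := fun s => (ρ (true :: s)).tail
      have hcons : ∀ b s, b :: s <+: ρ (b :: s) →
          ρ (b :: s) = b :: (ρ (b :: s)).tail ∧ s <+: (ρ (b :: s)).tail := by
        intro b s h
        obtain ⟨u, hu⟩ := h
        rw [← hu]; simp
      have hρ₀ : ∀ s ∈ P, ρ (false :: s) = false :: ρ₀ s ∧ s <+: ρ₀ s ∧ (ρ₀ s).length ≤ n := by
        intro s hs
        have hs' : false :: s ∈ A := by simpa [P] using hs
        have h1 := hcons _ _ (hρ _ hs').1
        refine ⟨h1.1, h1.2, ?_⟩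
        have h2 := (hρ _ hs').2
        show ((ρ (false :: s)).tail).length ≤ n
        rw [List.length_tail]; omega
      have hρ₁ : ∀ s ∈ Q, ρ (true :: s) = true :: ρ₁ s ∧ s <+: ρ₁ s ∧ (ρ₁ s).length ≤ n := by
        intro s hs
        have hs' : true :: s ∈ A := by simpa [Q] using hs
        have h1 := hcons _ _ (hρ _ hs').1
        refine ⟨h1.1, h1.2, ?_⟩
        have h2 := (hρ _ hs').2
        show ((ρ (true :: s)).tail).length ≤ n
        rw [List.length_tail]; omega
      have hPlev : P ∈ (lev n).powerset := by
        rw [Finset.mem_powerset]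
        intro s hs
        have := (hρ₀ s hs).2
        exact mem_lev.2 (this.1.length_le.trans this.2)
      have hQlev : Q.image (eR ∘ ρ₁) ∈ (lev NR).powerset := by
        rw [Finset.mem_powerset]
        intro s hs
        obtain ⟨t, ht, rfl⟩ := Finset.mem_image.1 hs
        exact mem_lev.2 (heRN _ (hρ₁ t ht).2.2)
      have e1 := congrFun (hpR Q hQa ρ₁ (fun s hs => (hρ₁ s hs).2)) ⟨P, hPlev⟩
      have e2 := congrFun (hpL P hPa ρ₀ (fun s hs => (hρ₀ s hs).2)) ⟨_, hQlev⟩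
      have i1 : A.image (e₁ ∘ glueEmb eL eR) = (P.image (List.cons false ∘ eL) ∪
          (Q.image eR).image (List.cons true)).image e₁ := by
        rw [hAPQ, ← Finset.image_image, Finset.image_union]
        simp only [Finset.image_image]
        rfl
      have i2 : A.image (e₁ ∘ glueEmb eL eR ∘ ρ) =
          ((P.image (eL ∘ ρ₀)).image (List.cons false) ∪
          (Q.image (eR ∘ ρ₁)).image (List.cons true)).image e₁ := by
        rw [hAPQ, ← Finset.image_image, Finset.image_union]
        simp only [Finset.image_image]
        congr 2
        · apply Finset.image_congr
          intro s hs
          simp [(hρ₀ s hs).1, glueEmb]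
        · apply Finset.image_congr
          intro s hs
          simp [(hρ₁ s hs).1, glueEmb]
      rw [Function.comp_assoc, i1, i2, e1, ← e2]
      simp only [Finset.image_image]

/-- Given a finite colouring of pointed antichains, there is a colour such that in arbitrarily
deep strong subtrees, every antichain extends to one in which all its elements have this
colour. -/
theorem exists_homogeneous_strongEmb [Finite κ] (c : Finset (List Bool) → List Bool → κ) :
    ∃ i, ∀ k, ∃ e, StrongEmb e ∧ ∀ A : Finset (List Bool),
      IsTreeAntichain (A : Set (List Bool)) → A ⊆ lev k →
      ∃ X : Finset (List Bool), IsTreeAntichain (X : Set (List Bool)) ∧ A.image e ⊆ X ∧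
        ∀ s ∈ A, c X (e s) = i := by
  classical
  have key : ∀ k, ∃ i, ∃ e, StrongEmb e ∧ ∀ A : Finset (List Bool),
      IsTreeAntichain (A : Set (List Bool)) → A ⊆ lev k →
      ∃ X : Finset (List Bool), IsTreeAntichain (X : Set (List Bool)) ∧ A.image e ⊆ X ∧
        ∀ s ∈ A, c X (e s) = i := by
    intro k
    obtain ⟨n, hn⟩ := exists_mono_strongEmb (κ := κ) k
    obtain ⟨N, hN⟩ := exists_push_strongEmb n (Set κ)
    obtain ⟨e, he, -, hpush⟩ := hN (fun A => {i | ∃ X : Finset (List Bool),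
      IsTreeAntichain (X : Set (List Bool)) ∧ A ⊆ X ∧ ∀ s ∈ A, c X s = i})
    let leaf : List Bool → List Bool := fun p => p ++ List.replicate (n - p.length) false
    let X₀ : Finset (List Bool) := ((lev n).filter (fun s => s.length = n)).image e
    obtain ⟨e₂, he₂, he₂n, i, hi⟩ := hn (fun p => c X₀ (e (leaf p)))
    have hX₀ : IsTreeAntichain (X₀ : Set (List Bool)) := by
      apply he.antichain
      intro s hs t ht hne hcomp
      simp only [Finset.coe_filter, mem_lev, Set.mem_ofPred_eq] at hs ht
      rcases hcomp with h | h
      · exact hne (h.eq_of_length (by omega))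
      · exact hne (h.eq_of_length (by omega)).symm
    refine ⟨i, e ∘ e₂, he.comp he₂, fun A hA hAk => ?_⟩
    have hleaf : ∀ s ∈ A.image e₂, (leaf s).length = n := by
      intro s hs
      obtain ⟨t, ht, rfl⟩ := Finset.mem_image.1 hs
      have := he₂n t (mem_lev.1 (hAk ht))
      simp only [leaf, List.length_append, List.length_replicate]
      omega
    have h1 := hpush (A.image e₂) (he₂.antichain hA) leaf (fun s hs =>
      ⟨List.prefix_append _ _, (hleaf s hs).le⟩)
    have h2 : i ∈ {i | ∃ X : Finset (List Bool), IsTreeAntichain (X : Set (List Bool)) ∧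
        (A.image e₂).image (e ∘ leaf) ⊆ X ∧
        ∀ s ∈ (A.image e₂).image (e ∘ leaf), c X s = i} := by
      refine ⟨X₀, hX₀, ?_, ?_⟩
      · intro s hs
        obtain ⟨t, ht, rfl⟩ := Finset.mem_image.1 hs
        exact Finset.mem_image_of_mem _ (by simp [hleaf t ht])
      · intro s hs
        obtain ⟨t, ht, rfl⟩ := Finset.mem_image.1 hs
        obtain ⟨q, hq, rfl⟩ := Finset.mem_image.1 ht
        exact hi q (mem_lev.1 (hAk hq))
    rw [← h1] at h2
    obtain ⟨X, hX, hAX, hc⟩ := h2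
    exact ⟨X, hX, by rwa [Finset.image_image] at hAX, fun s hs =>
      hc _ (Finset.mem_image_of_mem _ (Finset.mem_image_of_mem _ hs))⟩
  by_contra hcon
  push Not at hcon
  choose k hk using hcon
  cases nonempty_fintype κ
  obtain ⟨i, e, he, h⟩ := key (Finset.univ.sup k)
  obtain ⟨A, hA, hAk, hno⟩ := hk i e he
  obtain ⟨X, hX, hAX, hc⟩ := h A hA (hAk.trans (fun s hs => by
    rw [mem_lev] at hs ⊢
    exact hs.trans (Finset.le_sup (Finset.mem_univ i))))
  obtain ⟨s, hs, hne⟩ := hno X hX hAX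
  exact hne (hc s hs)

end Trees

/-! ### Uniformly definable predicates and compactness -/

section Elem

variable (L : FirstOrder.Language.{u, u}) {I : Type*} {C : I → Type u} [∀ i, L.Structure (C i)]
variable {α β γ : Type}

/-- `P` is defined by one first-order formula in all members of a family of structures. -/
def Elem (P : ∀ i, (α → C i) → Prop) : Prop :=
  ∃ φ : L.Formula α, ∀ i v, P i v ↔ φ.Realize v

/-- `t` is given by one term in all members of a family of structures. -/
def ElemT (t : ∀ i, (α → C i) → C i) : Prop :=
  ∃ τ : L.Term α, ∀ i v, t i v = τ.realize v

variable {L}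

theorem ElemT.var (a : α) : ElemT L (fun i (v : α → C i) => v a) :=
  ⟨Term.var a, fun _ _ => rfl⟩

theorem ElemT.func {n : ℕ} (f : L.Functions n) {t : Fin n → ∀ i, (α → C i) → C i}
    (h : ∀ k, ElemT L (t k)) :
    ElemT L (fun i v => Structure.funMap f (fun k => t k i v)) := by
  choose τ hτ using h
  exact ⟨Term.func f τ, fun i v => by simp [hτ]⟩

theorem ElemT.subst {t : ∀ i, (α → C i) → C i} (h : ElemT L t)
    {s : α → ∀ i, (β → C i) → C i} (hs : ∀ a, ElemT L (s a)) :
    ElemT L (fun i v => t i (fun a => s a i v)) := by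
  obtain ⟨τ, hτ⟩ := h
  choose σ hσ using hs
  exact ⟨τ.subst σ, fun i v => by simp [hτ, hσ]⟩

theorem ElemT.relabel {t : ∀ i, (α → C i) → C i} (h : ElemT L t) (f : α → β) :
    ElemT L (fun i v => t i (v ∘ f)) :=
  h.subst (fun a => ElemT.var (f a))

theorem Elem.of (φ : L.Formula α) : Elem L (fun i (v : α → C i) => φ.Realize v) :=
  ⟨φ, fun _ _ => Iff.rfl⟩

theorem Elem.congr {P Q : ∀ i, (α → C i) → Prop} (h : Elem L P) (hPQ : ∀ i v, Q i v ↔ P i v) :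
    Elem L Q := by
  obtain ⟨φ, hφ⟩ := h
  exact ⟨φ, fun i v => (hPQ i v).trans (hφ i v)⟩

theorem Elem.eq {s t : ∀ i, (α → C i) → C i} (hs : ElemT L s) (ht : ElemT L t) :
    Elem L (fun i v => s i v = t i v) := by
  obtain ⟨σ, hσ⟩ := hs
  obtain ⟨τ, hτ⟩ := ht
  exact ⟨σ.equal τ, fun i v => by simp [hσ, hτ]⟩

theorem Elem.rel {n : ℕ} (r : L.Relations n) {t : Fin n → ∀ i, (α → C i) → C i}
    (h : ∀ k, ElemT L (t k)) :
    Elem L (fun i v => Structure.RelMap r (fun k => t k i v)) := by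
  choose τ hτ using h
  exact ⟨r.formula τ, fun i v => by simp [hτ, Formula.realize_rel]⟩

theorem Elem.subst {P : ∀ i, (α → C i) → Prop} (h : Elem L P)
    {s : α → ∀ i, (β → C i) → C i} (hs : ∀ a, ElemT L (s a)) :
    Elem L (fun i v => P i (fun a => s a i v)) := by
  obtain ⟨φ, hφ⟩ := h
  choose σ hσ using hs
  refine ⟨BoundedFormula.subst φ σ, fun i v => ?_⟩
  refine (hφ i _).trans ?_
  simp only [hσ]
  exact BoundedFormula.realize_subst.symm

theorem Elem.relabel {P : ∀ i, (α → C i) → Prop} (h : Elem L P) (f : α → β) :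
    Elem L (fun i v => P i (v ∘ f)) :=
  h.subst (fun a => ElemT.var (f a))

theorem Elem.not {P : ∀ i, (α → C i) → Prop} (h : Elem L P) : Elem L (fun i v => ¬ P i v) := by
  obtain ⟨φ, hφ⟩ := h
  exact ⟨φ.not, fun i v => by simp [hφ]⟩

theorem Elem.imp {P Q : ∀ i, (α → C i) → Prop} (h : Elem L P) (h' : Elem L Q) :
    Elem L (fun i v => P i v → Q i v) := by
  obtain ⟨φ, hφ⟩ := h
  obtain ⟨ψ, hψ⟩ := h'
  exact ⟨φ.imp ψ, fun i v => by simp [hφ, hψ]⟩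

theorem Elem.and {P Q : ∀ i, (α → C i) → Prop} (h : Elem L P) (h' : Elem L Q) :
    Elem L (fun i v => P i v ∧ Q i v) :=
  (h.imp h'.not).not.congr (fun i v => by tauto)

theorem Elem.or {P Q : ∀ i, (α → C i) → Prop} (h : Elem L P) (h' : Elem L Q) :
    Elem L (fun i v => P i v ∨ Q i v) :=
  (h.not.imp h').congr (fun i v => by tauto)

theorem Elem.iff {P Q : ∀ i, (α → C i) → Prop} (h : Elem L P) (h' : Elem L Q) :
    Elem L (fun i v => P i v ↔ Q i v) :=
  ((h.imp h').and (h'.imp h)).congr (fun i v => by tauto)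

theorem Elem.const (p : Prop) : Elem L (fun i (_ : α → C i) => p) := by
  by_cases hp : p
  · exact ⟨⊤, fun i v => by simp [hp]⟩
  · exact ⟨⊥, fun i v => by simp [hp]⟩

theorem Elem.forall_mem {δ : Type*} (s : Finset δ) {P : δ → ∀ i, (α → C i) → Prop}
    (h : ∀ d ∈ s, Elem L (P d)) : Elem L (fun i v => ∀ d ∈ s, P d i v) := by
  classical
  induction s using Finset.induction_on with
  | empty => exact (Elem.const True).congr (by simp)
  | insert d s _ ih =>
    exact ((h d (by simp)).and (ih (fun d' hd' => h d' (by simp [hd'])))).congr (by simp)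

theorem Elem.exists_mem {δ : Type*} (s : Finset δ) {P : δ → ∀ i, (α → C i) → Prop}
    (h : ∀ d ∈ s, Elem L (P d)) : Elem L (fun i v => ∃ d ∈ s, P d i v) :=
  (Elem.forall_mem s (fun d hd => (h d hd).not)).not.congr (by simp)

theorem Elem.forall_fin {δ : Type*} [Finite δ] {P : δ → ∀ i, (α → C i) → Prop}
    (h : ∀ d, Elem L (P d)) : Elem L (fun i v => ∀ d, P d i v) := by
  cases nonempty_fintype δ
  exact (Elem.forall_mem Finset.univ (fun d _ => h d)).congr (by simp)

theorem Elem.exists_fin {δ : Type*} [Finite δ] {P : δ → ∀ i, (α → C i) → Prop}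
    (h : ∀ d, Elem L (P d)) : Elem L (fun i v => ∃ d, P d i v) := by
  cases nonempty_fintype δ
  exact (Elem.exists_mem Finset.univ (fun d _ => h d)).congr (by simp)

theorem Elem.ex [Finite β] {P : ∀ i, (α → C i) → (β → C i) → Prop}
    (h : Elem L (fun i (v : α ⊕ β → C i) => P i (v ∘ Sum.inl) (v ∘ Sum.inr))) :
    Elem L (fun i v => ∃ w, P i v w) := by
  obtain ⟨φ, hφ⟩ := h
  refine ⟨φ.iExs β, fun i v => ?_⟩
  rw [Formula.realize_iExs]
  exact exists_congr (fun w => hφ i (Sum.elim v w))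

theorem Elem.all [Finite β] {P : ∀ i, (α → C i) → (β → C i) → Prop}
    (h : Elem L (fun i (v : α ⊕ β → C i) => P i (v ∘ Sum.inl) (v ∘ Sum.inr))) :
    Elem L (fun i v => ∀ w, P i v w) := by
  have h' : Elem L (fun i (v : α ⊕ β → C i) => ¬ P i (v ∘ Sum.inl) (v ∘ Sum.inr)) := h.not
  exact (Elem.ex (P := fun i v w => ¬ P i v w) h').not.congr (by simp)

theorem Elem.ex1 {P : ∀ i, (α → C i) → C i → Prop}
    (h : Elem L (fun i (v : α ⊕ Unit → C i) => P i (v ∘ Sum.inl) (v (Sum.inr ())))) :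
    Elem L (fun i v => ∃ w, P i v w) :=
  (Elem.ex (β := Unit) (P := fun i v w => P i v (w ())) h).congr (fun i v =>
    ⟨fun ⟨w, hw⟩ => ⟨fun _ => w, hw⟩, fun ⟨w, hw⟩ => ⟨w (), hw⟩⟩)

theorem Elem.all1 {P : ∀ i, (α → C i) → C i → Prop}
    (h : Elem L (fun i (v : α ⊕ Unit → C i) => P i (v ∘ Sum.inl) (v (Sum.inr ())))) :
    Elem L (fun i v => ∀ w, P i v w) :=
  (Elem.all (β := Unit) (P := fun i v w => P i v (w ())) h).congr (fun i v =>
    ⟨fun h w => h (w ()), fun h w => h (fun _ => w)⟩)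

/-- There are `N` distinct elements with a uniformly definable property. -/
theorem Elem.many (N : ℕ) {P : ∀ i, (α → C i) → C i → Prop}
    (h : Elem L (fun i (v : α ⊕ Unit → C i) => P i (v ∘ Sum.inl) (v (Sum.inr ())))) :
    Elem L (fun i v => ∃ w : Fin N → C i, Function.Injective w ∧ ∀ k, P i v (w k)) := by
  refine Elem.ex ((?_ : Elem L _).and (Elem.forall_fin fun k => ?_))
  · have : Elem L (fun i (v : α ⊕ Fin N → C i) => ∀ j k : Fin N,
        v (Sum.inr j) = v (Sum.inr k) → j = k) :=
      Elem.forall_fin fun j => Elem.forall_fin fun k =>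
        (Elem.eq (ElemT.var _) (ElemT.var _)).imp (Elem.const _)
    exact this
  · exact (h.relabel (Sum.elim Sum.inl (fun _ => Sum.inr k)))

theorem Elem.realize_iff {P : ∀ i, (α → C i) → Prop} (h : Elem L P) {i j : I}
    (f : C i ↪ₑ[L] C j) (v : α → C i) : P j (f ∘ v) ↔ P i v := by
  obtain ⟨φ, hφ⟩ := h
  rw [hφ, hφ]
  exact f.map_formula φ v

theorem Elem.iff_of_equiv {P : ∀ i, (Empty → C i) → Prop} (h : Elem L P) {i j : I}
    (f : (L.completeTheory (C i)) = L.completeTheory (C j)) :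
    P i Empty.elim ↔ P j Empty.elim := by
  obtain ⟨φ, hφ⟩ := h
  rw [hφ, hφ]
  have : (φ : L.Sentence) ∈ L.completeTheory (C i) ↔ (φ : L.Sentence) ∈ L.completeTheory (C j) := by
    rw [f]
  rw [mem_completeTheory, mem_completeTheory] at this
  simp only [Sentence.Realize] at this
  convert this using 2

end Elem

section Compactness

variable {L : FirstOrder.Language.{u, u}} {α β : Type}

/-- The diagonal elementary embedding into an ultrapower. -/
noncomputable def diagEmb (M : Type u) [L.Structure M] [Nonempty M] {ι : Type u}
    (U : Ultrafilter ι) : M ↪ₑ[L] ((U : Filter ι).Product fun _ : ι => M) where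
  toFun x := ((fun _ => x : ι → M) : (U : Filter ι).Product fun _ : ι => M)
  map_formula' n φ x := by
    have := Ultraproduct.realize_formula_cast (u := U) (M := fun _ : ι => M) (φ := φ)
      (x := fun i _ => x i)
    refine Iff.trans ?_ (this.trans (by simp))
    rfl

theorem exists_elementary_extension (M : Type u) [L.Structure M] [Nonempty M] (e : β → M)
    (Δ : Set (L.Formula (β ⊕ α)))
    (h : ∀ s : Finset (L.Formula (β ⊕ α)), ↑s ⊆ Δ →
      ∃ v : α → M, ∀ φ ∈ s, φ.Realize (Sum.elim e v)) :
    ∃ (M' : Type u) (_ : L.Structure M') (_ : Nonempty M') (f : M ↪ₑ[L] M') (v : α → M'),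
      ∀ φ ∈ Δ, φ.Realize (Sum.elim (f ∘ e) v) := by
  classical
  let ι := Finset (L.Formula (β ⊕ α))
  let U : Ultrafilter ι := Ultrafilter.of Filter.atTop
  choose v hv using fun s : ι => h (s.filter (· ∈ Δ)) (by intro x hx; simp at hx; exact hx.2)
  refine ⟨(U : Filter ι).Product fun _ : ι => M, inferInstance, inferInstance, diagEmb M U,
    fun a => ((fun s => v s a : ι → M) : (U : Filter ι).Product fun _ : ι => M), fun φ hφ => ?_⟩
  have := Ultraproduct.realize_formula_cast (u := U) (M := fun _ : ι => M) (φ := φ)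
      (x := Sum.elim (fun b _ => e b) (fun a s => v s a))
  have h2 : (fun i => ((Sum.elim (fun b (_ : ι) => e b) (fun a s => v s a) i : ι → M) :
      (U : Filter ι).Product fun _ : ι => M)) = Sum.elim ((diagEmb (L := L) M U) ∘ e)
      (fun a => ((fun s => v s a : ι → M) : (U : Filter ι).Product fun _ : ι => M)) := by
    funext i
    cases i <;> rfl
  rw [← h2]
  refine this.2 ?_
  have h3 : ∀ᶠ s : ι in Filter.atTop, φ ∈ s := by
    filter_upwards [Filter.eventually_ge_atTop ({φ} : ι)] with s hs
    exact hs (Finset.mem_singleton_self φ)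
  filter_upwards [Ultrafilter.of_le _ h3] with s hs
  convert hv s φ (Finset.mem_filter.2 ⟨hs, hφ⟩) using 1
  funext i
  cases i <;> rfl

end Compactness

/-! ### The axioms of `T_G` are preserved under elementary equivalence -/

section Transfer

variable {𝔽 : Type u} [Field 𝔽] {L' : FirstOrder.Language.{u, u}}
variable (Rs : Subring 𝔽) (T : (fullLang 𝔽 L').Theory)

/-- The standing hypotheses on `T`. -/
structure TFacts : Prop where
  hee : EliminatesExInf T
  hvs : ∀ (N : Type u) [(fullLang 𝔽 L').Structure N], N ⊨ T →
    @VSAxioms 𝔽 N ((LHom.sumInl : vsLang 𝔽 →ᴸ fullLang 𝔽 L').reduct N) _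
  hacl : ∀ (N : Type u) [(fullLang 𝔽 L').Structure N], N ⊨ T →
    ∀ A : Set N, acl (fullLang 𝔽 L') N A =
      @vspan 𝔽 N ((LHom.sumInl : vsLang 𝔽 →ᴸ fullLang 𝔽 L').reduct N) A

variable {Rs T} {I : Type*} {C : I → Type u} [∀ i, (genLang 𝔽 L' ↥Rs).Structure (C i)]
variable {α β : Type}

theorem Elem.ofL (φ : (fullLang 𝔽 L').Formula α) : Elem (genLang 𝔽 L' ↥Rs)
    (fun i (v : α → C i) => @Formula.Realize _ (C i) (lOfLG 𝔽 L' ↥Rs (C i)) _ φ v) := by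
  refine ⟨(LHom.sumInl : fullLang 𝔽 L' →ᴸ genLang 𝔽 L' ↥Rs).onFormula φ, fun i v => ?_⟩
  let _ := lOfLG 𝔽 L' ↥Rs (C i)
  have : (LHom.sumInl : fullLang 𝔽 L' →ᴸ genLang 𝔽 L' ↥Rs).IsExpansionOn (C i) :=
    LHom.isExpansionOn_reduct _ _
  exact (LHom.realize_onFormula _ φ).symm

theorem ElemT.congr {L : FirstOrder.Language.{u, u}} {I : Type*} {C : I → Type u}
    [∀ i, L.Structure (C i)] {s t : ∀ i, (α → C i) → C i} (h : ElemT L s)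
    (hst : ∀ i v, t i v = s i v) : ElemT L t := by
  obtain ⟨τ, hτ⟩ := h
  exact ⟨τ, fun i v => (hst i v).trans (hτ i v)⟩

theorem ElemT.vzeroG : ElemT (genLang 𝔽 L' ↥Rs)
    (fun i (v : α → C i) => vzeroG 𝔽 L' ↥Rs (C i)) :=
  (ElemT.func (L := genLang 𝔽 L' ↥Rs) (Sum.inl (Sum.inl (vzeroSym 𝔽)))
    (t := fun k => k.elim0) (fun k => k.elim0)).congr (fun i v => by
      unfold NATPPaper.vzeroG vzero
      congr 1
      funext k
      exact k.elim0)

theorem ElemT.vaddG {s t : ∀ i, (α → C i) → C i} (hs : ElemT (genLang 𝔽 L' ↥Rs) s)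
    (ht : ElemT (genLang 𝔽 L' ↥Rs) t) : ElemT (genLang 𝔽 L' ↥Rs)
    (fun i (v : α → C i) => vaddG 𝔽 L' ↥Rs (C i) (s i v) (t i v)) :=
  (ElemT.func (L := genLang 𝔽 L' ↥Rs) (Sum.inl (Sum.inl (vaddSym 𝔽)))
    (t := ![s, t]) (fun k => by fin_cases k <;> assumption)).congr (fun i v => by
      unfold NATPPaper.vaddG vadd
      congr 1
      funext k
      fin_cases k <;> rfl)

theorem ElemT.vsmulG (c : 𝔽) {s : ∀ i, (α → C i) → C i} (hs : ElemT (genLang 𝔽 L' ↥Rs) s) :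
    ElemT (genLang 𝔽 L' ↥Rs) (fun i (v : α → C i) => vsmulG 𝔽 L' ↥Rs (C i) c (s i v)) :=
  (ElemT.func (L := genLang 𝔽 L' ↥Rs) (Sum.inl (Sum.inl (vsmulSym 𝔽 c)))
    (t := fun _ => s) (fun _ => hs)).congr (fun i v => by
      unfold NATPPaper.vsmulG vsmul
      congr 1
      funext k
      fin_cases k; rfl)

theorem ElemT.vsumG {n : ℕ} {s : Fin n → ∀ i, (α → C i) → C i}
    (hs : ∀ k, ElemT (genLang 𝔽 L' ↥Rs) (s k)) :
    ElemT (genLang 𝔽 L' ↥Rs) (fun i (v : α → C i) => vsumG 𝔽 L' ↥Rs (C i) (fun k => s k i v)) := by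
  induction n with
  | zero => exact ElemT.vzeroG
  | succ n ih => exact ElemT.vaddG (hs 0) (ih (fun k => hs k.succ))

theorem Elem.memGSet {s : ∀ i, (α → C i) → C i} (hs : ElemT (genLang 𝔽 L' ↥Rs) s) :
    Elem (genLang 𝔽 L' ↥Rs) (fun i (v : α → C i) => s i v ∈ GSet 𝔽 L' ↥Rs (C i)) :=
  (Elem.rel (L := genLang 𝔽 L' ↥Rs) (gSym 𝔽 L' ↥Rs) (t := fun _ => s) (fun _ => hs)).congr
    (fun i v => by
      unfold GSet
      rw [Set.mem_ofPred_eq]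
      have : ![s i v] = fun _ => s i v := by funext k; fin_cases k; rfl
      rw [this])

/-- `L_G`-structures in which `G` is a submodule. -/
structure SubmoduleStr (Rs : Subring 𝔽) (L' : FirstOrder.Language.{u, u}) where
  carrier : Type u
  str : (genLang 𝔽 L' ↥Rs).Structure carrier
  h0 : vzeroG 𝔽 L' ↥Rs carrier ∈ GSet 𝔽 L' ↥Rs carrier
  hadd : ∀ x ∈ GSet 𝔽 L' ↥Rs carrier, ∀ y ∈ GSet 𝔽 L' ↥Rs carrier,
    vaddG 𝔽 L' ↥Rs carrier x y ∈ GSet 𝔽 L' ↥Rs carrier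
  hsmul : ∀ r : Rs, ∀ x ∈ GSet 𝔽 L' ↥Rs carrier,
    vsmulG 𝔽 L' ↥Rs carrier (r : 𝔽) x ∈ GSet 𝔽 L' ↥Rs carrier

instance (i : SubmoduleStr Rs L') : (genLang 𝔽 L' ↥Rs).Structure i.carrier := i.str

instance (i : SubmoduleStr Rs L') : (vsLang ↥Rs).Structure ↥(GSet 𝔽 L' ↥Rs i.carrier) :=
  gStructure 𝔽 L' ↥Rs i.carrier Rs i.h0 i.hadd i.hsmul

theorem elemT_relativize (t : (vsLang ↥Rs).Term α) :
    ∃ τ : (genLang 𝔽 L' ↥Rs).Term α, ∀ (i : SubmoduleStr Rs L')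
      (v : α → ↥(GSet 𝔽 L' ↥Rs i.carrier)),
        ((t.realize v : ↥(GSet 𝔽 L' ↥Rs i.carrier)) : i.carrier) =
          τ.realize (fun a => ((v a : i.carrier))) := by
  induction t with
  | var a => exact ⟨Term.var a, fun _ _ => rfl⟩
  | @func n f ts ih =>
    choose τ hτ using ih
    match n, f, ts, τ, hτ with
    | 0, f, ts, τ, hτ =>
      obtain ⟨σ, hσ⟩ := ElemT.vzeroG (Rs := Rs) (L' := L') (C := fun i : SubmoduleStr Rs L' =>
        i.carrier) (α := α)
      exact ⟨σ, fun i v => (hσ i (fun a => (v a : i.carrier)))⟩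
    | 1, r, ts, τ, hτ =>
      obtain ⟨σ, hσ⟩ := ElemT.vsmulG (Rs := Rs) (L' := L') (C := fun i : SubmoduleStr Rs L' =>
        i.carrier) ((show ↥Rs from r) : 𝔽) (α := α) ⟨τ 0, fun _ _ => rfl⟩
      exact ⟨σ, fun i v => (congrArg (NATPPaper.vsmulG 𝔽 L' ↥Rs i.carrier
        ((show ↥Rs from r) : 𝔽)) (hτ 0 i v)).trans (hσ i (fun a => (v a : i.carrier)))⟩
    | 2, r, ts, τ, hτ =>
      obtain ⟨σ, hσ⟩ := ElemT.vaddG (Rs := Rs) (L' := L') (C := fun i : SubmoduleStr Rs L' =>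
        i.carrier) (α := α) ⟨τ 0, fun _ _ => rfl⟩ ⟨τ 1, fun _ _ => rfl⟩
      exact ⟨σ, fun i v => (congrArg₂ (NATPPaper.vaddG 𝔽 L' ↥Rs i.carrier) (hτ 0 i v)
        (hτ 1 i v)).trans (hσ i (fun a => (v a : i.carrier)))⟩
    | n + 3, f, _, _, _ => exact (show PEmpty from f).elim

/-- Relativization of module formulas to `G`. -/
theorem exists_relativize {n : ℕ} (θ : (vsLang ↥Rs).BoundedFormula α n) :
    ∃ φ : (genLang 𝔽 L' ↥Rs).Formula (α ⊕ Fin n), ∀ (i : SubmoduleStr Rs L')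
      (v : α → ↥(GSet 𝔽 L' ↥Rs i.carrier)) (w : Fin n → ↥(GSet 𝔽 L' ↥Rs i.carrier)),
      θ.Realize v w ↔ φ.Realize (Sum.elim (fun a => (v a : i.carrier)) (fun k => w k)) := by
  have hcoe : ∀ {n : ℕ} (i : SubmoduleStr Rs L')
      (v : α → ↥(GSet 𝔽 L' ↥Rs i.carrier)) (w : Fin n → ↥(GSet 𝔽 L' ↥Rs i.carrier)),
      (fun a => ((Sum.elim v w a : ↥(GSet 𝔽 L' ↥Rs i.carrier)) : i.carrier)) =
        Sum.elim (fun a => (v a : i.carrier)) (fun k => w k) := by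
    intro n i v w; funext a; cases a <;> rfl
  induction θ with
  | falsum => exact ⟨⊥, fun _ _ _ => Iff.rfl⟩
  | equal t₁ t₂ =>
    obtain ⟨τ₁, h₁⟩ := elemT_relativize (L' := L') t₁
    obtain ⟨τ₂, h₂⟩ := elemT_relativize (L' := L') t₂
    refine ⟨τ₁.equal τ₂, fun i v w => ?_⟩
    rw [Formula.realize_equal, ← hcoe, ← h₁, ← h₂]
    exact Subtype.ext_iff
  | rel R ts => exact (show PEmpty from R).elim
  | imp f₁ f₂ ih₁ ih₂ =>
    obtain ⟨φ₁, h₁⟩ := ih₁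
    obtain ⟨φ₂, h₂⟩ := ih₂
    exact ⟨φ₁.imp φ₂, fun i v w => by
      rw [Formula.realize_imp, ← h₁, ← h₂]; exact Iff.rfl⟩
  | @all n f ih =>
    obtain ⟨φ, h⟩ := ih
    have hE : Elem (genLang 𝔽 L' ↥Rs) (fun (i : SubmoduleStr Rs L')
        (v : α ⊕ Fin n → i.carrier) => ∀ x, x ∈ GSet 𝔽 L' ↥Rs i.carrier →
          φ.Realize (Sum.elim (v ∘ Sum.inl) (Fin.snoc (v ∘ Sum.inr) x))) := by
      refine Elem.all1 ((Elem.memGSet (ElemT.var _)).imp ?_)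
      refine ((Elem.of φ).relabel (Sum.elim (Sum.inl ∘ Sum.inl)
        (Fin.snoc (Sum.inl ∘ Sum.inr) (Sum.inr ())))).congr (fun i v => ?_)
      refine iff_of_eq (congrArg _ ?_)
      funext a
      rcases a with a | k
      · rfl
      · refine Fin.lastCases ?_ (fun k => ?_) k <;> simp
    obtain ⟨ψ, hψ⟩ := hE
    refine ⟨ψ, fun i v w => ?_⟩
    refine Iff.trans ?_ (hψ i _)
    refine BoundedFormula.realize_all.trans ?_
    have hsn : ∀ x : ↥(GSet 𝔽 L' ↥Rs i.carrier), (fun k => ((Fin.snoc w x :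
        Fin (n + 1) → ↥(GSet 𝔽 L' ↥Rs i.carrier)) k : i.carrier)) =
        Fin.snoc (fun k => (w k : i.carrier)) (x : i.carrier) := by
      intro x; funext k
      refine Fin.lastCases ?_ (fun k => ?_) k <;> simp
    refine ⟨fun H x hx => ?_, fun H x => ?_⟩
    · have := (h i v _).1 (H ⟨x, hx⟩)
      rw [hsn] at this
      exact this
    · refine (h i v _).2 ?_
      rw [hsn]
      exact H x x.2

theorem exists_injective_of_infinite {M : Type*} {S : Set M} (h : S.Infinite) (N : ℕ) :
    ∃ w : Fin N → M, Function.Injective w ∧ ∀ k, w k ∈ S :=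
  ⟨fun k => h.natEmbedding S k, fun i j hij => Fin.ext
    ((h.natEmbedding S).injective (Subtype.ext hij)), fun k => (h.natEmbedding S k).2⟩

theorem finite_ncard_le_iff {M : Type*} {S : Set M} (n : ℕ) :
    (S.Finite ∧ S.ncard ≤ n) ↔ ¬ ∃ w : Fin (n + 1) → M, Function.Injective w ∧ ∀ k, w k ∈ S := by
  constructor
  · rintro ⟨hf, hn⟩ ⟨w, hw, hS⟩
    have h1 := Set.ncard_le_ncard (Set.range_subset_iff.2 hS) hf
    rw [Set.ncard_range_of_injective hw] at h1
    simp at h1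
    omega
  · intro h
    have hf : S.Finite := by
      by_contra hf
      exact h (exists_injective_of_infinite hf _)
    refine ⟨hf, ?_⟩
    by_contra hn
    push Not at hn
    apply h
    have h2 : n + 1 ≤ hf.toFinset.card := by rw [← Set.ncard_eq_toFinset_card S hf]; exact hn
    obtain ⟨t, ht, htc⟩ := Finset.exists_subset_card_eq h2
    exact ⟨fun k => (t.equivFin.symm (Fin.cast htc.symm k)), fun i j hij => by
      simpa using hij, fun k => by
      have := ht (t.equivFin.symm (Fin.cast htc.symm k)).2
      simpa using this⟩

theorem EliminatesExInf.exists_many_iff {L : FirstOrder.Language.{u, u}} {T : L.Theory}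
    (hT : EliminatesExInf T) {k : ℕ} (φ : L.Formula (Fin 1 ⊕ Fin k)) :
    ∃ N : ℕ, ∀ (M : Type u) [L.Structure M] [Nonempty M], M ⊨ T → ∀ c : Fin k → M,
      ((∃ w : Fin N → M, Function.Injective w ∧ ∀ i, φ.Realize (Sum.elim (fun _ => w i) c)) ↔
        {x : M | φ.Realize (Sum.elim (fun _ => x) c)}.Infinite) := by
  obtain ⟨N, hN⟩ := hT k φ
  refine ⟨N, fun M _ _ hM c => ⟨fun ⟨w, hw, h⟩ => ?_, fun h => ?_⟩⟩
  · refine hN (Theory.ModelType.of T M) c ⟨Finset.univ.map ⟨w, hw⟩, by simp, ?_⟩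
    intro x hx
    obtain ⟨i, -, rfl⟩ := Finset.mem_map.1 hx
    exact h i
  · exact exists_injective_of_infinite h N

/-- Being a model of `T_G` is preserved under elementary equivalence. -/
theorem IsTGModel.of_completeTheory_eq (hT : TFacts T) {M M' : Type u}
    [hM : (genLang 𝔽 L' ↥Rs).Structure M] [hM' : (genLang 𝔽 L' ↥Rs).Structure M']
    (h : IsTGModel Rs T M)
    (he : (genLang 𝔽 L' ↥Rs).completeTheory M = (genLang 𝔽 L' ↥Rs).completeTheory M') :
    IsTGModel Rs T M' := by
  let C : Bool → Type u := fun b => if b then M' else M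
  let sC : ∀ b, (genLang 𝔽 L' ↥Rs).Structure (C b) := fun b => by
    cases b
    · exact hM
    · exact hM'
  have htr : ∀ {P : ∀ b, (Empty → C b) → Prop}, Elem (genLang 𝔽 L' ↥Rs) P →
      P false Empty.elim → P true Empty.elim := fun hP =>
    (Elem.iff_of_equiv (i := false) (j := true) hP he).1
  have modelsT : @Theory.Model (fullLang 𝔽 L') M' (lOfLG 𝔽 L' ↥Rs M') T := by
    let _ := lOfLG 𝔽 L' ↥Rs M
    let _ := lOfLG 𝔽 L' ↥Rs M'
    have h1 : M ⊨ T := h.modelsT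
    refine (Theory.model_iff T).2 fun φ hφ => ?_
    have := htr (Elem.ofL (C := C) φ) (by
      exact (iff_of_eq (congrArg (@Formula.Realize _ M (lOfLG 𝔽 L' ↥Rs M) _ φ) (Subsingleton.elim _ _))).1
        ((Theory.model_iff T).1 h1 φ hφ))
    exact (iff_of_eq (congrArg (Formula.Realize φ) (Subsingleton.elim _ _))).1 this
  have h0 : vzeroG 𝔽 L' ↥Rs M' ∈ GSet 𝔽 L' ↥Rs M' :=
    htr (P := fun b _ => vzeroG 𝔽 L' ↥Rs (C b) ∈ GSet 𝔽 L' ↥Rs (C b))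
      (Elem.memGSet ElemT.vzeroG) h.h0
  have hadd : ∀ x ∈ GSet 𝔽 L' ↥Rs M', ∀ y ∈ GSet 𝔽 L' ↥Rs M',
      vaddG 𝔽 L' ↥Rs M' x y ∈ GSet 𝔽 L' ↥Rs M' := by
    refine htr (P := fun b _ => ∀ x ∈ GSet 𝔽 L' ↥Rs (C b), ∀ y ∈ GSet 𝔽 L' ↥Rs (C b),
      vaddG 𝔽 L' ↥Rs (C b) x y ∈ GSet 𝔽 L' ↥Rs (C b)) ?_ h.hadd
    refine Elem.all1 ((Elem.memGSet (ElemT.var _)).imp (Elem.all1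
      ((Elem.memGSet (ElemT.var _)).imp (Elem.memGSet (ElemT.vaddG ?_ (ElemT.var _))))))
    exact ElemT.var (Sum.inl (Sum.inr ()))
  have hsmul : ∀ r : Rs, ∀ x ∈ GSet 𝔽 L' ↥Rs M',
      vsmulG 𝔽 L' ↥Rs M' (r : 𝔽) x ∈ GSet 𝔽 L' ↥Rs M' := by
    intro r
    refine htr (P := fun b _ => ∀ x ∈ GSet 𝔽 L' ↥Rs (C b),
      vsmulG 𝔽 L' ↥Rs (C b) r x ∈ GSet 𝔽 L' ↥Rs (C b)) ?_ (h.hsmul r)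
    exact Elem.all1 ((Elem.memGSet (ElemT.var _)).imp
      (Elem.memGSet (ElemT.vsmulG _ (ElemT.var _))))
  have : Nonempty M := ⟨vzeroG 𝔽 L' ↥Rs M⟩
  have : Nonempty M' := ⟨vzeroG 𝔽 L' ↥Rs M'⟩
  refine ⟨modelsT, h0, hadd, hsmul, ?_, ?_, ?_, ?_⟩
  · intro n θ
    obtain ⟨φ, hφ⟩ := exists_relativize (L' := L') θ
    have key : ∀ (i : SubmoduleStr Rs L') (v : Fin n → i.carrier),
        (∃ hv : ∀ k, v k ∈ GSet 𝔽 L' ↥Rs i.carrier,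
          BoundedFormula.Realize θ
            (fun k => (⟨v k, hv k⟩ : ↥(GSet 𝔽 L' ↥Rs i.carrier))) default) ↔
        (∀ k, v k ∈ GSet 𝔽 L' ↥Rs i.carrier) ∧ φ.Realize (Sum.elim v Fin.elim0) := by
      intro i v
      have : ∀ hv : ∀ k, v k ∈ GSet 𝔽 L' ↥Rs i.carrier,
          BoundedFormula.Realize θ
            (fun k => (⟨v k, hv k⟩ : ↥(GSet 𝔽 L' ↥Rs i.carrier))) default ↔
            φ.Realize (Sum.elim v Fin.elim0) := by
        intro hv
        rw [hφ]
        refine iff_of_eq (congrArg _ ?_)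
        congr 1
        funext k
        exact k.elim0
      exact ⟨fun ⟨hv, h⟩ => ⟨hv, (this hv).1 h⟩, fun ⟨hv, h⟩ => ⟨hv, (this hv).2 h⟩⟩
    have hE : Elem (genLang 𝔽 L' ↥Rs) (fun b (_ : Empty → C b) => ∀ v : Fin n → C b,
        Structure.RelMap (pSym 𝔽 L' ↥Rs θ) v ↔
          (∀ k, v k ∈ GSet 𝔽 L' ↥Rs (C b)) ∧ φ.Realize (Sum.elim v Fin.elim0)) := by
      refine Elem.all (Elem.iff (Elem.rel (L := genLang 𝔽 L' ↥Rs) _ fun k => ElemT.var _)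
        ((Elem.forall_fin fun k => Elem.memGSet (ElemT.var _)).and ?_))
      refine ((Elem.of φ).relabel (Sum.elim Sum.inr Fin.elim0)).congr (fun b v => ?_)
      refine iff_of_eq (congrArg _ ?_)
      funext k
      rcases k with k | k
      · rfl
      · exact k.elim0
    have h1 := htr hE (fun v => (h.p_iff n θ v).trans
      (key ⟨M, hM, h.h0, h.hadd, h.hsmul⟩ v))
    exact fun v => (h1 v).trans (key ⟨M', hM', h0, hadd, hsmul⟩ v).symm
  · intro n lam hlam
    refine htr (P := fun b _ => ∀ g : Fin n → C b, (∀ i, g i ∈ GSet 𝔽 L' ↥Rs (C b)) →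
      vsumG 𝔽 L' ↥Rs (C b) (fun i => vsmulG 𝔽 L' ↥Rs (C b) (lam i) (g i)) =
        vzeroG 𝔽 L' ↥Rs (C b) → ∀ i, g i = vzeroG 𝔽 L' ↥Rs (C b)) ?_ (h.axiomB n lam hlam)
    refine Elem.all ((Elem.forall_fin fun k => Elem.memGSet (ElemT.var _)).imp
      ((Elem.eq (ElemT.vsumG fun k => ElemT.vsmulG _ (ElemT.var _)) ElemT.vzeroG).imp
        (Elem.forall_fin fun k => Elem.eq (ElemT.var _) ElemT.vzeroG)))
  · intro r hr hr0 k φ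
    obtain ⟨N, hN⟩ := hT.hee.exists_many_iff φ
    have hE : Elem (genLang 𝔽 L' ↥Rs) (fun b (_ : Empty → C b) => ∀ c : Fin k → C b,
        (∃ w : Fin N → C b, Function.Injective w ∧ ∀ i, @Formula.Realize _ (C b)
          (lOfLG 𝔽 L' ↥Rs (C b)) _ φ (Sum.elim (fun _ => w i) c)) →
        ∃ g, g ∈ GSet 𝔽 L' ↥Rs (C b) ∧ @Formula.Realize _ (C b) (lOfLG 𝔽 L' ↥Rs (C b)) _ φ
          (Sum.elim (fun _ => vsmulG 𝔽 L' ↥Rs (C b) r g) c)) := by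
      refine Elem.all (Elem.imp ?_ (Elem.ex1 (Elem.and
        (Elem.memGSet (ElemT.var _)) ?_)))
      · refine Elem.many N (P := fun b v x => @Formula.Realize _ (C b)
          (lOfLG 𝔽 L' ↥Rs (C b)) _ φ (Sum.elim (fun _ => x) (v ∘ Sum.inr))) ?_
        refine ((Elem.ofL φ).relabel (Sum.elim (fun _ => Sum.inr ())
          (fun i => Sum.inl (Sum.inr i)))).congr (fun b v => iff_of_eq (congrArg _ ?_))
        funext a; cases a <;> rfl
      · refine ((Elem.ofL φ).subst (s := Sum.elim (fun _ b v => vsmulG 𝔽 L' ↥Rs (C b) r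
          (v (Sum.inr ()))) (fun i b v => v (Sum.inl (Sum.inr i)))) ?_).congr
            (fun b v => iff_of_eq (congrArg _ ?_))
        · rintro (a | a)
          · exact ElemT.vsmulG _ (ElemT.var _)
          · exact ElemT.var _
        · funext a; cases a <;> rfl
    have h1 := htr hE (fun c hc => h.axiomC r hr hr0 k φ c
      ((@hN M (lOfLG 𝔽 L' ↥Rs M) _ h.modelsT c).1 hc))
    exact fun c hc => h1 c ((@hN M' (lOfLG 𝔽 L' ↥Rs M') _ modelsT c).2 hc)
  · intro k l φ ψ nn hnn
    obtain ⟨N, hN⟩ := hT.hee.exists_many_iff φ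
    have hE : Elem (genLang 𝔽 L' ↥Rs) (fun b (_ : Empty → C b) => ∀ d : Fin k → C b,
        (∃ w : Fin N → C b, Function.Injective w ∧ ∀ i, @Formula.Realize _ (C b)
          (lOfLG 𝔽 L' ↥Rs (C b)) _ φ (Sum.elim (fun _ => w i) d)) →
        (∀ c : Fin l → C b, ¬ ∃ w : Fin (nn + 1) → C b, Function.Injective w ∧
          ∀ i, @Formula.Realize _ (C b) (lOfLG 𝔽 L' ↥Rs (C b)) _ ψ
            (Sum.elim (fun _ => w i) (Sum.elim d c))) →
        ∃ x, @Formula.Realize _ (C b) (lOfLG 𝔽 L' ↥Rs (C b)) _ φ (Sum.elim (fun _ => x) d) ∧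
          ∀ c : Fin l → C b, (∀ i, c i ∈ GSet 𝔽 L' ↥Rs (C b)) →
            ¬ @Formula.Realize _ (C b) (lOfLG 𝔽 L' ↥Rs (C b)) _ ψ
              (Sum.elim (fun _ => x) (Sum.elim d c))) := by
      refine Elem.all (Elem.imp ?_ (Elem.imp (Elem.all (Elem.not ?_)) (Elem.ex1 (Elem.and ?_ (Elem.all (Elem.imp
          (Elem.forall_fin fun i => Elem.memGSet (ElemT.var _)) (Elem.not ?_)))))))
      · refine Elem.many N (P := fun b v x => @Formula.Realize _ (C b)
          (lOfLG 𝔽 L' ↥Rs (C b)) _ φ (Sum.elim (fun _ => x) (v ∘ Sum.inr))) ?_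
        refine ((Elem.ofL φ).relabel (Sum.elim (fun _ => Sum.inr ())
          (fun i => Sum.inl (Sum.inr i)))).congr (fun b v => iff_of_eq (congrArg _ ?_))
        funext a; cases a <;> rfl
      · refine Elem.many (nn + 1) (P := fun b v x => @Formula.Realize _ (C b)
          (lOfLG 𝔽 L' ↥Rs (C b)) _ ψ (Sum.elim (fun _ => x)
            (Sum.elim (v ∘ Sum.inl ∘ Sum.inr) (v ∘ Sum.inr)))) ?_
        refine ((Elem.ofL ψ).relabel (Sum.elim (fun _ => Sum.inr ())
          (Sum.elim (fun i => Sum.inl (Sum.inl (Sum.inr i))) (fun i => Sum.inl (Sum.inr i))))).congr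
            (fun b v => iff_of_eq (congrArg _ ?_))
        funext a; rcases a with a | a | a <;> rfl
      · refine ((Elem.ofL φ).relabel (Sum.elim (fun _ => Sum.inr ())
          (fun i => Sum.inl (Sum.inr i)))).congr (fun b v => iff_of_eq (congrArg _ ?_))
        funext a; cases a <;> rfl
      · refine ((Elem.ofL ψ).relabel (Sum.elim (fun _ => Sum.inl (Sum.inr ()))
          (Sum.elim (fun i => Sum.inl (Sum.inl (Sum.inr i))) (fun i => Sum.inr i)))).congr
            (fun b v => iff_of_eq (congrArg _ ?_))
        funext a; rcases a with a | a | a <;> rfl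
    have h1 := htr hE (fun d hd hc => h.axiomD k l φ ψ nn hnn d
      ((@hN M (lOfLG 𝔽 L' ↥Rs M) _ h.modelsT d).1 hd) (fun c => finite_ncard_le_iff _ |>.2 (hc c)))
    exact fun d hd hc => h1 d ((@hN M' (lOfLG 𝔽 L' ↥Rs M') _ modelsT d).2 hd)
      (fun c => finite_ncard_le_iff _ |>.1 (hc c))

end Transfer

/-! ### Models of `T_G` -/

section Models

variable {𝔽 : Type u} [Field 𝔽] {L' : FirstOrder.Language.{u, u}}

/-- Bundled models of `T_G`, for `T` satisfying the standing hypotheses. -/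
structure TGMod (Rs : Subring 𝔽) (T : (fullLang 𝔽 L').Theory) where
  carrier : Type u
  str : (genLang 𝔽 L' ↥Rs).Structure carrier
  facts : TFacts T
  isTG : IsTGModel Rs T carrier

namespace TGMod

variable {Rs : Subring 𝔽} {T : (fullLang 𝔽 L').Theory}

instance : CoeSort (TGMod Rs T) (Type u) := ⟨TGMod.carrier⟩

variable (N : TGMod Rs T)

instance : (genLang 𝔽 L' ↥Rs).Structure N.carrier := N.str

instance instL : (fullLang 𝔽 L').Structure N.carrier := lOfLG 𝔽 L' ↥Rs N.carrier

theorem models : N.carrier ⊨ T := N.isTG.modelsT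

theorem vs : @VSAxioms 𝔽 N.carrier (vsOfLG 𝔽 L' ↥Rs N.carrier) _ :=
  N.facts.hvs N.carrier N.models

instance : Add N.carrier := ⟨vaddG 𝔽 L' ↥Rs N.carrier⟩

instance : Zero N.carrier := ⟨vzeroG 𝔽 L' ↥Rs N.carrier⟩

instance : Neg N.carrier := ⟨vsmulG 𝔽 L' ↥Rs N.carrier (-1)⟩

instance : AddCommGroup N.carrier where
  add_assoc := N.vs.2.1
  add_comm := N.vs.1
  add_zero := N.vs.2.2.1
  zero_add x := (N.vs.1 _ _).trans (N.vs.2.2.1 x)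
  neg_add_cancel x := (N.vs.1 _ _).trans (N.vs.2.2.2.1 x)
  nsmul := nsmulRec
  zsmul := zsmulRec

theorem add_def (x y : N.carrier) : x + y = vaddG 𝔽 L' ↥Rs N.carrier x y := rfl

theorem zero_def : (0 : N.carrier) = vzeroG 𝔽 L' ↥Rs N.carrier := rfl

instance : Module 𝔽 N.carrier where
  smul c x := vsmulG 𝔽 L' ↥Rs N.carrier c x
  one_smul := N.vs.2.2.2.2.1
  mul_smul c d x := (N.vs.2.2.2.2.2.1 c d x).symm
  smul_add := N.vs.2.2.2.2.2.2.2
  add_smul := N.vs.2.2.2.2.2.2.1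
  smul_zero c := by
    have h : vsmulG 𝔽 L' ↥Rs N.carrier c (0 + 0) = vsmulG 𝔽 L' ↥Rs N.carrier c 0 +
      vsmulG 𝔽 L' ↥Rs N.carrier c 0 := N.vs.2.2.2.2.2.2.2 c 0 0
    rw [add_zero] at h
    exact left_eq_add.1 h
  zero_smul x := by
    have h : vsmulG 𝔽 L' ↥Rs N.carrier (0 + 0) x = vsmulG 𝔽 L' ↥Rs N.carrier 0 x +
      vsmulG 𝔽 L' ↥Rs N.carrier 0 x := N.vs.2.2.2.2.2.2.1 0 0 x
    rw [add_zero] at h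
    exact left_eq_add.1 h

theorem smul_def (c : 𝔽) (x : N.carrier) : c • x = vsmulG 𝔽 L' ↥Rs N.carrier c x := rfl

theorem vsumG_eq {n : ℕ} (g : Fin n → N.carrier) : vsumG 𝔽 L' ↥Rs N.carrier g = ∑ i, g i := by
  induction n with
  | zero => rfl
  | succ n ih =>
    rw [Fin.sum_univ_succ, ← show _ = ∑ i : Fin n, g i.succ from ih (g ∘ Fin.succ)]
    rfl

/-- The generic submodule. -/
def G : Submodule ↥Rs N.carrier where
  carrier := GSet 𝔽 L' ↥Rs N.carrier
  zero_mem' := N.isTG.h0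
  add_mem' {x y} hx hy := N.isTG.hadd x hx y hy
  smul_mem' r x hx := N.isTG.hsmul r x hx

instance : (vsLang ↥Rs).Structure ↥N.G where
  funMap {n} f w :=
    match n, f, w with
    | 0, _, _ => 0
    | 1, r, w => (show ↥Rs from r) • w 0
    | 2, _, w => w 0 + w 1
    | _ + 3, f, _ => (show PEmpty from f).elim
  RelMap {n} r _ := (show PEmpty from r).elim

theorem p_iff {n : ℕ} (θ : (vsLang ↥Rs).Formula (Fin n)) (v : Fin n → N.carrier) :
    Structure.RelMap (pSym 𝔽 L' ↥Rs θ) v ↔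
      ∃ hv : ∀ i, v i ∈ N.G, θ.Realize (fun i => (⟨v i, hv i⟩ : ↥N.G)) := by
  rw [N.isTG.p_iff n θ v]
  let _ : (vsLang ↥Rs).Structure ↥(GSet 𝔽 L' ↥Rs N.carrier) :=
    gStructure 𝔽 L' ↥Rs N.carrier Rs N.isTG.h0 N.isTG.hadd N.isTG.hsmul
  let E : ↥(GSet 𝔽 L' ↥Rs N.carrier) ≃[vsLang ↥Rs] ↥N.G :=
    { toFun := fun x => ⟨x.1, x.2⟩
      invFun := fun x => ⟨x.1, x.2⟩
      left_inv := fun _ => rfl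
      right_inv := fun _ => rfl
      map_fun' := fun {n} f w => by
        match n, f, w with
        | 0, _, _ => rfl
        | 1, r, w => rfl
        | 2, _, w => rfl
        | n + 3, f, _ => exact (show PEmpty from f).elim
      map_rel' := fun {n} r _ => (show PEmpty from r).elim }
  exact exists_congr fun hv => (StrongHomClass.realize_formula E θ
    (v := fun i => (⟨v i, hv i⟩ : ↥(GSet 𝔽 L' ↥Rs N.carrier)))).symm

end TGMod

variable {Rs : Subring 𝔽} {T : (fullLang 𝔽 L').Theory} {α β γ : Type}

/-- Uniform definability by `L_G`-formulas in models of `T_G`. -/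
abbrev DefG (P : ∀ N : TGMod Rs T, (α → N.carrier) → Prop) : Prop :=
  Elem (genLang 𝔽 L' ↥Rs) (C := fun N : TGMod Rs T => N.carrier) P

/-- Uniform definability by `L`-formulas in models of `T_G`. -/
abbrev DefL (P : ∀ N : TGMod Rs T, (α → N.carrier) → Prop) : Prop :=
  Elem (fullLang 𝔽 L') (C := fun N : TGMod Rs T => N.carrier) P

/-- Uniform definability by module formulas in the generic submodule. -/
abbrev DefR (P : ∀ N : TGMod Rs T, (α → ↥N.G) → Prop) : Prop :=
  Elem (vsLang ↥Rs) (C := fun N : TGMod Rs T => ↥N.G) P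

/-- Uniform `L`-terms. -/
abbrev TermL (t : ∀ N : TGMod Rs T, (α → N.carrier) → N.carrier) : Prop :=
  ElemT (fullLang 𝔽 L') (C := fun N : TGMod Rs T => N.carrier) t

/-- Uniform `L_G`-terms. -/
abbrev TermG (t : ∀ N : TGMod Rs T, (α → N.carrier) → N.carrier) : Prop :=
  ElemT (genLang 𝔽 L' ↥Rs) (C := fun N : TGMod Rs T => N.carrier) t

/-- Uniform module terms. -/
abbrev TermR (t : ∀ N : TGMod Rs T, (α → ↥N.G) → ↥N.G) : Prop :=
  ElemT (vsLang ↥Rs) (C := fun N : TGMod Rs T => ↥N.G) t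

theorem TermL.zero : TermL (fun (N : TGMod Rs T) (v : α → N.carrier) => 0) :=
  (ElemT.func (L := fullLang 𝔽 L') (Sum.inl (vzeroSym 𝔽))
    (t := fun k => k.elim0) (fun k => k.elim0)).congr (fun i v => by
      rw [TGMod.zero_def]
      unfold vzeroG vzero
      congr 1
      funext k
      exact k.elim0)

theorem TermL.add {s t : ∀ N : TGMod Rs T, (α → N.carrier) → N.carrier} (hs : TermL s)
    (ht : TermL t) : TermL (fun N v => s N v + t N v) :=
  (ElemT.func (L := fullLang 𝔽 L') (Sum.inl (vaddSym 𝔽))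
    (t := ![s, t]) (fun k => by fin_cases k <;> assumption)).congr (fun i v => by
      rw [TGMod.add_def]
      unfold NATPPaper.vaddG vadd
      congr 1
      funext k
      fin_cases k <;> rfl)

theorem TermL.smul (c : 𝔽) {s : ∀ N : TGMod Rs T, (α → N.carrier) → N.carrier} (hs : TermL s) :
    TermL (fun N v => c • s N v) :=
  (ElemT.func (L := fullLang 𝔽 L') (Sum.inl (vsmulSym 𝔽 c))
    (t := fun _ => s) (fun _ => hs)).congr (fun i v => by
      rw [TGMod.smul_def]
      unfold NATPPaper.vsmulG vsmul
      congr 1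
      funext k
      fin_cases k; rfl)

theorem TermL.neg {s : ∀ N : TGMod Rs T, (α → N.carrier) → N.carrier} (hs : TermL s) :
    TermL (fun N v => - s N v) :=
  (TermL.smul (-1) hs).congr (fun N v => by simp)

theorem TermL.sub {s t : ∀ N : TGMod Rs T, (α → N.carrier) → N.carrier} (hs : TermL s)
    (ht : TermL t) : TermL (fun N v => s N v - t N v) :=
  (hs.add ht.neg).congr (fun N v => sub_eq_add_neg _ _)

theorem TermL.sum {δ : Type*} (s : Finset δ) {t : δ → ∀ N : TGMod Rs T,
    (α → N.carrier) → N.carrier} (ht : ∀ d, TermL (t d)) :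
    TermL (fun N v => ∑ d ∈ s, t d N v) := by
  classical
  induction s using Finset.induction_on with
  | empty => exact TermL.zero.congr (by simp)
  | insert d s hd ih => exact ((ht d).add ih).congr (fun N v => Finset.sum_insert hd)

theorem TermR.zero : TermR (fun (N : TGMod Rs T) (v : α → ↥N.G) => 0) :=
  (ElemT.func (L := vsLang ↥Rs) (vzeroSym ↥Rs)
    (t := fun k => k.elim0) (fun k => k.elim0)).congr (fun i v => rfl)

theorem TermR.add {s t : ∀ N : TGMod Rs T, (α → ↥N.G) → ↥N.G} (hs : TermR s)
    (ht : TermR t) : TermR (fun N v => s N v + t N v) :=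
  (ElemT.func (L := vsLang ↥Rs) (vaddSym ↥Rs)
    (t := ![s, t]) (fun k => by fin_cases k <;> assumption)).congr (fun i v => rfl)

theorem TermR.smul (c : ↥Rs) {s : ∀ N : TGMod Rs T, (α → ↥N.G) → ↥N.G} (hs : TermR s) :
    TermR (fun N v => c • s N v) :=
  (ElemT.func (L := vsLang ↥Rs) (vsmulSym ↥Rs c)
    (t := fun _ => s) (fun _ => hs)).congr (fun i v => rfl)

theorem TermR.neg {s : ∀ N : TGMod Rs T, (α → ↥N.G) → ↥N.G} (hs : TermR s) :
    TermR (fun N v => - s N v) :=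
  (TermR.smul (-1) hs).congr (fun N v => (neg_one_smul _ _).symm)

theorem TermR.sub {s t : ∀ N : TGMod Rs T, (α → ↥N.G) → ↥N.G} (hs : TermR s)
    (ht : TermR t) : TermR (fun N v => s N v - t N v) :=
  (hs.add ht.neg).congr (fun N v => sub_eq_add_neg _ _)

theorem TermR.sum {δ : Type*} (s : Finset δ) {t : δ → ∀ N : TGMod Rs T,
    (α → ↥N.G) → ↥N.G} (ht : ∀ d, TermR (t d)) :
    TermR (fun N v => ∑ d ∈ s, t d N v) := by
  classical
  induction s using Finset.induction_on with
  | empty => exact TermR.zero.congr (by simp)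
  | insert d s hd ih => exact ((ht d).add ih).congr (fun N v => Finset.sum_insert hd)

theorem DefL.toG {P : ∀ N : TGMod Rs T, (α → N.carrier) → Prop} (h : DefL P) : DefG P := by
  obtain ⟨φ, hφ⟩ := h
  exact (Elem.ofL (Rs := Rs) (C := fun N : TGMod Rs T => N.carrier) φ).congr hφ

theorem TermL.toG {t : ∀ N : TGMod Rs T, (α → N.carrier) → N.carrier} (h : TermL t) :
    TermG t := by
  obtain ⟨τ, hτ⟩ := h
  refine ⟨(LHom.sumInl : fullLang 𝔽 L' →ᴸ genLang 𝔽 L' ↥Rs).onTerm τ, fun N v => ?_⟩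
  have : (LHom.sumInl : fullLang 𝔽 L' →ᴸ genLang 𝔽 L' ↥Rs).IsExpansionOn N.carrier :=
    LHom.isExpansionOn_reduct _ _
  exact (hτ N v).trans (LHom.realize_onTerm _ τ v).symm

/-- Every `L_G`-term is an `L`-term. -/
theorem TermG.toL {t : ∀ N : TGMod Rs T, (α → N.carrier) → N.carrier} (h : TermG t) :
    TermL t := by
  obtain ⟨τ, hτ⟩ := h
  refine ElemT.congr (s := fun N v => τ.realize v) ?_ hτ
  clear hτ
  induction τ with
  | var a => exact ElemT.var a
  | @func n f ts ih =>
    rcases f with f | f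
    · exact ElemT.func (L := fullLang 𝔽 L') f ih
    · exact (show PEmpty from f).elim

theorem DefG.memG {t : ∀ N : TGMod Rs T, (α → N.carrier) → N.carrier} (h : TermL t) :
    DefG (fun N v => t N v ∈ N.G) :=
  Elem.memGSet h.toG

theorem DefR.toG [Finite α] {P : ∀ N : TGMod Rs T, (α → ↥N.G) → Prop} (h : DefR P)
    {t : α → ∀ N : TGMod Rs T, (β → N.carrier) → N.carrier} (ht : ∀ a, TermL (t a)) :
    DefG (fun N v => ∃ hv : ∀ a, t a N v ∈ N.G, P N (fun a => ⟨t a N v, hv a⟩)) := by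
  obtain ⟨n, ⟨E⟩⟩ := Finite.exists_equiv_fin α
  obtain ⟨θ, hθ⟩ := h.relabel E
  have := (Elem.rel (C := fun N : TGMod Rs T => N.carrier) (L := genLang 𝔽 L' ↥Rs)
    (pSym 𝔽 L' ↥Rs θ) (t := fun k => t (E.symm k)) (fun k => (ht _).toG))
  refine this.congr (fun N v => ?_)
  refine Iff.trans ?_ (N.p_iff θ _).symm
  constructor
  · rintro ⟨hv, hP⟩
    refine ⟨fun k => hv _, (hθ N _).1 ?_⟩
    simpa [Function.comp_def] using hP
  · rintro ⟨hv, hP⟩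
    refine ⟨fun a => by simpa using hv (E a), ?_⟩
    have := (hθ N _).2 hP
    simpa [Function.comp_def] using this

/-- Elementary embeddings between models of `T_G`. -/
abbrev Ext (N N' : TGMod Rs T) := N.carrier ↪ₑ[genLang 𝔽 L' ↥Rs] N'.carrier

namespace Ext

variable {N N' : TGMod Rs T} (f : Ext N N')

theorem defG_iff {P : ∀ N : TGMod Rs T, (α → N.carrier) → Prop} (h : DefG P)
    (v : α → N.carrier) : P N' (fun a => f (v a)) ↔ P N v :=
  Elem.realize_iff (C := fun N : TGMod Rs T => N.carrier) h (i := N) (j := N') f v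

theorem termL {t : ∀ N : TGMod Rs T, (α → N.carrier) → N.carrier} (h : TermL t)
    (v : α → N.carrier) : f (t N v) = t N' (fun a => f (v a)) := by
  obtain ⟨τ, hτ⟩ := h.toG
  rw [hτ, hτ]
  exact (HomClass.realize_term f (t := τ) (v := v)).symm

theorem map_add (x y : N.carrier) : f (x + y) = f x + f y :=
  f.termL (TermL.add (ElemT.var (0 : Fin 2)) (ElemT.var 1)) ![x, y]

theorem map_smul (c : 𝔽) (x : N.carrier) : f (c • x) = c • f x :=
  f.termL (TermL.smul c (ElemT.var 0 : TermL (fun N (v : Fin 1 → N.carrier) => v 0))) ![x]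

/-- An elementary embedding as a linear map. -/
def lin : N.carrier →ₗ[𝔽] N'.carrier where
  toFun := f
  map_add' := f.map_add
  map_smul' := f.map_smul

@[simp] theorem lin_apply (x : N.carrier) : f.lin x = f x := rfl

theorem mem_G {x : N.carrier} : f x ∈ N'.G ↔ x ∈ N.G :=
  f.defG_iff (DefG.memG (ElemT.var 0 : TermL (fun N (v : Fin 1 → N.carrier) => v 0))) ![x]

/-- The restriction of an elementary embedding to the generic submodules. -/
def res : ↥N.G →ₗ[↥Rs] ↥N'.G where
  toFun x := ⟨f x, f.mem_G.2 x.2⟩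
  map_add' x y := Subtype.ext (f.map_add _ _)
  map_smul' r x := Subtype.ext (f.map_smul _ _)

@[simp] theorem coe_res (x : ↥N.G) : (f.res x : N'.carrier) = f x := rfl

/-- The restriction to the generic submodules is elementary. -/
def resElem : ↥N.G ↪ₑ[vsLang ↥Rs] ↥N'.G where
  toFun x := ⟨f x, f.mem_G.2 x.2⟩
  map_formula' n φ x := by
    have h := f.defG_iff (DefR.toG (Elem.of φ) (fun k => ElemT.var k)) (fun k => (x k : N.carrier))
    constructor
    · intro H
      exact (h.1 ⟨fun k => f.mem_G.2 (x k).2, H⟩).choose_spec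
    · intro H
      exact (h.2 ⟨fun k => (x k).2, H⟩).choose_spec

theorem defR_iff {P : ∀ N : TGMod Rs T, (α → ↥N.G) → Prop} (h : DefR P)
    (v : α → ↥N.G) : P N' (fun a => f.res (v a)) ↔ P N v :=
  Elem.realize_iff (C := fun N : TGMod Rs T => ↥N.G) h (i := N) (j := N') f.resElem v

end Ext

/-- Compactness over models of `T_G`. -/
theorem exists_ext (N : TGMod Rs T) (e : β → N.carrier) {J : Type*}
    (P : J → ∀ N : TGMod Rs T, (β ⊕ α → N.carrier) → Prop) (hP : ∀ j, DefG (P j))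
    (hfin : ∀ s : Finset J, ∃ v : α → N.carrier, ∀ j ∈ s, P j N (Sum.elim e v)) :
    ∃ (N' : TGMod Rs T) (f : Ext N N') (v : α → N'.carrier),
      ∀ j, P j N' (Sum.elim (fun b => f (e b)) v) := by
  classical
  choose φ hφ using hP
  have : Nonempty N.carrier := ⟨0⟩
  obtain ⟨M', i1, i2, f, v, h⟩ := exists_elementary_extension N.carrier e (Set.range φ) (by
    intro s hs
    obtain ⟨t, rfl⟩ : ∃ t : Finset J, t.image φ = s := by
      have := Finset.subset_set_image_iff (s := Set.univ) (t := s) (f := φ)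
      rw [Set.image_univ] at this
      obtain ⟨t, -, ht⟩ := this.1 hs
      exact ⟨t, ht⟩
    obtain ⟨v, hv⟩ := hfin t
    refine ⟨v, fun ψ hψ => ?_⟩
    obtain ⟨j, hj, rfl⟩ := Finset.mem_image.1 hψ
    exact (hφ j N _).1 (hv j hj))
  let N' : TGMod Rs T := ⟨M', i1, N.facts,
    IsTGModel.of_completeTheory_eq N.facts N.isTG f.elementarilyEquivalent⟩
  exact ⟨N', f, v, fun j => (hφ j N' _).2 (h _ ⟨j, rfl⟩)⟩

end Models

section Basic

variable {𝔽 : Type u} [Field 𝔽] {L' : FirstOrder.Language.{u, u}}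
variable {Rs : Subring 𝔽} {T : (fullLang 𝔽 L').Theory} {α β γ : Type}

/-- Uniformly definable relations between a tuple and an element. -/
abbrev DefL1 (P : ∀ N : TGMod Rs T, (β → N.carrier) → N.carrier → Prop) : Prop :=
  DefL (fun N (v : β ⊕ Unit → N.carrier) => P N (v ∘ Sum.inl) (v (Sum.inr ())))

theorem TGMod.vspan_eq (N : TGMod Rs T) (A : Set N.carrier) :
    @vspan 𝔽 N.carrier ((LHom.sumInl : vsLang 𝔽 →ᴸ fullLang 𝔽 L').reduct N.carrier) A =
      (Submodule.span 𝔽 A : Set N.carrier) := by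
  apply subset_antisymm
  · refine Set.sInter_subset_of_mem ⟨Submodule.subset_span, Submodule.zero_mem _,
      fun x hx y hy => Submodule.add_mem _ hx hy, fun c x hx => Submodule.smul_mem _ c hx⟩
  · refine Set.subset_sInter ?_
    rintro S ⟨h1, h2, h3, h4⟩
    let S' : Submodule 𝔽 N.carrier :=
      { carrier := S
        zero_mem' := h2
        add_mem' := fun hx hy => h3 _ hx _ hy
        smul_mem' := fun c x hx => h4 c x hx }
    exact (Submodule.span_le (p := S')).2 h1

theorem DefL1.exists_formula [Finite β]
    {P : ∀ N : TGMod Rs T, (β → N.carrier) → N.carrier → Prop}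
    (hP : DefL1 P) : ∃ (k : ℕ) (E : β ≃ Fin k) (φ : (fullLang 𝔽 L').Formula (Fin 1 ⊕ Fin k)),
      ∀ (N : TGMod Rs T) (e : β → N.carrier) (x : N.carrier),
        φ.Realize (Sum.elim (fun _ => x) (e ∘ E.symm)) ↔ P N e x := by
  obtain ⟨k, ⟨E⟩⟩ := Finite.exists_equiv_fin β
  obtain ⟨φ, hφ⟩ := hP.relabel (β := Fin 1 ⊕ Fin k) (Sum.elim (Sum.inr ∘ E) (fun _ => Sum.inl 0))
  refine ⟨k, E, φ, fun N e x => (hφ N _).symm.trans (iff_of_eq ?_)⟩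
  refine congrArg (fun z => P N z x) ?_
  funext b
  simp

theorem DefL1.infinite_of_notMem_span [Finite β]
    {P : ∀ N : TGMod Rs T, (β → N.carrier) → N.carrier → Prop} (hP : DefL1 P) (N : TGMod Rs T)
    (e : β → N.carrier) {x : N.carrier} (hx : P N e x)
    (hxe : x ∉ Submodule.span 𝔽 (Set.range e)) : {y | P N e y}.Infinite := by
  obtain ⟨k, E, φ, hφ⟩ := hP.exists_formula
  intro hf
  apply hxe
  have h1 := N.facts.hacl N.carrier N.models (Set.range e)
  rw [N.vspan_eq] at h1
  refine (Set.ext_iff.1 h1 x).1 ⟨k, φ, e ∘ E.symm, fun j => ⟨_, rfl⟩, (hφ N e x).2 hx, ?_⟩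
  simpa only [hφ] using hf

theorem DefL1.exists_many_iff [Finite β]
    {P : ∀ N : TGMod Rs T, (β → N.carrier) → N.carrier → Prop} (hP : DefL1 P)
    (hT : TFacts T) : ∃ n : ℕ, ∀ (N : TGMod Rs T) (e : β → N.carrier),
      (∃ w : Fin n → N.carrier, Function.Injective w ∧ ∀ k, P N e (w k)) ↔
        {y | P N e y}.Infinite := by
  obtain ⟨k, E, φ, hφ⟩ := hP.exists_formula
  obtain ⟨n, hn⟩ := hT.hee.exists_many_iff φ
  refine ⟨n, fun N e => ?_⟩
  have : Nonempty N.carrier := ⟨0⟩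
  have := hn N.carrier N.models (e ∘ E.symm)
  simpa only [hφ] using this

theorem DefL1.infinite [Finite β]
    {P : ∀ N : TGMod Rs T, (β → N.carrier) → N.carrier → Prop} (hP : DefL1 P)
    (hT : TFacts T) : DefL (fun N v => {y | P N v y}.Infinite) := by
  obtain ⟨n, hn⟩ := hP.exists_many_iff hT
  exact (Elem.many (C := fun N : TGMod Rs T => N.carrier) n hP).congr
    (fun N v => (hn N v).symm)

theorem DefL1.exists_smul [Finite β]
    {P : ∀ N : TGMod Rs T, (β → N.carrier) → N.carrier → Prop} (hP : DefL1 P) (N : TGMod Rs T)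
    (e : β → N.carrier) (h : {y | P N e y}.Infinite) {r : 𝔽} (hr : r ∈ Rs) (hr0 : r ≠ 0) :
    ∃ g ∈ N.G, P N e (r • g) := by
  obtain ⟨k, E, φ, hφ⟩ := hP.exists_formula
  obtain ⟨g, hg, hg'⟩ := N.isTG.axiomC r hr hr0 k φ (e ∘ E.symm) (by
    change {y : N.carrier | φ.Realize (Sum.elim (fun _ => y) (e ∘ E.symm))}.Infinite
    simpa only [hφ] using h)
  exact ⟨g, hg, (hφ N e _).1 hg'⟩

theorem DefL1.exists_forall_ne [Finite β] [Fintype γ]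
    {P : ∀ N : TGMod Rs T, (β → N.carrier) → N.carrier → Prop} (hP : DefL1 P) (N : TGMod Rs T)
    (e : β → N.carrier) (h : {y | P N e y}.Infinite) {n : ℕ}
    {t : Fin n → ∀ N : TGMod Rs T, (β ⊕ γ → N.carrier) → N.carrier} (ht : ∀ j, TermL (t j)) :
    ∃ x, P N e x ∧ ∀ c : γ → N.carrier, (∀ i, c i ∈ N.G) → ∀ j, x ≠ t j N (Sum.elim e c) := by
  obtain ⟨k, E, φ, hφ⟩ := hP.exists_formula
  obtain ⟨l, ⟨E'⟩⟩ := Finite.exists_equiv_fin γ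
  have hQ : DefL1 (β := β ⊕ γ) (fun N v x => ∃ j, x = t j N v) :=
    Elem.exists_fin fun j => Elem.eq (ElemT.var _) ((ht j).relabel Sum.inl)
  obtain ⟨ψ, hψ⟩ := hQ.relabel (β := Fin 1 ⊕ (Fin k ⊕ Fin l))
    (Sum.elim (Sum.inr ∘ Sum.map E E') (fun _ => Sum.inl 0))
  have hψ' : ∀ (x : N.carrier) (c : Fin l → N.carrier),
      ψ.Realize (Sum.elim (fun _ => x) (Sum.elim (e ∘ E.symm) c)) ↔
        ∃ j, x = t j N (Sum.elim e (c ∘ E')) := by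
    intro x c
    refine (hψ N _).symm.trans (exists_congr fun j => iff_of_eq ?_)
    congr 2
    funext b
    rcases b with b | b <;> simp
  obtain ⟨x, hx, hx'⟩ := N.isTG.axiomD k l φ ψ (n + 1) (by omega) (e ∘ E.symm) (by
    change {y : N.carrier | φ.Realize (Sum.elim (fun _ => y) (e ∘ E.symm))}.Infinite
    simpa only [hφ] using h) (by
    intro c
    change {x : N.carrier | ψ.Realize (Sum.elim (fun _ => x) (Sum.elim (e ∘ E.symm) c))}.Finite ∧
      {x : N.carrier | ψ.Realize (Sum.elim (fun _ => x) (Sum.elim (e ∘ E.symm) c))}.ncard ≤ n + 1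
    have hS : {x : N.carrier | ψ.Realize (Sum.elim (fun _ => x) (Sum.elim (e ∘ E.symm) c))} =
        Set.range (fun j => t j N (Sum.elim e (c ∘ E'))) := by
      ext x
      rw [Set.mem_ofPred_eq, hψ']
      exact exists_congr fun j => eq_comm
    rw [hS]
    refine ⟨Set.finite_range _, ?_⟩
    rw [← Set.image_univ]
    refine (Set.ncard_image_le Set.finite_univ).trans ?_
    simp [Set.ncard_univ])
  refine ⟨x, (hφ N e x).1 hx, fun c hc j hj => hx' (c ∘ E'.symm) (fun i => hc _) ?_⟩
  refine (hψ' x _).2 ⟨j, ?_⟩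
  rw [hj]
  congr 2
  funext i
  simp

theorem TGMod.sum_smul_eq_zero (N : TGMod Rs T) {κ : Type*} [Fintype κ] {g : κ → N.carrier}
    (hg : ∀ j, g j ∈ N.G)
    (hind : ∀ r : κ → ↥Rs, ∑ j, (r j : 𝔽) • g j = 0 → r = 0)
    (μ : κ → 𝔽) (hμ : ∑ j, μ j • g j = 0) : μ = 0 := by
  classical
  obtain ⟨I, hI, hI'⟩ := exists_maximal_linearIndepOn ↥Rs μ
  have h1 : ∀ j, ∃ a : ↥Rs, a ≠ 0 ∧ a • μ j ∈ Submodule.span ↥Rs (μ '' I) := by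
    intro j
    by_cases hj : j ∈ I
    · exact ⟨1, one_ne_zero, by
        rw [one_smul]; exact Submodule.subset_span ⟨j, hj, rfl⟩⟩
    · exact hI' j hj
  choose a ha ha' using h1
  let r : ↥Rs := ∏ j, a j
  have hr : r ≠ 0 := Finset.prod_ne_zero_iff.2 fun j _ => ha j
  have h2 : ∀ j, ∃ c : I → ↥Rs, ∑ i, c i • μ i = r • μ j := by
    intro j
    have h3 : r • μ j ∈ Submodule.span ↥Rs (Set.range fun i : I => μ i) := by
      have : r = (∏ i ∈ Finset.univ.erase j, a i) * a j := by
        rw [mul_comm]; exact (Finset.mul_prod_erase _ _ (Finset.mem_univ j)).symm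
      rw [this, mul_smul, ← Set.image_eq_range]
      exact Submodule.smul_mem _ _ (ha' j)
    exact (Submodule.mem_span_range_iff_exists_fun _).1 h3
  choose c hc using h2
  obtain ⟨n, ⟨E⟩⟩ := Finite.exists_equiv_fin I
  have h4 := N.isTG.axiomB n (fun k => μ (E.symm k)) (by
    intro d hd hd0 k
    have := Fintype.linearIndependent_iff.1 hI (fun i => ⟨d (E i), hd _⟩) (by
      rw [← hd0, ← E.symm.sum_comp]
      refine Finset.sum_congr rfl fun k _ => ?_
      simp [Subring.smul_def]) (E.symm k)
    simpa using congrArg Subtype.val this)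
    (fun k => ∑ j, c j (E.symm k) • g j) (fun k => N.G.sum_mem fun j _ => N.G.smul_mem _ (hg j)) (by
      rw [N.vsumG_eq]
      change ∑ k, μ (E.symm k) • ∑ j, c j (E.symm k) • g j = 0
      rw [E.symm.sum_comp (fun i : I => μ i • ∑ j, c j i • g j)]
      simp_rw [Finset.smul_sum]
      rw [Finset.sum_comm]
      have : ∀ j, ∑ i : I, μ i • c j i • g j = (r : 𝔽) • μ j • g j := by
        intro j
        have := congrArg (fun z => z • g j) (hc j)
        simp only [Subring.smul_def, smul_eq_mul, Finset.sum_smul] at this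
        rw [smul_smul, ← this]
        refine Finset.sum_congr rfl fun i _ => ?_
        rw [Subring.smul_def, smul_smul, mul_comm]
      simp_rw [this]
      rw [← Finset.smul_sum, hμ, smul_zero])
  have h5 : ∀ i : I, ∀ j, c j i = 0 := by
    intro i j
    have := hind (fun j => c j i) (by simpa [Subring.smul_def, TGMod.zero_def] using h4 (E i))
    exact congrFun this j
  funext j
  have := hc j
  simp only [h5, zero_smul, Finset.sum_const_zero] at this
  have h6 := this.symm
  rw [Subring.smul_def, smul_eq_mul, mul_eq_zero] at h6
  exact h6.resolve_left (fun h => hr (Subtype.ext h))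

theorem TGMod.exists_denominator (N : TGMod Rs T) {κ : Type*} [Fintype κ] {g : κ → N.carrier}
    (hg : ∀ j, g j ∈ N.G) (hind : ∀ μ : κ → 𝔽, ∑ j, μ j • g j = 0 → μ = 0)
    {μ : κ → 𝔽} (hμ : ∑ j, μ j • g j ∈ N.G) :
    ∃ r : ↥Rs, r ≠ 0 ∧ ∃ c : κ → ↥Rs, ∀ j, (c j : 𝔽) = r * μ j := by
  classical
  by_contra hcon
  push Not at hcon
  have := N.sum_smul_eq_zero (κ := Option κ)
    (g := fun o => o.elim (∑ j, μ j • g j) g) (fun o => by cases o; exacts [hμ, hg _]) (by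
    intro r hr
    rw [Fintype.sum_option] at hr
    simp only [Option.elim_none, Option.elim_some] at hr
    rw [Finset.smul_sum, ← Finset.sum_add_distrib] at hr
    have h1 := hind (fun j => r none * μ j + r (some j)) (by
      rw [← hr]
      refine Finset.sum_congr rfl fun j _ => ?_
      rw [add_smul, mul_smul])
    have h0 : r none = 0 := by
      by_contra h0
      obtain ⟨j, hj⟩ := hcon (r none) h0 (fun j => - r (some j))
      apply hj
      have := congrFun h1 j
      simp only [Pi.zero_apply] at this
      rw [Subring.coe_neg]
      linear_combination -this
    funext o
    cases o with
    | none => exact h0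
    | some j =>
      have := congrFun h1 j
      simpa [h0] using this)
    (fun o => o.elim (-1) μ) (by
      rw [Fintype.sum_option]
      simp)
  have h := congrFun this none
  simp at h

end Basic

section Good

variable {𝔽 : Type u} [Field 𝔽] {L' : FirstOrder.Language.{u, u}}
variable {Rs : Subring 𝔽} {T : (fullLang 𝔽 L').Theory} {α β γ ι' κ' ι κ υ : Type}

/-- The `𝔽`-span of the generic submodule. -/
def TGMod.W (N : TGMod Rs T) : Submodule 𝔽 N.carrier := Submodule.span 𝔽 (N.G : Set N.carrier)

theorem TGMod.G_le_W (N : TGMod Rs T) {x : N.carrier} (hx : x ∈ N.G) : x ∈ N.W :=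
  Submodule.subset_span hx

theorem TGMod.mem_W_iff (N : TGMod Rs T) {x : N.carrier} : x ∈ N.W ↔
    ∃ (m : ℕ) (τ : Fin m → 𝔽) (t : Fin m → N.carrier), (∀ k, t k ∈ N.G) ∧ x = ∑ k, τ k • t k := by
  constructor
  · intro hx
    obtain ⟨m, τ, t, rfl⟩ := Submodule.mem_span_set'.1 hx
    exact ⟨m, τ, fun k => t k, fun k => (t k).2, rfl⟩
  · rintro ⟨m, τ, t, ht, rfl⟩
    exact Submodule.sum_mem _ fun k _ => Submodule.smul_mem _ _ (N.G_le_W (ht k))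

/-- The span of a tuple. -/
abbrev TGMod.sp (N : TGMod Rs T) (A : υ → N.carrier) : Submodule 𝔽 N.carrier :=
  Submodule.span 𝔽 (Set.range A)

theorem TGMod.mem_sp_iff (N : TGMod Rs T) [Fintype υ] (A : υ → N.carrier) {x : N.carrier} :
    x ∈ N.sp A ↔ ∃ ν : υ → 𝔽, x = ∑ k, ν k • A k := by
  rw [Submodule.mem_span_range_iff_exists_fun]
  exact exists_congr fun ν => eq_comm

theorem TGMod.mem_sp_sup_W_iff (N : TGMod Rs T) [Fintype υ] (A : υ → N.carrier) {x : N.carrier} :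
    x ∈ N.sp A ⊔ N.W ↔ ∃ (ν : υ → 𝔽) (m : ℕ) (τ : Fin m → 𝔽) (t : Fin m → N.carrier),
      (∀ k, t k ∈ N.G) ∧ x = ∑ k, ν k • A k + ∑ k, τ k • t k := by
  rw [Submodule.mem_sup]
  constructor
  · rintro ⟨y, hy, z, hz, rfl⟩
    obtain ⟨ν, rfl⟩ := (N.mem_sp_iff A).1 hy
    obtain ⟨m, τ, t, ht, rfl⟩ := N.mem_W_iff.1 hz
    exact ⟨ν, m, τ, t, ht, rfl⟩
  · rintro ⟨ν, m, τ, t, ht, rfl⟩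
    exact ⟨_, (N.mem_sp_iff A).2 ⟨ν, rfl⟩, _, N.mem_W_iff.2 ⟨m, τ, t, ht, rfl⟩, rfl⟩

/-- The second part of the tuple lies in the generic submodule. -/
def InG (N : TGMod Rs T) (e : ι ⊕ κ → N.carrier) : Prop := ∀ j, e (Sum.inr j) ∈ N.G

theorem InG.map {N N' : TGMod Rs T} (f : Ext N N') {e : ι ⊕ κ → N.carrier} (h : InG N e) :
    InG N' (fun a => f (e a)) :=
  fun j => f.mem_G.2 (h j)

theorem InG.sum_mem [Fintype κ] {N : TGMod Rs T} {e : ι ⊕ κ → N.carrier} (h : InG N e) (m : κ → 𝔽) :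
    ∑ j, m j • e (Sum.inr j) ∈ N.W :=
  Submodule.sum_mem _ fun j _ => Submodule.smul_mem _ _ (N.G_le_W (h j))

variable [Fintype ι] [Fintype κ]

/-- The tuple `e = (u, g)` is independent over `S`, the part `u` even modulo the span of `G`. -/
def GoodOver (N : TGMod Rs T) (S : Submodule 𝔽 N.carrier) (e : ι ⊕ κ → N.carrier) : Prop :=
  (∀ l : ι → 𝔽, ∑ i, l i • e (Sum.inl i) ∈ S ⊔ N.W → l = 0) ∧
    ∀ m : κ → 𝔽, ∑ j, m j • e (Sum.inr j) ∈ S → m = 0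

/-- Independent tuples whose second part is in `G` and whose first part is independent
modulo the span of `G`. -/
def Good (N : TGMod Rs T) (e : ι ⊕ κ → N.carrier) : Prop := InG N e ∧ GoodOver N ⊥ e

theorem GoodOver.mono {N : TGMod Rs T} {S S' : Submodule 𝔽 N.carrier} {e : ι ⊕ κ → N.carrier}
    (h : GoodOver N S' e) (hS : S ≤ S') : GoodOver N S e :=
  ⟨fun l hl => h.1 l (sup_le_sup_right hS _ hl), fun m hm => h.2 m (hS hm)⟩

theorem GoodOver.eq_zero {N : TGMod Rs T} {S : Submodule 𝔽 N.carrier} {e : ι ⊕ κ → N.carrier}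
    (hG : InG N e) (h : GoodOver N S e) {l : ι ⊕ κ → 𝔽} (hl : ∑ a, l a • e a ∈ S) : l = 0 := by
  rw [Fintype.sum_sum_type] at hl
  have h1 : (fun i => l (Sum.inl i)) = 0 := h.1 _ (by
    have h2 := Submodule.sub_mem (S ⊔ N.W) (Submodule.mem_sup_left hl)
      (Submodule.mem_sup_right (hG.sum_mem (fun j => l (Sum.inr j))))
    simpa using h2)
  have h2 : (fun j => l (Sum.inr j)) = 0 := h.2 _ (by
    have h3 : ∀ i, l (Sum.inl i) = 0 := congrFun h1
    simpa [h3] using hl)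
  funext a
  cases a with
  | inl i => exact congrFun h1 i
  | inr j => exact congrFun h2 j

theorem Good.sum_eq_zero {N : TGMod Rs T} {e : ι ⊕ κ → N.carrier}
    (h : Good N e) {l : ι ⊕ κ → 𝔽} (hl : ∑ a, l a • e a = 0) : l = 0 :=
  h.2.eq_zero h.1 (by rw [hl]; exact Submodule.zero_mem _)

/-- Combining a good tuple with a tuple good over it. -/
theorem Good.append [Fintype ι'] [Fintype κ'] {N : TGMod Rs T} {a : ι ⊕ κ → N.carrier}
    {b : ι' ⊕ κ' → N.carrier} (ha : Good N a) (hbG : InG N b) (hb : GoodOver N (N.sp a) b) :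
    Good N (Sum.elim (Sum.elim (b ∘ Sum.inl) (a ∘ Sum.inl)) (Sum.elim (b ∘ Sum.inr) (a ∘ Sum.inr)) :
      (ι' ⊕ ι) ⊕ (κ' ⊕ κ) → N.carrier) := by
  have hmem : ∀ x, a x ∈ N.sp a := fun x => Submodule.subset_span ⟨x, rfl⟩
  refine ⟨?_, ?_, ?_⟩
  · rintro (j | j)
    exacts [hbG j, ha.1 j]
  · intro l hl
    rw [bot_sup_eq] at hl
    simp only [Fintype.sum_sum_type, Sum.elim_inl, Sum.elim_inr, Function.comp_apply] at hl
    have h1 : (fun i => l (Sum.inl i)) = 0 := hb.1 _ (by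
      have h2 : ∑ i, l (Sum.inr i) • a (Sum.inl i) ∈ N.sp a :=
        Submodule.sum_mem _ fun i _ => Submodule.smul_mem _ _ (hmem _)
      have h3 := Submodule.sub_mem (N.sp a ⊔ N.W) (Submodule.mem_sup_right hl)
        (Submodule.mem_sup_left h2)
      simpa using h3)
    have h1' : ∀ i, l (Sum.inl i) = 0 := congrFun h1
    have h2 : (fun i => l (Sum.inr i)) = 0 := ha.2.1 _ (by
      rw [bot_sup_eq]
      simpa [h1'] using hl)
    funext i
    cases i with
    | inl i => exact h1' i
    | inr i => exact congrFun h2 i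
  · intro l hl
    simp only [Fintype.sum_sum_type, Sum.elim_inl, Sum.elim_inr, Function.comp_apply] at hl
    rw [Submodule.mem_bot] at hl
    have h1 : (fun i => l (Sum.inl i)) = 0 := hb.2 _ (by
      have h2 : ∑ i, l (Sum.inr i) • a (Sum.inr i) ∈ N.sp a :=
        Submodule.sum_mem _ fun i _ => Submodule.smul_mem _ _ (hmem _)
      rw [eq_neg_of_add_eq_zero_left hl]
      exact Submodule.neg_mem _ h2)
    have h1' : ∀ i, l (Sum.inl i) = 0 := congrFun h1
    have h2 : (fun i => l (Sum.inr i)) = 0 := ha.2.2 _ (by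
      rw [Submodule.mem_bot]
      simpa [h1'] using hl)
    funext i
    cases i with
    | inl i => exact h1' i
    | inr i => exact congrFun h2 i

variable (𝔽 ι κ υ) in
/-- Data of a linear dependence violating `GoodOver`. -/
abbrev DepData : Type u :=
  ({l : ι → 𝔽 // l ≠ 0} × (υ → 𝔽) × Σ m : ℕ, Fin m → 𝔽) ⊕ ({l : κ → 𝔽 // l ≠ 0} × (υ → 𝔽))

variable [Fintype υ]

/-- The dependence given by the data `d` holds. -/
def DepHolds : DepData 𝔽 ι κ υ → ∀ N : TGMod Rs T, (ι ⊕ κ → N.carrier) → (υ → N.carrier) → Prop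
  | Sum.inl d, N, e, A => ∃ t : Fin d.2.2.1 → N.carrier, (∀ k, t k ∈ N.G) ∧
      ∑ i, d.1.1 i • e (Sum.inl i) = ∑ k, d.2.1 k • A k + ∑ k, d.2.2.2 k • t k
  | Sum.inr d, N, e, A => ∑ j, d.1.1 j • e (Sum.inr j) = ∑ k, d.2 k • A k

theorem DepHolds.defG (d : DepData 𝔽 ι κ υ) :
    DefG (Rs := Rs) (T := T) (fun N (v : (ι ⊕ κ) ⊕ υ → N.carrier) =>
      DepHolds d N (v ∘ Sum.inl) (v ∘ Sum.inr)) := by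
  rcases d with d | d
  · refine Elem.ex (Elem.and (Elem.forall_fin fun k => DefG.memG (ElemT.var _))
      (DefL.toG (Elem.eq ?_ ?_)))
    · exact TermL.sum _ fun i => TermL.smul _ (ElemT.var _)
    · exact TermL.add (TermL.sum _ fun i => TermL.smul _ (ElemT.var _))
        (TermL.sum _ fun i => TermL.smul _ (ElemT.var _))
  · exact DefL.toG (Elem.eq (TermL.sum _ fun i => TermL.smul _ (ElemT.var _))
      (TermL.sum _ fun i => TermL.smul _ (ElemT.var _)))

theorem goodOver_iff_forall_not_depHolds (N : TGMod Rs T) (e : ι ⊕ κ → N.carrier)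
    (A : υ → N.carrier) :
    GoodOver N (N.sp A) e ↔ ∀ d : DepData 𝔽 ι κ υ, ¬ DepHolds d N e A := by
  constructor
  · rintro ⟨h1, h2⟩ (⟨l, ν, m, τ⟩ | ⟨l, ν⟩) hd
    · obtain ⟨t, ht, hd⟩ := hd
      exact l.2 (h1 l.1 ((N.mem_sp_sup_W_iff A).2 ⟨ν, m, τ, t, ht, hd⟩))
    · exact l.2 (h2 l.1 ((N.mem_sp_iff A).2 ⟨ν, hd⟩))
  · intro h
    constructor
    · intro l hl
      by_contra hl0
      obtain ⟨ν, m, τ, t, ht, heq⟩ := (N.mem_sp_sup_W_iff A).1 hl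
      exact h (Sum.inl ⟨⟨l, hl0⟩, ν, m, τ⟩) ⟨t, ht, heq⟩
    · intro l hl
      by_contra hl0
      obtain ⟨ν, heq⟩ := (N.mem_sp_iff A).1 hl
      exact h (Sum.inr ⟨⟨l, hl0⟩, ν⟩) heq

theorem GoodOver.map_iff {N N' : TGMod Rs T} (f : Ext N N') {e : ι ⊕ κ → N.carrier}
    {A : υ → N.carrier} : GoodOver N' (N'.sp (fun k => f (A k))) (fun a => f (e a)) ↔
      GoodOver N (N.sp A) e := by
  rw [goodOver_iff_forall_not_depHolds, goodOver_iff_forall_not_depHolds]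
  exact forall_congr' fun d => not_congr (f.defG_iff (DepHolds.defG d) (Sum.elim e A))

theorem TGMod.sp_empty (N : TGMod Rs T) (A : Empty → N.carrier) : N.sp A = ⊥ := by
  simp [TGMod.sp]

theorem Good.map {N N' : TGMod Rs T} (f : Ext N N') {e : ι ⊕ κ → N.carrier} (h : Good N e) :
    Good N' (fun a => f (e a)) := by
  refine ⟨h.1.map f, ?_⟩
  have := (GoodOver.map_iff f (e := e) (A := Empty.elim)).2 (by rw [N.sp_empty]; exact h.2)
  rwa [N'.sp_empty] at this

/-- A dependence allows to replace a tuple by a smaller one. -/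
theorem DepData.exists_smaller (d : DepData 𝔽 ι κ υ) :
    ∃ (ι₁ κ₁ : Type) (_ : Fintype ι₁) (_ : Fintype κ₁)
      (t : ι ⊕ κ → ∀ N : TGMod Rs T, ((ι₁ ⊕ κ₁) ⊕ υ → N.carrier) → N.carrier),
      (Fintype.card ι₁ < Fintype.card ι ∨
        Fintype.card ι₁ = Fintype.card ι ∧ Fintype.card κ₁ < Fintype.card κ) ∧
      (∀ a, TermL (t a)) ∧
      ∀ (N : TGMod Rs T) (e : ι ⊕ κ → N.carrier) (A : υ → N.carrier), InG N e → DepHolds d N e A →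
        ∃ e₁ : ι₁ ⊕ κ₁ → N.carrier, InG N e₁ ∧ ∀ a, e a = t a N (Sum.elim e₁ A) := by
  classical
  rcases d with ⟨⟨l, hl⟩, ν, m, τ⟩ | ⟨⟨l, hl⟩, ν⟩
  · obtain ⟨i₀, hi₀⟩ : ∃ i, l i ≠ 0 := by
      by_contra h; push Not at h; exact hl (funext h)
    refine ⟨{i // i ≠ i₀}, κ ⊕ Fin m, inferInstance, inferInstance,
      Sum.elim (fun i => if h : i = i₀ then fun N v =>
          (l i₀)⁻¹ • (∑ k, ν k • v (Sum.inr k) + ∑ k, τ k • v (Sum.inl (Sum.inr (Sum.inr k))) -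
            ∑ i : {i // i ≠ i₀}, l i • v (Sum.inl (Sum.inl i)))
        else fun N v => v (Sum.inl (Sum.inl ⟨i, h⟩)))
        (fun j N v => v (Sum.inl (Sum.inr (Sum.inl j)))), Or.inl ?_, ?_, ?_⟩
    · exact Fintype.card_subtype_lt (x := i₀) (by simp)
    · rintro (i | j)
      · by_cases h : i = i₀
        · simp only [Sum.elim_inl, h, dite_true]
          exact TermL.smul _ (TermL.sub (TermL.add
            (TermL.sum _ fun k => TermL.smul _ (ElemT.var _))
            (TermL.sum _ fun k => TermL.smul _ (ElemT.var _)))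
            (TermL.sum _ fun k => TermL.smul _ (ElemT.var _)))
        · simp only [Sum.elim_inl, h, dite_false]
          exact ElemT.var _
      · exact ElemT.var _
    · rintro N e A hG ⟨t, ht, heq⟩
      refine ⟨Sum.elim (fun i => e (Sum.inl i)) (Sum.elim (e ∘ Sum.inr) t), ?_, ?_⟩
      · rintro (j | k)
        exacts [hG j, ht k]
      · rintro (i | j)
        · by_cases h : i = i₀
          · subst h
            simp only [Sum.elim_inl, dite_true, Sum.elim_inr]
            rw [eq_inv_smul_iff₀ hi₀, eq_sub_iff_add_eq, ← heq,
              ← Fintype.sum_subtype_add_sum_subtype (fun j => j ≠ i)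
                (fun j => l j • e (Sum.inl j)), add_comm]
            congr 1
            have : ∀ j : {j // ¬ j ≠ i}, j = ⟨i, by simp⟩ := fun j =>
              Subtype.ext (not_not.1 j.2)
            rw [Fintype.sum_eq_single ⟨i, by simp⟩ (fun j hj => absurd (this j) hj)]
          · simp [h]
        · simp
  · obtain ⟨j₀, hj₀⟩ : ∃ i, l i ≠ 0 := by
      by_contra h; push Not at h; exact hl (funext h)
    refine ⟨ι, {j // j ≠ j₀}, inferInstance, inferInstance,
      Sum.elim (fun i N v => v (Sum.inl (Sum.inl i))) (fun j => if h : j = j₀ then fun N v =>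
          (l j₀)⁻¹ • (∑ k, ν k • v (Sum.inr k) -
            ∑ j : {j // j ≠ j₀}, l j • v (Sum.inl (Sum.inr j)))
        else fun N v => v (Sum.inl (Sum.inr ⟨j, h⟩))), Or.inr ⟨rfl, ?_⟩, ?_, ?_⟩
    · exact Fintype.card_subtype_lt (x := j₀) (by simp)
    · rintro (i | j)
      · exact ElemT.var _
      · by_cases h : j = j₀
        · simp only [Sum.elim_inr, h, dite_true]
          exact TermL.smul _ (TermL.sub
            (TermL.sum _ fun k => TermL.smul _ (ElemT.var _))
            (TermL.sum _ fun k => TermL.smul _ (ElemT.var _)))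
        · simp only [Sum.elim_inr, h, dite_false]
          exact ElemT.var _
    · intro N e A hG heq
      refine ⟨Sum.elim (e ∘ Sum.inl) (fun j => e (Sum.inr j)), fun j => hG j, ?_⟩
      rintro (i | j)
      · simp
      · by_cases h : j = j₀
        · subst h
          simp only [Sum.elim_inl, dite_true, Sum.elim_inr]
          have heq' : ∑ j, l j • e (Sum.inr j) = ∑ k, ν k • A k := heq
          rw [eq_inv_smul_iff₀ hj₀, eq_sub_iff_add_eq, ← heq',
            ← Fintype.sum_subtype_add_sum_subtype (fun i => i ≠ j)
              (fun j => l j • e (Sum.inr j)), add_comm]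
          congr 1
          have : ∀ i : {i // ¬ i ≠ j}, i = ⟨j, by simp⟩ := fun i =>
            Subtype.ext (not_not.1 i.2)
          rw [Fintype.sum_eq_single ⟨j, by simp⟩ (fun j hj => absurd (this j) hj)]
        · simp [h]

end Good

section Types

variable {𝔽 : Type u} [Field 𝔽] {L' : FirstOrder.Language.{u, u}}
variable {Rs : Subring 𝔽} {T : (fullLang 𝔽 L').Theory} {α β γ ι' κ' ι κ υ : Type}

/-- Compactness over models of `T_G`, for one new element. -/
theorem exists_ext_one (N : TGMod Rs T) (e : β → N.carrier) {J : Type*}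
    (P : J → ∀ N : TGMod Rs T, (β → N.carrier) → N.carrier → Prop)
    (hP : ∀ j, DefG (fun N (v : β ⊕ Unit → N.carrier) => P j N (v ∘ Sum.inl) (v (Sum.inr ()))))
    (hfin : ∀ s : Finset J, ∃ x : N.carrier, ∀ j ∈ s, P j N e x) :
    ∃ (N' : TGMod Rs T) (f : Ext N N') (x : N'.carrier), ∀ j, P j N' (fun b => f (e b)) x := by
  obtain ⟨N', f, v, hv⟩ := exists_ext (α := Unit) N e _ hP (fun s => by
    obtain ⟨x, hx⟩ := hfin s
    exact ⟨fun _ => x, hx⟩)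
  exact ⟨N', f, v (), hv⟩

/-- Two tuples have the same `L`-type. -/
def SameL (N : TGMod Rs T) (e₁ e₂ : β → N.carrier) : Prop :=
  ∀ φ : (fullLang 𝔽 L').Formula β, φ.Realize e₁ ↔ φ.Realize e₂

/-- Two tuples in the generic submodule have the same type in the language of modules. -/
def SameR (N : TGMod Rs T) (v v' : α → ↥N.G) : Prop :=
  ∀ φ : (vsLang ↥Rs).Formula α, φ.Realize v ↔ φ.Realize v'

section SameL

variable {N N' : TGMod Rs T} {e e' e'' : β → N.carrier}

theorem SameL.refl (e : β → N.carrier) : SameL N e e := fun _ => Iff.rfl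

theorem SameL.symm (h : SameL N e e') : SameL N e' e := fun φ => (h φ).symm

theorem SameL.trans (h : SameL N e e') (h' : SameL N e' e'') : SameL N e e'' :=
  fun φ => (h φ).trans (h' φ)

theorem SameL.iff (h : SameL N e e') {P : ∀ N : TGMod Rs T, (β → N.carrier) → Prop}
    (hP : DefL P) : P N e ↔ P N e' := by
  obtain ⟨φ, hφ⟩ := hP
  rw [hφ, hφ]
  exact h φ

theorem SameL.subst (h : SameL N e e') {t : γ → ∀ N : TGMod Rs T, (β → N.carrier) → N.carrier}
    (ht : ∀ c, TermL (t c)) : SameL N (fun c => t c N e) (fun c => t c N e') :=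
  fun φ => h.iff (Elem.subst (C := fun N : TGMod Rs T => N.carrier) (Elem.of φ) ht)

theorem SameL.comp (h : SameL N e e') (g : γ → β) : SameL N (e ∘ g) (e' ∘ g) :=
  h.subst (fun c => ElemT.var (g c))

theorem SameL.map (h : SameL N e e') (f : Ext N N') :
    SameL N' (fun b => f (e b)) (fun b => f (e' b)) := fun φ => by
  have := DefL.toG (Rs := Rs) (T := T) (Elem.of φ)
  exact (f.defG_iff this e).trans ((h φ).trans (f.defG_iff this e').symm)

end SameL

section SameR

variable {N N' : TGMod Rs T} {v v' v'' : α → ↥N.G}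

theorem SameR.refl (v : α → ↥N.G) : SameR N v v := fun _ => Iff.rfl

theorem SameR.symm (h : SameR N v v') : SameR N v' v := fun φ => (h φ).symm

theorem SameR.trans (h : SameR N v v') (h' : SameR N v' v'') : SameR N v v'' :=
  fun φ => (h φ).trans (h' φ)

theorem SameR.iff (h : SameR N v v') {P : ∀ N : TGMod Rs T, (α → ↥N.G) → Prop}
    (hP : DefR P) : P N v ↔ P N v' := by
  obtain ⟨φ, hφ⟩ := hP
  rw [hφ, hφ]
  exact h φ

theorem SameR.subst (h : SameR N v v') {t : γ → ∀ N : TGMod Rs T, (α → ↥N.G) → ↥N.G}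
    (ht : ∀ c, TermR (t c)) : SameR N (fun c => t c N v) (fun c => t c N v') :=
  fun φ => h.iff (Elem.subst (C := fun N : TGMod Rs T => ↥N.G) (Elem.of φ) ht)

theorem SameR.comp (h : SameR N v v') (g : γ → α) : SameR N (v ∘ g) (v' ∘ g) :=
  h.subst (fun c => ElemT.var (g c))

theorem SameR.map (h : SameR N v v') (f : Ext N N') :
    SameR N' (fun b => f.res (v b)) (fun b => f.res (v' b)) := fun φ => by
  have : DefR (Rs := Rs) (T := T) _ := Elem.of φ
  exact (f.defR_iff this v).trans ((h φ).trans (f.defR_iff this v').symm)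

end SameR

/-- Finitely many conditions on an independent element have infinitely many solutions over a
tuple of the same type. -/
theorem SameL.infinite [Finite β] {N : TGMod Rs T} {e e' : β → N.carrier} (h : SameL N e e')
    {c : N.carrier} (hc : c ∉ N.sp e) (s : Finset ((fullLang 𝔽 L').Formula (β ⊕ Unit))) :
    ∃ P : ∀ N : TGMod Rs T, (β → N.carrier) → N.carrier → Prop, DefL1 P ∧
      {y | P N e' y}.Infinite ∧ ∀ y, P N e' y → ∀ φ ∈ s,
        (φ.Realize (Sum.elim e' (fun _ => y)) ↔ φ.Realize (Sum.elim e (fun _ => c))) := by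
  let P : ∀ N : TGMod Rs T, (β → N.carrier) → N.carrier → Prop := fun N' v y => ∀ φ ∈ s,
        (φ.Realize (Sum.elim v (fun _ => y)) ↔
          (φ.Realize (M := N.carrier) (Sum.elim e (fun _ => c))))
  have hP : DefL1 P := Elem.forall_mem _ fun φ _ => Elem.iff
    ((Elem.of φ).congr fun N v => iff_of_eq (congrArg _ (by
      funext b; rcases b with b | b <;> rfl))) (Elem.const _)
  refine ⟨P, hP, (h.iff (hP.infinite N.facts)).1 ?_, fun y hy => hy⟩
  exact hP.infinite_of_notMem_span N e (fun φ _ => Iff.rfl) hc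

theorem SameL.exists_divisible [Finite β] [Fintype γ] {N : TGMod Rs T} {e e' : β → N.carrier}
    (h : SameL N e e') {c : N.carrier} (hc : c ∉ N.sp e) (w : N.carrier) (o : γ → N.carrier) :
    ∃ (N' : TGMod Rs T) (f : Ext N N') (d : N'.carrier),
      (∀ r : ↥Rs, r ≠ 0 → ∃ g ∈ N'.G, (r : 𝔽) • g = d) ∧ d ∉ N'.sp (fun b => f (o b)) ∧
      SameL N' (Sum.elim (fun b => f (e b)) (fun _ : Unit => f c))
        (Sum.elim (fun b => f (e' b)) (fun _ : Unit => f w + d)) := by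
  classical
  let J := (fullLang 𝔽 L').Formula (β ⊕ Unit) ⊕ {r : ↥Rs // r ≠ 0} ⊕ (γ → 𝔽)
  let P : J → ∀ N : TGMod Rs T, ((β ⊕ Unit) ⊕ γ → N.carrier) → N.carrier → Prop
    | Sum.inl φ => fun N' v y => φ.Realize (Sum.elim (fun b => v (Sum.inl (Sum.inl b)))
        (fun _ => v (Sum.inl (Sum.inr ())) + y)) ↔
          φ.Realize (M := N.carrier) (Sum.elim e (fun _ => c))
    | Sum.inr (Sum.inl r) => fun N' v y => ∃ g, g ∈ N'.G ∧ (r.1 : 𝔽) • g = y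
    | Sum.inr (Sum.inr μ) => fun N' v y => ¬ y = ∑ k, μ k • v (Sum.inr k)
  obtain ⟨N', f, d, hd⟩ := exists_ext_one N (Sum.elim (Sum.elim e' (fun _ => w)) o) P (by
    rintro (φ | r | μ)
    · refine Elem.iff (DefL.toG ?_) (Elem.const _)
      refine (Elem.subst (Elem.of φ) (s := Sum.elim (fun b N v => v (Sum.inl (Sum.inl (Sum.inl b))))
        (fun _ N v => v (Sum.inl (Sum.inl (Sum.inr ()))) + v (Sum.inr ()))) ?_).congr ?_
      · rintro (b | b)
        exacts [ElemT.var _, TermL.add (ElemT.var _) (ElemT.var _)]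
      · intro N v
        refine iff_of_eq (congrArg _ ?_)
        funext b; rcases b with b | b <;> rfl
    · exact Elem.ex1 (Elem.and (DefG.memG (ElemT.var _))
        (DefL.toG (Elem.eq (TermL.smul _ (ElemT.var _)) (ElemT.var _))))
    · exact Elem.not (DefL.toG (Elem.eq (ElemT.var _)
        (TermL.sum _ fun k => TermL.smul _ (ElemT.var _))))) (by
    intro s
    obtain ⟨Q, hQ, hinf, hQ'⟩ := h.infinite hc s.toLeft
    let ms : Finset (γ → 𝔽) := s.toRight.toRight
    let rs : Finset {r : ↥Rs // r ≠ 0} := s.toRight.toLeft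
    let Q' : ∀ N : TGMod Rs T, ((β ⊕ Unit) ⊕ γ → N.carrier) → N.carrier → Prop := fun N v y =>
      Q N (fun b => v (Sum.inl (Sum.inl b))) (v (Sum.inl (Sum.inr ())) + y) ∧
        ∀ μ ∈ ms, ¬ y = ∑ k, μ k • v (Sum.inr k)
    have hQd : DefL1 Q' := by
      refine Elem.and ?_ (Elem.forall_mem _ fun μ _ => Elem.not (Elem.eq (ElemT.var _)
        (TermL.sum _ fun k => TermL.smul _ (ElemT.var _))))
      refine (Elem.subst hQ (s := Sum.elim (fun b N v => v (Sum.inl (Sum.inl (Sum.inl b))))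
        (fun _ N v => v (Sum.inl (Sum.inl (Sum.inr ()))) + v (Sum.inr ()))) ?_)
      rintro (b | b)
      exacts [ElemT.var _, TermL.add (ElemT.var _) (ElemT.var _)]
    have hinf2 : {y | Q' N (Sum.elim (Sum.elim e' (fun _ => w)) o) y}.Infinite := by
      have h1 : {y | Q N e' (w + y)}.Infinite :=
        hinf.preimage (f := fun y => w + y) (fun y _ => ⟨y - w, by simp⟩)
      refine (h1.sdiff (ms.image (fun μ => ∑ k, μ k • o k)).finite_toSet).mono ?_
      rintro y ⟨hy1, hy2⟩
      refine ⟨hy1, fun μ hμ h => hy2 ?_⟩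
      simp only [Finset.coe_image, Set.mem_image, Finset.mem_coe]
      exact ⟨μ, hμ, h.symm⟩
    obtain ⟨g, hg, hg1, hg2⟩ := hQd.exists_smul N _ hinf2 (r := ((∏ r ∈ rs, r.1 : ↥Rs) : 𝔽))
      (Subtype.mem _) (by
        simp only [ne_eq, ZeroMemClass.coe_eq_zero, Finset.prod_eq_zero_iff, not_exists, not_and]
        exact fun r _ => r.2)
    refine ⟨((∏ r ∈ rs, r.1 : ↥Rs) : 𝔽) • g, ?_⟩
    rintro (φ | r | μ) hj
    · exact hQ' _ hg1 φ (Finset.mem_toLeft.2 hj)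
    · have hr : r ∈ rs := by simpa [rs] using hj
      refine ⟨(∏ r ∈ rs.erase r, r.1 : ↥Rs) • g, N.G.smul_mem _ hg, ?_⟩
      rw [← Finset.mul_prod_erase rs _ hr, Subring.coe_mul, mul_smul]
      rfl
    · exact hg2 μ (by simpa [ms] using hj))
  refine ⟨N', f, d, fun r hr => ?_, fun hmem => ?_, fun φ => ?_⟩
  · obtain ⟨g, hg⟩ := hd (Sum.inr (Sum.inl ⟨r, hr⟩))
    exact ⟨g, hg⟩
  · obtain ⟨μ, hμ⟩ := (N'.mem_sp_iff _).1 hmem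
    exact hd (Sum.inr (Sum.inr μ)) hμ
  · refine Iff.trans ?_ (hd (Sum.inl φ)).symm
    have := f.defG_iff (DefL.toG (Rs := Rs) (T := T) (Elem.of φ)) (Sum.elim e (fun _ => c))
    refine Iff.trans (iff_of_eq (congrArg _ ?_)) this
    funext b; rcases b with b | b <;> rfl

theorem SameL.exists_notMem [Finite β] [Fintype γ] {N : TGMod Rs T} {e e' : β → N.carrier}
    (h : SameL N e e') {c : N.carrier} (hc : c ∉ N.sp e) (o : γ → N.carrier) :
    ∃ (N' : TGMod Rs T) (f : Ext N N') (d : N'.carrier),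
      d ∉ N'.sp (fun b => f (o b)) ⊔ N'.W ∧
      SameL N' (Sum.elim (fun b => f (e b)) (fun _ : Unit => f c))
        (Sum.elim (fun b => f (e' b)) (fun _ : Unit => d)) := by
  classical
  let K := (γ → 𝔽) × Σ m : ℕ, Fin m → 𝔽
  let J := (fullLang 𝔽 L').Formula (β ⊕ Unit) ⊕ K
  let P : J → ∀ N : TGMod Rs T, (β ⊕ γ → N.carrier) → N.carrier → Prop
    | Sum.inl φ => fun N' v y => φ.Realize (Sum.elim (v ∘ Sum.inl) (fun _ => y)) ↔
          φ.Realize (M := N.carrier) (Sum.elim e (fun _ => c))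
    | Sum.inr p => fun N' v y => ¬ ∃ t : Fin p.2.1 → N'.carrier, (∀ k, t k ∈ N'.G) ∧
        y = ∑ k, p.1 k • v (Sum.inr k) + ∑ k, p.2.2 k • t k
  obtain ⟨N', f, d, hd⟩ := exists_ext_one N (Sum.elim e' o) P (by
    rintro (φ | p)
    · refine Elem.iff (DefL.toG ?_) (Elem.const _)
      refine ((Elem.of φ).relabel (Sum.elim (Sum.inl ∘ Sum.inl) Sum.inr)).congr ?_
      intro N v
      refine iff_of_eq (congrArg _ ?_)
      funext b; rcases b with b | b <;> rfl
    · refine Elem.not (Elem.ex (Elem.and (Elem.forall_fin fun k => DefG.memG (ElemT.var _))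
        (DefL.toG (Elem.eq (ElemT.var _) ?_))))
      exact TermL.add (TermL.sum _ fun i => TermL.smul _ (ElemT.var _))
        (TermL.sum _ fun i => TermL.smul _ (ElemT.var _))) (by
    intro s
    obtain ⟨Q, hQ, hinf, hQ'⟩ := h.infinite hc s.toLeft
    let ps : Finset K := s.toRight
    let E := ps.equivFin
    have hQd : DefL1 (β := β ⊕ γ) (fun N v y => Q N (v ∘ Sum.inl) y) :=
      (hQ.relabel (Sum.elim (Sum.inl ∘ Sum.inl) Sum.inr))
    obtain ⟨x, hx1, hx2⟩ := hQd.exists_forall_ne (γ := Σ q : Fin ps.card, Fin (E.symm q).1.2.1)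
      N (Sum.elim e' o) hinf
      (t := fun q N v => ∑ k, (E.symm q).1.1 k • v (Sum.inl (Sum.inr k)) +
        ∑ k, (E.symm q).1.2.2 k • v (Sum.inr ⟨q, k⟩)) (fun q =>
        TermL.add (TermL.sum _ fun i => TermL.smul _ (ElemT.var _))
        (TermL.sum _ fun i => TermL.smul _ (ElemT.var _)))
    refine ⟨x, ?_⟩
    rintro (φ | p) hj
    · exact hQ' _ hx1 φ (Finset.mem_toLeft.2 hj)
    · rintro ⟨t, ht, hx⟩
      have hp : p ∈ ps := Finset.mem_toRight.2 hj
      have hq : (E.symm (E ⟨p, hp⟩)).1 = p := by simp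
      have key : ∀ q : K, q = p → ∃ t' : Fin q.2.1 → N.carrier, (∀ k, t' k ∈ N.G) ∧
          x = ∑ k, q.1 k • o k + ∑ k, q.2.2 k • t' k := by
        rintro q rfl
        exact ⟨t, ht, hx⟩
      obtain ⟨t', ht', hx'⟩ := key _ hq
      refine hx2 (fun z => if hz : z.1 = E ⟨p, hp⟩ then t' (hz ▸ z.2) else 0) ?_ (E ⟨p, hp⟩) ?_
      · rintro ⟨z, k⟩
        dsimp only
        split_ifs with hz
        exacts [ht' _, N.G.zero_mem]
      · simpa using hx')
  refine ⟨N', f, d, fun hmem => ?_, fun φ => ?_⟩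
  · obtain ⟨ν, m, τ, t, ht, hd'⟩ := (N'.mem_sp_sup_W_iff _).1 hmem
    exact hd (Sum.inr (ν, ⟨m, τ⟩)) ⟨t, ht, hd'⟩
  · refine Iff.trans ?_ (hd (Sum.inl φ)).symm
    have := f.defG_iff (DefL.toG (Rs := Rs) (T := T) (Elem.of φ)) (Sum.elim e (fun _ => c))
    refine Iff.trans (iff_of_eq (congrArg _ ?_)) this
    funext b; rcases b with b | b <;> rfl

end Types

section Shear

variable {𝔽 : Type u} [Field 𝔽] {L' : FirstOrder.Language.{u, u}}
variable {Rs : Subring 𝔽} {T : (fullLang 𝔽 L').Theory} {α β γ ι' κ' ι κ υ : Type}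

theorem SameR.of_linearEquiv {N : TGMod Rs T} (σ : ↥N.G ≃ₗ[↥Rs] ↥N.G) (v : α → ↥N.G) :
    SameR N v (fun a => σ (v a)) := by
  intro φ
  let E : ↥N.G ≃[vsLang ↥Rs] ↥N.G :=
    { toEquiv := σ.toEquiv
      map_fun' := by
        intro n f x
        match n, f, x with
        | 0, _, _ => exact σ.map_zero
        | 1, r, x => exact σ.map_smul (show ↥Rs from r) (x 0)
        | 2, _, x => exact σ.map_add (x 0) (x 1)
        | _ + 3, f, _ => exact (show PEmpty from f).elim
      map_rel' := fun {n} r => (show PEmpty from r).elim }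
  exact (StrongHomClass.realize_formula E φ).symm

theorem exists_projection (Rs : Subring 𝔽) : ∃ π : 𝔽 →ₗ[↥Rs] 𝔽, π 1 = 1 ∧
    ∀ x, ∃ a b : ↥Rs, b ≠ 0 ∧ π x = a / b := by
  let K := Subfield.closure (Rs : Set 𝔽)
  obtain ⟨π, hπ⟩ := LinearMap.exists_leftInverse_of_injective (Algebra.linearMap K 𝔽)
    (LinearMap.ker_eq_bot.2 Subtype.val_injective)
  have hsub : (Rs : Set 𝔽) ⊆ K := Subfield.subset_closure
  refine ⟨{ toFun := fun x => (π x : 𝔽)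
            map_add' := by simp
            map_smul' := fun r x => ?_ }, ?_, fun x => ?_⟩
  · have := π.map_smul (⟨r, hsub r.2⟩ : K) x
    exact congrArg Subtype.val this
  · have := LinearMap.congr_fun hπ 1
    simpa using congrArg Subtype.val this
  · obtain ⟨y, hy, z, hz, h⟩ := Subfield.mem_closure_iff.1 (π x).2
    rw [Subring.closure_eq] at hy hz
    by_cases hz0 : z = 0
    · exact ⟨0, 1, one_ne_zero, by simpa [hz0] using h.symm⟩
    · exact ⟨⟨y, hy⟩, ⟨z, hz⟩, fun h => hz0 (congrArg Subtype.val h), h.symm⟩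

theorem sameR_shear (N : TGMod Rs T) {S : Submodule 𝔽 N.carrier} {w d : ↥N.G}
    (hw : (w : N.carrier) ∉ S) (hd : ∀ r : ↥Rs, r ≠ 0 → ∃ g ∈ N.G, (r : 𝔽) • g = d)
    (hdw : (d : N.carrier) ∉ S ⊔ Submodule.span 𝔽 {(w : N.carrier)}) {o : α → ↥N.G}
    (ho : ∀ a, (o a : N.carrier) ∈ S) :
    SameR N (Sum.elim o (fun _ : Unit => w)) (Sum.elim o (fun _ => w + d)) := by
  have hwd : (w : N.carrier) ∉ S ⊔ Submodule.span 𝔽 {(d : N.carrier)} := by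
    intro h
    obtain ⟨s, hs, y, hy, hsy⟩ := Submodule.mem_sup.1 h
    obtain ⟨μ, rfl⟩ := Submodule.mem_span_singleton.1 hy
    have hμ : μ ≠ 0 := by
      rintro rfl
      rw [zero_smul, add_zero] at hsy
      exact hw (hsy ▸ hs)
    apply hdw
    rw [Submodule.mem_sup]
    refine ⟨-(μ⁻¹ • s), S.neg_mem (S.smul_mem _ hs), μ⁻¹ • (w : N.carrier),
      Submodule.smul_mem _ _ (Submodule.mem_span_singleton_self _), ?_⟩
    rw [← hsy, smul_add, smul_smul, inv_mul_cancel₀ hμ, one_smul]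
    abel
  obtain ⟨ℓ₀, h1, h2⟩ := Submodule.exists_le_ker_of_notMem hwd
  obtain ⟨ℓ, hℓw, hℓ⟩ : ∃ ℓ : N.carrier →ₗ[𝔽] 𝔽, ℓ w = 1 ∧
      S ⊔ Submodule.span 𝔽 {(d : N.carrier)} ≤ LinearMap.ker ℓ := by
    refine ⟨(ℓ₀ w)⁻¹ • ℓ₀, ?_, fun x hx => ?_⟩
    · simpa using inv_mul_cancel₀ h1
    · have : ℓ₀ x = 0 := h2 hx
      simp [this]
  have hℓd : ℓ d = 0 := hℓ (Submodule.mem_sup_right (Submodule.mem_span_singleton_self _))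
  obtain ⟨π, hπ1, hπ⟩ := exists_projection Rs
  have hG : ∀ x : N.carrier, π (ℓ x) • (d : N.carrier) ∈ N.G := by
    intro x
    obtain ⟨a, b, hb, hab⟩ := hπ (ℓ x)
    obtain ⟨g, hg, hgd⟩ := hd b hb
    have hb' : (b : 𝔽) ≠ 0 := fun h => hb (Subtype.ext h)
    rw [hab, ← hgd, smul_smul, div_mul_cancel₀ _ hb']
    exact N.G.smul_mem a hg
  let τ : ↥N.G →ₗ[↥Rs] ↥N.G :=
    { toFun := fun x => ⟨π (ℓ x) • (d : N.carrier), hG x⟩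
      map_add' := fun x y => Subtype.ext (by simp [add_smul])
      map_smul' := fun r x => Subtype.ext (by
        have h3 : ℓ ((r • x : ↥N.G) : N.carrier) = r • ℓ (x : N.carrier) := ℓ.map_smul (r : 𝔽) x
        simp only [h3, map_smul, RingHom.id_apply]
        exact mul_smul (r : 𝔽) _ _) }
  have hττ : ∀ x, τ (τ x) = 0 := fun x => Subtype.ext (by
    change π (ℓ (π (ℓ x) • (d : N.carrier))) • (d : N.carrier) = 0
    simp [hℓd])
  let σ : ↥N.G ≃ₗ[↥Rs] ↥N.G := LinearEquiv.ofLinearMap (LinearMap.id + τ) (LinearMap.id - τ)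
    (by ext1 x; simp [hττ]) (by ext1 x; simp [hττ])
  have key := SameR.of_linearEquiv σ (Sum.elim o (fun _ : Unit => w))
  refine fun φ => (key φ).trans (iff_of_eq (congrArg _ ?_))
  funext a
  rcases a with a | a
  · have : ℓ (o a : N.carrier) = 0 := hℓ (Submodule.mem_sup_left (ho a))
    refine Subtype.ext ?_
    change (o a : N.carrier) + π (ℓ (o a : N.carrier)) • (d : N.carrier) = o a
    simp [this]
  · refine Subtype.ext ?_
    change (w : N.carrier) + π (ℓ (w : N.carrier)) • (d : N.carrier) = w + d
    rw [hℓw, hπ1, one_smul]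

/-- An element of `G` in the span of a tuple of elements of `G` is a rational combination. -/
theorem TGMod.exists_rational (N : TGMod Rs T) [Fintype γ] {o : γ → N.carrier}
    (ho : ∀ c, o c ∈ N.G) {w : N.carrier} (hw : w ∈ N.G) (h : w ∈ N.sp o) :
    ∃ r : ↥Rs, r ≠ 0 ∧ ∃ c : γ → ↥Rs, (r : 𝔽) • w = ∑ j, (c j : 𝔽) • o j := by
  classical
  obtain ⟨I, hI, hI'⟩ := exists_maximal_linearIndepOn 𝔽 o
  have h1 : ∀ j, o j ∈ Submodule.span 𝔽 (o '' I) := by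
    intro j
    by_cases hj : j ∈ I
    · exact Submodule.subset_span ⟨j, hj, rfl⟩
    · obtain ⟨a, ha, hj'⟩ := hI' j hj
      exact (Submodule.smul_mem_iff _ ha).1 hj'
  have h2 : w ∈ Submodule.span 𝔽 (Set.range fun j : I => o j) := by
    rw [← Set.image_eq_range]
    exact Submodule.span_le.2 (by rintro _ ⟨j, rfl⟩; exact h1 j) h
  obtain ⟨μ, hμ⟩ := Submodule.mem_span_range_iff_exists_fun 𝔽 |>.1 h2
  obtain ⟨r, hr, c, hc⟩ := N.exists_denominator (g := fun j : I => o j) (fun j => ho j)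
    (fun ν hν => funext (Fintype.linearIndependent_iff.1 hI ν hν)) (μ := μ) (by rw [hμ]; exact hw)
  refine ⟨r, hr, fun j => if hj : j ∈ I then c ⟨j, hj⟩ else 0, ?_⟩
  rw [← hμ, Finset.smul_sum, ← Fintype.sum_subtype_add_sum_subtype (fun j => j ∈ I)]
  have h3 : ∑ j : {j // ¬ j ∈ I}, ((if hj : j.1 ∈ I then c ⟨j.1, hj⟩ else 0 : ↥Rs) : 𝔽) • o j
      = 0 := Finset.sum_eq_zero fun j _ => by simp [j.2]
  rw [h3, add_zero]
  exact Finset.sum_congr rfl fun j _ => by simp [hc, smul_smul]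

end Shear

section Indep

variable {𝔽 : Type u} [Field 𝔽] {L' : FirstOrder.Language.{u, u}}
variable {Rs : Subring 𝔽} {T : (fullLang 𝔽 L').Theory} {α β γ ι' κ' ι κ υ : Type}

/-- A tuple is linearly independent over a subspace. -/
def IndepOver (N : TGMod Rs T) [Fintype κ] (S : Submodule 𝔽 N.carrier) (c : κ → N.carrier) :
    Prop :=
  ∀ m : κ → 𝔽, ∑ j, m j • c j ∈ S → m = 0

theorem goodOver_iff_indepOver {N : TGMod Rs T} [Fintype ι] [Fintype κ]
    {S : Submodule 𝔽 N.carrier} {e : ι ⊕ κ → N.carrier} : GoodOver N S e ↔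
      IndepOver N (S ⊔ N.W) (e ∘ Sum.inl) ∧ IndepOver N S (e ∘ Sum.inr) := Iff.rfl

theorem IndepOver.mono {N : TGMod Rs T} [Fintype κ] {S S' : Submodule 𝔽 N.carrier}
    {c : κ → N.carrier} (h : IndepOver N S c) (hS : S' ≤ S) : IndepOver N S' c :=
  fun m hm => h m (hS hm)

theorem IndepOver.comp {N : TGMod Rs T} [Fintype κ] [Fintype ι] {S : Submodule 𝔽 N.carrier}
    {c : κ → N.carrier} (h : IndepOver N S c) {g : ι → κ} (hg : g.Injective) :
    IndepOver N S (c ∘ g) := by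
  classical
  intro m hm
  have h1 := h (fun j => ∑ i, if g i = j then m i else 0) (by
    convert hm using 1
    simp only [Finset.sum_smul, ite_smul, zero_smul, Function.comp_apply]
    rw [Finset.sum_comm]
    simp)
  funext i
  have h2 := congrFun h1 (g i)
  simpa [hg.eq_iff] using h2

theorem indepOver_option {N : TGMod Rs T} [Fintype κ] {S : Submodule 𝔽 N.carrier}
    {c : Option κ → N.carrier} : IndepOver N S c ↔
      IndepOver N S (fun j => c (some j)) ∧ c none ∉ S ⊔ N.sp (fun j => c (some j)) := by
  constructor
  · intro h
    refine ⟨h.comp (Option.some_injective _), fun hn => ?_⟩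
    obtain ⟨s, hs, y, hy, hsy⟩ := Submodule.mem_sup.1 hn
    obtain ⟨μ, rfl⟩ := (N.mem_sp_iff _).1 hy
    have := congrFun (h (fun o => o.elim 1 (fun j => - μ j)) (by
      rw [Fintype.sum_option]
      simp only [Option.elim, one_smul, neg_smul, Finset.sum_neg_distrib]
      rw [← hsy]
      simpa using hs)) none
    simp at this
  · rintro ⟨h1, h2⟩ m hm
    rw [Fintype.sum_option] at hm
    have h0 : m none = 0 := by
      by_contra h0
      apply h2
      rw [← Submodule.smul_mem_iff _ h0, Submodule.mem_sup]
      exact ⟨_, hm, -∑ j, m (some j) • c (some j), Submodule.neg_mem _ ((N.mem_sp_iff _).2 ⟨_, rfl⟩),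
        by abel⟩
    rw [h0, zero_smul, zero_add] at hm
    have h3 := h1 (fun j => m (some j)) hm
    funext o
    cases o with
    | none => exact h0
    | some j => exact congrFun h3 j

theorem IndepOver.map {N N' : TGMod Rs T} [Fintype κ] [Fintype υ] (f : Ext N N')
    {A : υ → N.carrier} {c : κ → N.carrier} (h : IndepOver N (N.sp A) c) :
    IndepOver N' (N'.sp (fun a => f (A a))) (fun j => f (c j)) := by
  have := (GoodOver.map_iff f (A := A) (e := Sum.elim (Empty.elim) c)).2
    ⟨fun l _ => funext fun i => i.elim, h⟩
  exact this.2

theorem IndepOver.map_sup {N N' : TGMod Rs T} [Fintype κ] [Fintype υ] (f : Ext N N')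
    {A : υ → N.carrier} {c : κ → N.carrier} (h : IndepOver N (N.sp A ⊔ N.W) c) :
    IndepOver N' (N'.sp (fun a => f (A a)) ⊔ N'.W) (fun j => f (c j)) := by
  have := (GoodOver.map_iff f (A := A) (e := Sum.elim c (Empty.elim))).2
    ⟨h, fun l _ => funext fun i => i.elim⟩
  exact this.1

theorem TGMod.sp_elim (N : TGMod Rs T) (A : υ → N.carrier) (B : γ → N.carrier) :
    N.sp (Sum.elim A B) = N.sp A ⊔ N.sp B := by
  rw [TGMod.sp, Set.Sum.elim_range, Submodule.span_union]

theorem IndepOver.sum_elim {N : TGMod Rs T} [Fintype κ] [Fintype ι] {S : Submodule 𝔽 N.carrier}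
    {c : ι ⊕ κ → N.carrier} (h : IndepOver N S c) :
    IndepOver N (S ⊔ N.sp (c ∘ Sum.inr)) (c ∘ Sum.inl) := by
  intro m hm
  obtain ⟨s, hs, y, hy, hsy⟩ := Submodule.mem_sup.1 hm
  obtain ⟨μ, rfl⟩ := (N.mem_sp_iff _).1 hy
  have := h (Sum.elim m (fun j => - μ j)) (by
    rw [Fintype.sum_sum_type]
    simp only [Sum.elim_inl, Sum.elim_inr, neg_smul, Finset.sum_neg_distrib]
    have h2 : ∑ i, m i • c (Sum.inl i) = s + ∑ j, μ j • c (Sum.inr j) := hsy.symm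
    rw [h2]
    simpa using hs)
  funext i
  exact congrFun this (Sum.inl i)

theorem SameL.indepOver {N : TGMod Rs T} [Fintype κ] [Fintype υ] {A A' : υ → N.carrier}
    {c c' : κ → N.carrier} (h : SameL N (Sum.elim A c) (Sum.elim A' c'))
    (hc : IndepOver N (N.sp A) c) : IndepOver N (N.sp A') c' := by
  intro m hm
  obtain ⟨μ, hμ⟩ := (N.mem_sp_iff _).1 hm
  refine hc m ((N.mem_sp_iff _).2 ⟨μ, ?_⟩)
  refine (h.iff (P := fun N v => ∑ j, m j • v (Sum.inr j) = ∑ j, μ j • v (Sum.inl j)) ?_).2 hμ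
  exact Elem.eq (TermL.sum _ fun b => TermL.smul _ (ElemT.var _))
    (TermL.sum _ fun b => TermL.smul _ (ElemT.var _))

/-- Types of tuples of `G` extend. -/
theorem SameR.exists_realize [Finite α] {N : TGMod Rs T} {v v' : α → ↥N.G} (h : SameR N v v')
    (t : ↥N.G) : ∃ (N' : TGMod Rs T) (f : Ext N N') (w : ↥N'.G),
      SameR N' (Sum.elim (fun a => f.res (v a)) (fun _ : Unit => f.res t))
        (Sum.elim (fun a => f.res (v' a)) (fun _ => w)) := by
  let P : (vsLang ↥Rs).Formula (α ⊕ Unit) → ∀ N : TGMod Rs T, (α → N.carrier) → N.carrier → Prop :=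
    fun φ N' u y => ∃ hv : ∀ a : α ⊕ Unit, Sum.elim u (fun _ => y) a ∈ N'.G,
      (φ.Realize (M := ↥N'.G) (fun a => ⟨_, hv a⟩) ↔
        φ.Realize (M := ↥N.G) (Sum.elim v (fun _ => t)))
  obtain ⟨N', f, w, hw⟩ := exists_ext_one N (fun a => (v' a : N.carrier)) P (fun φ =>
    (DefR.toG (t := Sum.elim (fun a N v => v (Sum.inl a)) (fun _ N v => v (Sum.inr ())))
      (Elem.iff (Elem.of φ) (Elem.const (φ.Realize (M := ↥N.G) (Sum.elim v (fun _ => t)))))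
      (by rintro (a | a) <;> exact ElemT.var _)).congr (fun N u => by
        have : (Sum.elim (fun a => u (Sum.inl a)) (fun _ => u (Sum.inr ())) : α ⊕ Unit → _) =
          fun a => Sum.elim (fun a N (v : α ⊕ Unit → TGMod.carrier N) => v (Sum.inl a))
            (fun _ N v => v (Sum.inr ())) a N u := by funext a; rcases a with a | a <;> rfl
        simp only [P, Function.comp_def, this])) (by
    intro s
    have hd : DefR (Rs := Rs) (T := T) (fun N' (u : α → ↥N'.G) => ∃ y : ↥N'.G, ∀ φ ∈ s,
        (φ.Realize (M := ↥N'.G) (Sum.elim u (fun _ => y)) ↔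
        φ.Realize (M := ↥N.G) (Sum.elim v (fun _ => t)))) :=
      Elem.ex1 (Elem.forall_mem _ fun φ _ => Elem.iff ((Elem.of φ).congr fun N u =>
        iff_of_eq (congrArg _ (by funext a; rcases a with a | a <;> rfl))) (Elem.const _))
    obtain ⟨y, hy⟩ := (h.iff hd).1 ⟨t, fun φ _ => Iff.rfl⟩
    refine ⟨y, fun φ hφ => ⟨?_, ?_⟩⟩
    · rintro (a | a)
      exacts [(v' a).2, y.2]
    · refine Iff.trans (iff_of_eq (congrArg _ ?_)) (hy φ hφ)
      funext a; rcases a with a | a <;> rfl)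
  obtain ⟨hw0, -⟩ := hw ⊤
  refine ⟨N', f, ⟨w, hw0 (Sum.inr ())⟩, fun φ => ?_⟩
  obtain ⟨hw1, hw2⟩ := hw φ
  have h1 := f.defR_iff (Elem.of φ) (Sum.elim v (fun _ => t))
  refine Iff.trans (Iff.trans (iff_of_eq (congrArg _ ?_)) h1) (hw2.symm.trans
    (iff_of_eq (congrArg _ ?_)))
  all_goals funext a; rcases a with a | a <;> rfl

end Indep

section Realize

variable {𝔽 : Type u} [Field 𝔽] {L' : FirstOrder.Language.{u, u}}
variable {Rs : Subring 𝔽} {T : (fullLang 𝔽 L').Theory} {α β γ ι' κ' ι κ υ : Type}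

/-- Composition of elementary extensions. -/
def Ext.trans {N₁ N₂ N₃ : TGMod Rs T} (f : Ext N₁ N₂) (g : Ext N₂ N₃) : Ext N₁ N₃ := g.comp f

/-- The identity extension. -/
def Ext.refl (N : TGMod Rs T) : Ext N N := ElementaryEmbedding.refl _ _

@[simp] theorem Ext.trans_apply {N₁ N₂ N₃ : TGMod Rs T} (f : Ext N₁ N₂) (g : Ext N₂ N₃)
    (x : N₁.carrier) : f.trans g x = g (f x) := rfl

@[simp] theorem Ext.refl_apply {N : TGMod Rs T} (x : N.carrier) : Ext.refl N x = x := rfl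

theorem TGMod.mem_sp_comp (N : TGMod Rs T) (A : υ → N.carrier) (a : υ) : A a ∈ N.sp A :=
  Submodule.subset_span ⟨a, rfl⟩

theorem Ext.mem_sp_iff [Fintype υ] {N N' : TGMod Rs T} (f : Ext N N') {A : υ → N.carrier}
    {x : N.carrier} : f x ∈ N'.sp (fun a => f (A a)) ↔ x ∈ N.sp A := by
  rw [N.mem_sp_iff, N'.mem_sp_iff]
  refine exists_congr fun μ => ?_
  refine f.defG_iff (P := fun N v => v (Sum.inl ()) = ∑ k, μ k • v (Sum.inr k))
    (DefL.toG (Elem.eq (ElemT.var _) (TermL.sum _ fun _ => TermL.smul _ (ElemT.var _))))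
    (Sum.elim (fun _ => x) A)

theorem SameR.notMem_sp [Fintype γ] {N : TGMod Rs T} {o o' : γ → ↥N.G} {g w : ↥N.G}
    (h : SameR N (Sum.elim o (fun _ : Unit => g)) (Sum.elim o' (fun _ => w)))
    (hg : (g : N.carrier) ∉ N.sp (fun a => (o a : N.carrier))) :
    (w : N.carrier) ∉ N.sp (fun a => (o' a : N.carrier)) := by
  intro hw
  obtain ⟨r, hr, q, hq⟩ := N.exists_rational (fun a => (o' a).2) w.2 hw
  have hd : DefR (Rs := Rs) (T := T) (fun N (v : γ ⊕ Unit → ↥N.G) =>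
      r • v (Sum.inr ()) = ∑ j, q j • v (Sum.inl j)) :=
    Elem.eq (TermR.smul _ (ElemT.var _)) (TermR.sum _ fun _ => TermR.smul _ (ElemT.var _))
  have h1 : r • g = ∑ j, q j • o j := (h.iff hd).2 (Subtype.ext (by
    rw [Submodule.coe_sum]; exact hq))
  have h2 : (r : 𝔽) • (g : N.carrier) = ∑ j, (q j : 𝔽) • (o j : N.carrier) := by
    have := congrArg Subtype.val h1
    rw [Submodule.coe_sum] at this
    exact this
  have hr' : (r : 𝔽) ≠ 0 := fun h => hr (Subtype.ext h)
  apply hg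
  rw [← Submodule.smul_mem_iff _ hr', h2]
  exact Submodule.sum_mem _ fun j _ => Submodule.smul_mem _ _ (N.mem_sp_comp _ j)

/-- An `L`-type of an element independent over a tuple and a module type are realized
simultaneously. -/
theorem SameL.exists_realize_sameR_one [Fintype υ] [Fintype γ]
    {N : TGMod Rs T} {A A' : υ → N.carrier} (h : SameL N A A') {c : N.carrier}
    (hc : c ∉ N.sp A) {o o' : γ → ↥N.G} (h' : SameR N o o') {g : ↥N.G}
    (hg : (g : N.carrier) ∉ N.sp (fun a => (o a : N.carrier))) :
    ∃ (N' : TGMod Rs T) (f : Ext N N') (b : ↥N'.G),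
      SameL N' (Sum.elim (fun a => f (A a)) (fun _ : Unit => f c))
        (Sum.elim (fun a => f (A' a)) (fun _ => (b : N'.carrier))) ∧
      SameR N' (Sum.elim (fun a => f.res (o a)) (fun _ : Unit => f.res g))
        (Sum.elim (fun a => f.res (o' a)) (fun _ => b)) := by
  obtain ⟨N₁, f₁, w, hR⟩ := h'.exists_realize g
  have hw := hR.notMem_sp (f₁.mem_sp_iff.not.2 hg)
  obtain ⟨N₂, f₂, d, hd, hd', hL⟩ := (h.map f₁).exists_divisible (f₁.mem_sp_iff.not.2 hc)
    (w : N₁.carrier) (Sum.elim (fun a => f₁ (o' a)) (fun _ : Unit => (w : N₁.carrier)))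
  have hdG : d ∈ N₂.G := by
    obtain ⟨g', hg', rfl⟩ := hd 1 one_ne_zero
    simpa using hg'
  refine ⟨N₂, f₁.trans f₂, f₂.res w + (⟨d, hdG⟩ : ↥N₂.G), by exact hL, ?_⟩
  have h1 := sameR_shear N₂ (S := N₂.sp (fun a => f₂ (f₁ (o' a)))) (w := f₂.res w) (d := ⟨d, hdG⟩)
    (o := fun a => f₂.res (f₁.res (o' a))) (f₂.mem_sp_iff.not.2 hw) hd (by
      refine fun hm => hd' (SetLike.le_def.1 (sup_le ?_ ?_) hm)
      · refine Submodule.span_mono ?_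
        rintro _ ⟨a, rfl⟩
        exact ⟨Sum.inl a, rfl⟩
      · refine Submodule.span_mono ?_
        rintro _ rfl
        exact ⟨Sum.inr (), rfl⟩) (fun a => N₂.mem_sp_comp _ a)
  refine SameR.trans ?_ h1
  convert hR.map f₂ using 1 <;> (funext a; rcases a with a | a <;> rfl)

/-- `L`-types of independent tuples are realized in `G`, with a prescribed module type. -/
theorem SameL.exists_realize_sameR [Fintype κ] [Fintype υ] [Fintype γ]
    {N : TGMod Rs T} {A A' : υ → N.carrier} (h : SameL N A A') {c : κ → N.carrier}
    (hc : IndepOver N (N.sp A) c) {o o' : γ → ↥N.G} (h' : SameR N o o') {g : κ → ↥N.G}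
    (hg : IndepOver N (N.sp (fun a => (o a : N.carrier))) (fun j => (g j : N.carrier))) :
    ∃ (N' : TGMod Rs T) (f : Ext N N') (b : κ → ↥N'.G),
      SameL N' (Sum.elim (fun a => f (A a)) (fun j => f (c j)))
        (Sum.elim (fun a => f (A' a)) (fun j => (b j : N'.carrier))) ∧
      SameR N' (Sum.elim (fun a => f.res (o a)) (fun j => f.res (g j)))
        (Sum.elim (fun a => f.res (o' a)) b) := by
  refine Fintype.induction_empty_option (P := fun κ _ => ∀ {c : κ → N.carrier}
    (_ : IndepOver N (N.sp A) c) {g : κ → ↥N.G}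
    (_ : IndepOver N (N.sp (fun a => (o a : N.carrier))) (fun j => (g j : N.carrier))),
    ∃ (N' : TGMod Rs T) (f : Ext N N') (b : κ → ↥N'.G),
      SameL N' (Sum.elim (fun a => f (A a)) (fun j => f (c j)))
        (Sum.elim (fun a => f (A' a)) (fun j => (b j : N'.carrier))) ∧
      SameR N' (Sum.elim (fun a => f.res (o a)) (fun j => f.res (g j)))
        (Sum.elim (fun a => f.res (o' a)) b)) ?_ ?_ ?_ κ hc hg
  · intro κ₁ κ₂ _ E ih c hc g hg
    let _ : Fintype κ₁ := Fintype.ofEquiv κ₂ E.symm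
    obtain ⟨N', f, b, h1, h2⟩ := ih (c := c ∘ E) (hc.comp E.injective) (g := g ∘ E)
      (hg.comp E.injective)
    refine ⟨N', f, b ∘ E.symm, ?_, ?_⟩
    · convert h1.comp (Sum.elim Sum.inl (Sum.inr ∘ E.symm)) using 1 <;>
        (funext a; rcases a with a | a <;> simp)
    · convert h2.comp (Sum.elim Sum.inl (Sum.inr ∘ E.symm)) using 1 <;>
        (funext a; rcases a with a | a <;> simp)
  · intro c hc g hg
    refine ⟨N, Ext.refl N, PEmpty.elim, ?_, ?_⟩
    · convert h.comp (Sum.elim id PEmpty.elim) using 1 <;>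
        (funext a; rcases a with a | ⟨⟨⟩⟩; rfl)
    · convert h'.comp (Sum.elim id PEmpty.elim) using 1 <;>
        (funext a; rcases a with a | ⟨⟨⟩⟩; rfl)
  · intro κ _ ih c hc g hg
    rw [indepOver_option] at hc hg
    obtain ⟨N₁, f₁, b₁, hL₁, hR₁⟩ := ih hc.1 hg.1
    obtain ⟨N₂, f₂, b, hL₂, hR₂⟩ := hL₁.exists_realize_sameR_one (c := f₁ (c none)) (by
      have := f₁.mem_sp_iff (A := Sum.elim A fun j => c (some j)) (x := c none)
      rw [N.sp_elim, ← not_iff_not] at this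
      convert this.2 hc.2
      rename_i a; rcases a with a | a <;> rfl) hR₁ (g := f₁.res (g none)) (by
      have := f₁.mem_sp_iff (A := Sum.elim (fun a => (o a : N.carrier)) fun j => (g (some j) : N.carrier))
        (x := (g none : N.carrier))
      rw [N.sp_elim, ← not_iff_not] at this
      convert this.2 hg.2
      · rename_i a; rcases a with a | a <;> rfl
      · rfl)
    let re : ∀ {δ : Type}, δ ⊕ Option κ → (δ ⊕ κ) ⊕ Unit := fun {δ} =>
      Sum.elim (Sum.inl ∘ Sum.inl) (fun o => o.elim (Sum.inr ()) (fun j => Sum.inl (Sum.inr j)))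
    refine ⟨N₂, f₁.trans f₂, fun j => j.elim b (fun j => f₂.res (b₁ j)), ?_, ?_⟩
    · convert hL₂.comp re using 1 <;> (funext a; rcases a with a | _ | a <;> rfl)
    · convert hR₂.comp re using 1 <;> (funext a; rcases a with a | _ | a <;> rfl)

/-- `L`-types of independent tuples are realized by tuples independent modulo `G`. -/
theorem SameL.exists_realize_indepOver [Fintype ι] [Fintype υ]
    {N : TGMod Rs T} {A A' : υ → N.carrier} (h : SameL N A A') {c : ι → N.carrier}
    (hc : IndepOver N (N.sp A) c) :
    ∃ (N' : TGMod Rs T) (f : Ext N N') (b : ι → N'.carrier),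
      SameL N' (Sum.elim (fun a => f (A a)) (fun j => f (c j)))
        (Sum.elim (fun a => f (A' a)) b) ∧
      IndepOver N' (N'.sp (fun a => f (A' a)) ⊔ N'.W) b := by
  refine Fintype.induction_empty_option (P := fun ι _ => ∀ {c : ι → N.carrier}
    (_ : IndepOver N (N.sp A) c),
    ∃ (N' : TGMod Rs T) (f : Ext N N') (b : ι → N'.carrier),
      SameL N' (Sum.elim (fun a => f (A a)) (fun j => f (c j)))
        (Sum.elim (fun a => f (A' a)) b) ∧
      IndepOver N' (N'.sp (fun a => f (A' a)) ⊔ N'.W) b) ?_ ?_ ?_ ι hc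
  · intro κ₁ κ₂ _ E ih c hc
    let _ : Fintype κ₁ := Fintype.ofEquiv κ₂ E.symm
    obtain ⟨N', f, b, h1, h2⟩ := ih (c := c ∘ E) (hc.comp E.injective)
    refine ⟨N', f, b ∘ E.symm, ?_, h2.comp E.symm.injective⟩
    convert h1.comp (Sum.elim Sum.inl (Sum.inr ∘ E.symm)) using 1 <;>
        (funext a; rcases a with a | a <;> simp)
  · intro c hc
    refine ⟨N, Ext.refl N, PEmpty.elim, ?_, fun _ _ => funext fun i => i.elim⟩
    convert h.comp (Sum.elim id PEmpty.elim) using 1 <;>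
        (funext a; rcases a with a | ⟨⟨⟩⟩; rfl)
  · intro κ _ ih c hc
    rw [indepOver_option] at hc
    obtain ⟨N₁, f₁, b₁, hL₁, hI₁⟩ := ih hc.1
    obtain ⟨N₂, f₂, b, hb, hL₂⟩ := hL₁.exists_notMem (c := f₁ (c none)) (by
      have := f₁.mem_sp_iff (A := Sum.elim A fun j => c (some j)) (x := c none)
      rw [N.sp_elim, ← not_iff_not] at this
      convert this.2 hc.2
      rename_i a; rcases a with a | a <;> rfl) (Sum.elim (fun a => f₁ (A' a)) b₁)
    let re : ∀ {δ : Type}, δ ⊕ Option κ → (δ ⊕ κ) ⊕ Unit := fun {δ} =>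
      Sum.elim (Sum.inl ∘ Sum.inl) (fun o => o.elim (Sum.inr ()) (fun j => Sum.inl (Sum.inr j)))
    refine ⟨N₂, f₁.trans f₂, fun j => j.elim b (fun j => f₂ (b₁ j)), ?_, ?_⟩
    · convert hL₂.comp re using 1 <;> (funext a; rcases a with a | _ | a <;> rfl)
    · rw [indepOver_option]
      refine ⟨hI₁.map_sup f₂, fun hm => hb ?_⟩
      have : (fun a => f₂ (Sum.elim (fun a => f₁ (A' a)) b₁ a)) =
          Sum.elim (fun a => f₂ (f₁ (A' a))) (fun j => f₂ (b₁ j)) := by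
        funext a; rcases a with a | a <;> rfl
      rw [this, N₂.sp_elim, sup_right_comm]
      exact hm

/-- The joint realization lemma. -/
theorem SameL.exists_realize [Fintype ι] [Fintype κ] [Fintype υ] [Fintype γ]
    {N : TGMod Rs T} {A A' : υ → N.carrier} (h : SameL N A A') {c : ι ⊕ κ → N.carrier}
    (hc : IndepOver N (N.sp A) c) {o o' : γ → ↥N.G} (h' : SameR N o o') {g : κ → ↥N.G}
    (hg : IndepOver N (N.sp (fun a => (o a : N.carrier))) (fun j => (g j : N.carrier))) :
    ∃ (N' : TGMod Rs T) (f : Ext N N') (b : ι ⊕ κ → N'.carrier) (hb : InG N' b),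
      SameL N' (Sum.elim (fun a => f (A a)) (fun j => f (c j))) (Sum.elim (fun a => f (A' a)) b) ∧
      SameR N' (Sum.elim (fun a => f.res (o a)) (fun j => f.res (g j)))
        (Sum.elim (fun a => f.res (o' a)) (fun j => ⟨b (Sum.inr j), hb j⟩)) ∧
      GoodOver N' (N'.sp (fun a => f (A' a))) b := by
  obtain ⟨N₁, f₁, b₁, hL₁, hR₁⟩ := h.exists_realize_sameR (c := c ∘ Sum.inr)
    (hc.comp Sum.inr_injective) h' hg
  obtain ⟨N₂, f₂, b₂, hL₂, hI₂⟩ := hL₁.exists_realize_indepOver (c := fun i => f₁ (c (Sum.inl i)))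
    (by
      have h1 := hc.sum_elim
      rw [← N.sp_elim] at h1
      convert h1.map f₁ using 2
      · funext a; rcases a with a | a <;> rfl
      · rfl)
  have hb : InG N₂ (Sum.elim b₂ (fun j => f₂ (b₁ j))) := fun j => (f₂.res (b₁ j)).2
  have hL : SameL N₂ (Sum.elim (fun a => f₁.trans f₂ (A a)) (fun j => f₁.trans f₂ (c j)))
      (Sum.elim (fun a => f₁.trans f₂ (A' a)) (Sum.elim b₂ (fun j => f₂ (b₁ j)))) := by
    convert hL₂.comp (Sum.elim (Sum.inl ∘ Sum.inl) (Sum.elim Sum.inr (Sum.inl ∘ Sum.inr)))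
      using 1 <;> (funext a; rcases a with a | a | a <;> rfl)
  refine ⟨N₂, f₁.trans f₂, _, hb, hL, ?_, ?_⟩
  · convert hR₁.map f₂ using 1 <;> (funext a; rcases a with a | a <;> rfl)
  · refine goodOver_iff_indepOver.2 ⟨hI₂.mono (sup_le_sup_right (Submodule.span_mono ?_) _), ?_⟩
    · rintro _ ⟨a, rfl⟩
      exact ⟨Sum.inl a, rfl⟩
    · exact (hL.indepOver (hc.map (f₁.trans f₂))).comp Sum.inr_injective

end Realize

section Cosets

variable {A : Type*} [AddCommGroup A] {I : Type*}

/-- `C` is empty or a coset of `X`. -/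
def IsCoset (X : AddSubgroup A) (C : Set A) : Prop := ∀ x ∈ C, ∀ y, y ∈ C ↔ y - x ∈ X

open Classical in
theorem IsCoset.card_eq [Fintype A] {X : I → AddSubgroup A} {D D' : I → Set A}
    (hD : ∀ i, IsCoset (X i) (D i)) (hD' : ∀ i, IsCoset (X i) (D' i)) (S : Finset I)
    (h : (∃ q, ∀ i ∈ S, q ∈ D i) ↔ ∃ q, ∀ i ∈ S, q ∈ D' i) :
    (Finset.univ.filter fun q => ∀ i ∈ S, q ∈ D i).card =
      (Finset.univ.filter fun q => ∀ i ∈ S, q ∈ D' i).card := by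
  by_cases hp : ∃ q, ∀ i ∈ S, q ∈ D i
  · obtain ⟨p', hp'⟩ := h.1 hp
    obtain ⟨p, hp⟩ := hp
    refine Finset.card_nbij' (fun q => q - p + p') (fun q => q - p' + p) ?_ ?_ ?_ ?_
    · intro q hq
      simp only [Finset.coe_filter, Finset.mem_univ, true_and, Set.mem_ofPred_eq] at hq ⊢
      exact fun i hi => (hD' i _ (hp' i hi) _).2 (by simpa using (hD i _ (hp i hi) _).1 (hq i hi))
    · intro q hq
      simp only [Finset.coe_filter, Finset.mem_univ, true_and, Set.mem_ofPred_eq] at hq ⊢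
      exact fun i hi => (hD i _ (hp i hi) _).2 (by simpa using (hD' i _ (hp' i hi) _).1 (hq i hi))
    · intro q _
      simp
    · intro q _
      simp
  · have hp' := fun h' => hp (h.2 h')
    rw [Finset.filter_false_of_mem, Finset.filter_false_of_mem]
    · exact fun q _ hq => hp' ⟨q, hq⟩
    · exact fun q _ hq => hp ⟨q, hq⟩

/-- Inclusion-exclusion for cosets in a finite group. -/
theorem IsCoset.exists_forall_notMem_of_finite [Finite A] [Finite I] {X : I → AddSubgroup A}
    {D D' : I → Set A} (hD : ∀ i, IsCoset (X i) (D i)) (hD' : ∀ i, IsCoset (X i) (D' i))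
    (h : ∀ S : Finset I, (∃ q, ∀ i ∈ S, q ∈ D i) ↔ ∃ q, ∀ i ∈ S, q ∈ D' i)
    (hq : ∃ q, ∀ i, q ∉ D i) : ∃ q, ∀ i, q ∉ D' i := by
  classical
  cases nonempty_fintype A
  cases nonempty_fintype I
  have key : ∀ E : I → Set A, ((∃ q, ∀ i, q ∉ E i) ↔
      (∑ t ∈ (Finset.univ : Finset I).powerset, (-1 : ℤ) ^ t.card *
        ((Finset.univ.filter fun q => ∀ i ∈ t, q ∈ E i).card : ℤ)) ≠ 0) := by
    intro E
    have h1 := Finset.inclusion_exclusion_card_inf_compl (Finset.univ : Finset I)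
      (fun i => Finset.univ.filter fun q => q ∈ E i)
    have h2 : ∀ t : Finset I, (t.inf fun i => Finset.univ.filter fun q => q ∈ E i) =
        Finset.univ.filter fun q => ∀ i ∈ t, q ∈ E i := by
      intro t
      ext q
      simp [Finset.mem_inf]
    simp only [h2] at h1
    rw [← h1, Nat.cast_ne_zero, Finset.card_ne_zero]
    constructor
    · rintro ⟨q, hq⟩
      exact ⟨q, by simpa [Finset.mem_inf] using hq⟩
    · rintro ⟨q, hq⟩
      exact ⟨q, by simpa [Finset.mem_inf] using hq⟩
  rw [key] at hq ⊢
  convert hq using 3 with t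
  exact congrArg _ (by convert (IsCoset.card_eq hD hD' t (h t)).symm)

open scoped Pointwise in
/-- In a covering of a coset by cosets, those of infinite index may be dropped. -/
theorem IsCoset.exists_relIndex_ne_zero [Finite I] {X : I → AddSubgroup A} {C : I → Set A}
    (hC : ∀ i, IsCoset (X i) (C i)) (H : AddSubgroup A) (x₀ : A)
    (hcov : ∀ h ∈ H, ∃ i, x₀ + h ∈ C i) :
    ∀ h ∈ H, ∃ i, (X i).relIndex H ≠ 0 ∧ x₀ + h ∈ C i := by
  classical
  cases nonempty_fintype I
  let s : Finset I := Finset.univ.filter fun i => ∃ h ∈ H, x₀ + h ∈ C i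
  have hg : ∀ i, ∃ g : ↥H, i ∈ s → x₀ + g ∈ C i := by
    intro i
    by_cases hi : i ∈ s
    · obtain ⟨h, hh, hx⟩ := (Finset.mem_filter.1 hi).2
      exact ⟨⟨h, hh⟩, fun _ => hx⟩
    · exact ⟨0, fun h => absurd h hi⟩
  choose g hg using hg
  have hmem : ∀ i ∈ s, ∀ h : ↥H, (h ∈ (g i +ᵥ ((X i).addSubgroupOf H : Set ↥H))) ↔ x₀ + h ∈ C i := by
    intro i hi h
    rw [mem_leftAddCoset_iff, hC i _ (hg i hi)]
    simp only [SetLike.mem_coe, AddSubgroup.mem_addSubgroupOf]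
    refine iff_of_eq (congrArg (· ∈ X i) ?_)
    push_cast
    abel
  have hcov' : ⋃ i ∈ s, (g i +ᵥ ((X i).addSubgroupOf H : Set ↥H)) = Set.univ := by
    refine Set.eq_univ_of_forall fun h => ?_
    obtain ⟨i, hi⟩ := hcov h h.2
    have his : i ∈ s := Finset.mem_filter.2 ⟨Finset.mem_univ _, h, h.2, hi⟩
    exact Set.mem_biUnion his ((hmem i his h).2 hi)
  have := AddSubgroup.leftCoset_cover_filter_FiniteIndex hcov'
  intro h hh
  obtain ⟨i, hi, hi'⟩ := Set.mem_iUnion₂.1 (this ▸ Set.mem_univ (⟨h, hh⟩ : ↥H))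
  rw [Finset.mem_filter] at hi
  exact ⟨i, hi.2.index_ne_zero, (hmem i hi.1 ⟨h, hh⟩).1 hi'⟩

/-- If two systems of cosets have the same intersection pattern, then differences are nonempty
simultaneously. -/
theorem IsCoset.exists_forall_notMem [Finite I] {Ψ : AddSubgroup A} {X : I → AddSubgroup A}
    {E E' : Set A} {C C' : I → Set A} (hE : IsCoset Ψ E) (hE' : IsCoset Ψ E')
    (hC : ∀ i, IsCoset (X i) (C i)) (hC' : ∀ i, IsCoset (X i) (C' i))
    (h : ∀ S : Finset I, (∃ x ∈ E, ∀ i ∈ S, x ∈ C i) ↔ ∃ x ∈ E', ∀ i ∈ S, x ∈ C' i)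
    (hx : ∃ x ∈ E, ∀ i, x ∉ C i) : ∃ x ∈ E', ∀ i, x ∉ C' i := by
  classical
  obtain ⟨x, hxE, hx⟩ := hx
  obtain ⟨x', hxE', -⟩ := (h ∅).1 ⟨x, hxE, by simp⟩
  by_contra hcon
  push Not at hcon
  have hcov := IsCoset.exists_relIndex_ne_zero hC' Ψ x' (fun p hp =>
    hcon _ ((hE' x' hxE' _).2 (by simpa using hp)))
  let F := {i : I // (X i).relIndex Ψ ≠ 0}
  let H : AddSubgroup ↥Ψ := ⨅ i : F, (X i).addSubgroupOf Ψ
  have hH : H.FiniteIndex := AddSubgroup.finiteIndex_iInf fun i => ⟨i.2⟩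
  have : Finite (↥Ψ ⧸ H) := inferInstance
  let ρ := QuotientAddGroup.mk' H
  have hρ : Function.Surjective ρ := QuotientAddGroup.mk'_surjective H
  have hker : ∀ p p' : ↥Ψ, ρ p = ρ p' → ∀ i : F, (p - p' : A) ∈ X i := by
    intro p p' hpp i
    have h1 : -p' + p ∈ H := QuotientAddGroup.eq.1 hpp.symm
    have h2 := (AddSubgroup.mem_iInf.1 h1) i
    rw [AddSubgroup.mem_addSubgroupOf] at h2
    push_cast at h2
    rwa [neg_add_eq_sub] at h2
  let D (x : A) (C : I → Set A) (i : F) : Set (↥Ψ ⧸ H) := {q | ∃ p, ρ p = q ∧ x + p ∈ C i}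
  have hD : ∀ (x : A) (C : I → Set A), (∀ i, IsCoset (X i) (C i)) → ∀ i p,
      ρ p ∈ D x C i ↔ x + p ∈ C i := by
    intro x C hC i p
    refine ⟨fun ⟨p', hp', h'⟩ => ?_, fun h => ⟨p, rfl, h⟩⟩
    rw [hC i _ h', add_sub_add_left_eq_sub]
    exact hker _ _ hp'.symm i
  have hX : ∀ (i : F) p, ρ p ∈ ((X i).addSubgroupOf Ψ).map ρ ↔ (p : A) ∈ X i := by
    intro i p
    refine ⟨fun ⟨p', hp', h'⟩ => ?_, fun h => ⟨p, h, rfl⟩⟩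
    have := add_mem (hker _ _ h'.symm i) hp'
    simpa using this
  have hDc : ∀ (x : A) (C : I → Set A), (∀ i, IsCoset (X i) (C i)) → ∀ i : F,
      IsCoset (((X i).addSubgroupOf Ψ).map ρ) (D x C i) := by
    intro x C hC i q hq q'
    obtain ⟨p, rfl⟩ := hρ q
    obtain ⟨p', rfl⟩ := hρ q'
    rw [hD x C hC] at hq ⊢
    rw [← map_sub, hX, hC i _ hq, add_sub_add_left_eq_sub, AddSubgroup.coe_sub]
  have hDE : ∀ (x : A) (E : Set A) (C : I → Set A), (∀ i, IsCoset (X i) (C i)) → IsCoset Ψ E →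
      x ∈ E → ∀ S : Finset F, (∃ q, ∀ i ∈ S, q ∈ D x C i) ↔
        ∃ y ∈ E, ∀ i ∈ S.map (Function.Embedding.subtype _), y ∈ C i := by
    intro x E C hC hE hxE S
    constructor
    · rintro ⟨q, hq⟩
      obtain ⟨p, rfl⟩ := hρ q
      refine ⟨x + p, (hE x hxE _).2 (by simp), fun i hi => ?_⟩
      obtain ⟨k, hk, rfl⟩ := Finset.mem_map.1 hi
      exact (hD x C hC k p).1 (hq k hk)
    · rintro ⟨y, hy, hyS⟩
      refine ⟨ρ ⟨y - x, (hE x hxE _).1 hy⟩, fun i hi => (hD x C hC i _).2 ?_⟩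
      simpa using hyS i (Finset.mem_map_of_mem _ hi)
  obtain ⟨q, hq⟩ := IsCoset.exists_forall_notMem_of_finite (hDc x C hC) (hDc x' C' hC')
    (fun S => ((hDE x E C hC hE hxE S).trans (h _)).trans (hDE x' E' C' hC' hE' hxE' S).symm)
    ⟨ρ 0, fun i hi => hx i (by simpa using (hD x C hC i 0).1 hi)⟩
  obtain ⟨p, rfl⟩ := hρ q
  obtain ⟨i, hi, hi'⟩ := hcov p p.2
  exact hq ⟨i, hi⟩ ((hD x' C' hC' ⟨i, hi⟩ p).2 hi')

end Cosets

section Additive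

variable {𝔽 : Type u} [Field 𝔽] {L' : FirstOrder.Language.{u, u}}
variable {Rs : Subring 𝔽} {T : (fullLang 𝔽 L').Theory} {α β γ ι' κ' ι κ υ : Type}

/-- Compactness for tuples of the generic submodule. -/
theorem exists_ext_res [Finite α] [Finite β] (N : TGMod Rs T) (v : β → ↥N.G) {J : Type*}
    (P : J → ∀ N : TGMod Rs T, (β ⊕ α → ↥N.G) → Prop) (hP : ∀ j, DefR (P j))
    (hfin : ∀ s : Finset J, ∃ w : α → ↥N.G, ∀ j ∈ s, P j N (Sum.elim v w)) :
    ∃ (N' : TGMod Rs T) (f : Ext N N') (w : α → ↥N'.G),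
      ∀ j, P j N' (Sum.elim (fun b => f.res (v b)) w) := by
  let Q : Option J → ∀ N : TGMod Rs T, (β ⊕ α → N.carrier) → Prop := fun j N u =>
    ∃ hu : ∀ a, u a ∈ N.G, j.elim True (fun j => P j N (fun a => ⟨u a, hu a⟩))
  have hval : ∀ (N : TGMod Rs T) (v : β → ↥N.G) (w : α → ↥N.G) a,
      Sum.elim (fun b => (v b : N.carrier)) (fun a => (w a : N.carrier)) a =
        (Sum.elim v w a : ↥N.G) := by
    rintro N v w (a | a) <;> rfl
  obtain ⟨N', f, w, hw⟩ := exists_ext N (fun b => (v b : N.carrier)) Q (by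
    rintro (_ | j)
    · exact DefR.toG (P := fun _ _ => True) (Elem.const _) (fun a => ElemT.var a)
    · exact DefR.toG (hP j) (fun a => ElemT.var a)) (by
    intro s
    classical
    obtain ⟨w, hw⟩ := hfin s.eraseNone
    refine ⟨fun a => w a, fun j hj => ⟨fun a => ?_, ?_⟩⟩
    · rw [hval]
      exact Subtype.coe_prop _
    · rcases j with _ | j
      · trivial
      · refine (iff_of_eq (congrArg (P j N) ?_)).1 (hw j (by simpa using hj))
        funext a
        exact Subtype.ext (hval N v w a).symm)
  obtain ⟨h0, -⟩ := hw none
  refine ⟨N', f, fun a => ⟨w a, h0 (Sum.inr a)⟩, fun j => ?_⟩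
  obtain ⟨h1, h2⟩ := hw (some j)
  refine (iff_of_eq (congrArg (P j N') ?_)).1 h2
  funext a
  rcases a with a | a <;> rfl

/-- Uniformly definable predicates that define subgroups. -/
def AddR (P : ∀ N : TGMod Rs T, (α → ↥N.G) → Prop) : Prop :=
  DefR P ∧ ∀ N : TGMod Rs T, ∃ H : AddSubgroup (α → ↥N.G), ∀ v, P N v ↔ v ∈ H

theorem TermR.exists_hom {t : ∀ N : TGMod Rs T, (α → ↥N.G) → ↥N.G} (ht : TermR t)
    (N : TGMod Rs T) : ∃ h : (α → ↥N.G) →+ ↥N.G, ∀ v, t N v = h v := by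
  obtain ⟨τ, hτ⟩ := ht
  simp only [hτ]
  clear hτ
  induction τ with
  | var a => exact ⟨Pi.evalAddMonoidHom _ a, fun v => rfl⟩
  | @func n g ts ih =>
    choose h hh using ih
    match n, g, ts, h, hh with
    | 0, _, ts, h, hh => exact ⟨0, fun v => rfl⟩
    | 1, r, ts, h, hh =>
      refine ⟨(DistribSMul.toAddMonoidHom ↥N.G (show ↥Rs from r)).comp (h 0), fun v => ?_⟩
      rw [AddMonoidHom.comp_apply, ← hh]
      rfl
    | 2, _, ts, h, hh =>
      refine ⟨h 0 + h 1, fun v => ?_⟩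
      rw [AddMonoidHom.add_apply, ← hh, ← hh]
      rfl
    | _ + 3, g, _, _, _ => exact (show PEmpty from g).elim

theorem AddR.congr {P Q : ∀ N : TGMod Rs T, (α → ↥N.G) → Prop} (h : AddR P)
    (hPQ : ∀ N v, Q N v ↔ P N v) : AddR Q :=
  ⟨Elem.congr h.1 hPQ, fun N => (h.2 N).imp fun H hH v => (hPQ N v).trans (hH v)⟩

theorem AddR.eq {s t : ∀ N : TGMod Rs T, (α → ↥N.G) → ↥N.G} (hs : TermR s) (ht : TermR t) :
    AddR (fun N v => s N v = t N v) := by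
  refine ⟨Elem.eq hs ht, fun N => ?_⟩
  obtain ⟨f, hf⟩ := hs.exists_hom N
  obtain ⟨g, hg⟩ := ht.exists_hom N
  exact ⟨f.eqLocus g, fun v => by show s N v = t N v ↔ _; rw [hf, hg]; rfl⟩

theorem AddR.forall_mem {δ : Type*} (s : Finset δ)
    {P : δ → ∀ N : TGMod Rs T, (α → ↥N.G) → Prop} (h : ∀ d ∈ s, AddR (P d)) :
    AddR (fun N v => ∀ d ∈ s, P d N v) := by
  refine ⟨Elem.forall_mem s fun d hd => (h d hd).1, fun N => ?_⟩
  choose H hH using fun d (hd : d ∈ s) => (h d hd).2 N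
  refine ⟨⨅ d : s, H d d.2, fun v => ?_⟩
  rw [AddSubgroup.mem_iInf]
  exact ⟨fun h d => (hH d d.2 v).1 (h d d.2), fun h d hd => (hH d hd v).2 (h ⟨d, hd⟩)⟩

theorem AddR.and {P Q : ∀ N : TGMod Rs T, (α → ↥N.G) → Prop} (h : AddR P) (h' : AddR Q) :
    AddR (fun N v => P N v ∧ Q N v) := by
  refine ⟨Elem.and h.1 h'.1, fun N => ?_⟩
  obtain ⟨H, hH⟩ := h.2 N
  obtain ⟨H', hH'⟩ := h'.2 N
  exact ⟨H ⊓ H', fun v => and_congr (hH v) (hH' v)⟩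

theorem AddR.subst {P : ∀ N : TGMod Rs T, (α → ↥N.G) → Prop} (h : AddR P)
    {t : α → ∀ N : TGMod Rs T, (β → ↥N.G) → ↥N.G} (ht : ∀ a, TermR (t a)) :
    AddR (fun N v => P N (fun a => t a N v)) := by
  refine ⟨Elem.subst h.1 ht, fun N => ?_⟩
  obtain ⟨H, hH⟩ := h.2 N
  choose f hf using fun a => (ht a).exists_hom N
  refine ⟨H.comap (AddMonoidHom.mk' (fun v a => f a v) fun v w => ?_), fun v => ?_⟩
  · funext a
    exact map_add _ _ _
  · simp only [hf]
    exact hH _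

theorem AddR.ex [Finite β] {P : ∀ N : TGMod Rs T, (α → ↥N.G) → (β → ↥N.G) → Prop}
    (h : AddR (fun N (v : α ⊕ β → ↥N.G) => P N (v ∘ Sum.inl) (v ∘ Sum.inr))) :
    AddR (fun N v => ∃ w, P N v w) := by
  refine ⟨Elem.ex h.1, fun N => ?_⟩
  obtain ⟨H, hH⟩ := h.2 N
  refine ⟨H.map (AddMonoidHom.mk' (fun v => v ∘ Sum.inl) fun v w => rfl), fun v => ?_⟩
  constructor
  · rintro ⟨w, hw⟩
    exact ⟨Sum.elim v w, (hH _).1 hw, rfl⟩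
  · rintro ⟨u, hu, rfl⟩
    exact ⟨_, (hH u).2 hu⟩

/-- Additive formulas. -/
def AddForm (T : (fullLang 𝔽 L').Theory) (Rs : Subring 𝔽) (α : Type) : Type u :=
  {φ : (vsLang ↥Rs).Formula α // AddR (T := T) fun (N : TGMod Rs T) v => φ.Realize v}

theorem AddR.exists_addForm {P : ∀ N : TGMod Rs T, (α → ↥N.G) → Prop} (h : AddR P) :
    ∃ θ : AddForm T Rs α, ∀ (N : TGMod Rs T) v, P N v ↔ θ.1.Realize v := by
  obtain ⟨φ, hφ⟩ := h.1
  exact ⟨⟨φ, h.congr fun N v => (hφ N v).symm⟩, hφ⟩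

/-- Two tuples satisfy the same additive formulas. -/
def SameA (N : TGMod Rs T) (v v' : α → ↥N.G) : Prop :=
  ∀ θ : AddForm T Rs α, θ.1.Realize v ↔ θ.1.Realize v'

theorem SameA.symm {N : TGMod Rs T} {v v' : α → ↥N.G} (h : SameA N v v') : SameA N v' v :=
  fun θ => (h θ).symm

theorem SameA.iff {N : TGMod Rs T} {v v' : α → ↥N.G} (h : SameA N v v')
    {P : ∀ N : TGMod Rs T, (α → ↥N.G) → Prop} (hP : AddR P) : P N v ↔ P N v' := by
  obtain ⟨θ, hθ⟩ := hP.exists_addForm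
  rw [hθ, hθ]
  exact h θ

theorem SameA.comp {N : TGMod Rs T} {v v' : α → ↥N.G} (h : SameA N v v') (g : β → α) :
    SameA N (v ∘ g) (v' ∘ g) := fun θ =>
  h.iff (P := fun N v => θ.1.Realize (v ∘ g)) (θ.2.subst fun b => ElemT.var (g b))

/-- The fibers of an additive predicate are cosets. -/
theorem AddR.isCoset {P : ∀ N : TGMod Rs T, (α ⊕ β → ↥N.G) → Prop} (h : AddR P) (N : TGMod Rs T) :
    ∃ X : AddSubgroup (β → ↥N.G), (∀ x, x ∈ X ↔ P N (Sum.elim (0 : α → ↥N.G) x)) ∧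
      ∀ e : α → ↥N.G, IsCoset X {x | P N (Sum.elim e x)} := by
  obtain ⟨H, hH⟩ := h.2 N
  refine ⟨H.comap (AddMonoidHom.mk' (fun x => Sum.elim (0 : α → ↥N.G) x) fun v w => ?_), fun x => (hH _).symm,
    fun e x hx y => ?_⟩
  · funext a
    rcases a with a | a <;> simp
  · have hx' := (hH _).1 hx
    refine (hH _).trans ?_
    have hs : Sum.elim (0 : α → ↥N.G) (y - x) = Sum.elim e y - Sum.elim e x := by
      funext a
      rcases a with a | a <;> simp
    change _ ↔ Sum.elim (0 : α → ↥N.G) (y - x) ∈ H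
    rw [hs]
    exact ⟨fun h => sub_mem h hx', fun h => by simpa using add_mem h hx'⟩

/-- Types of additive formulas extend. -/
theorem SameA.exists_realize [Finite α] {N : TGMod Rs T} {v v' : α → ↥N.G} (h : SameA N v v')
    (t : ↥N.G) : ∃ (N' : TGMod Rs T) (f : Ext N N') (w : ↥N'.G),
      SameA N' (Sum.elim (fun a => f.res (v a)) (fun _ : Unit => f.res t))
        (Sum.elim (fun a => f.res (v' a)) (fun _ => w)) := by
  classical
  obtain ⟨N', f, w, hw⟩ := exists_ext_res (α := Unit) N v'
    (fun (θ : AddForm T Rs (α ⊕ Unit)) N' u => θ.1.Realize u ↔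
      θ.1.Realize (M := ↥N.G) (Sum.elim v (fun _ => t)))
    (fun θ => Elem.iff (Elem.of _) (Elem.const _)) (by
    intro s
    let pos := s.filter fun θ => θ.1.Realize (Sum.elim v (fun _ : Unit => t))
    have hΨ : AddR fun N u => ∀ θ ∈ pos, θ.1.Realize (M := ↥(TGMod.G (T := T) N)) u :=
      AddR.forall_mem _ fun θ _ => θ.2
    let I := {θ : AddForm T Rs (α ⊕ Unit) // θ ∈ s ∧ ¬ θ.1.Realize (Sum.elim v (fun _ : Unit => t))}
    have : Finite I := Finite.of_injective (fun i : I => (⟨i.1, i.2.1⟩ : s)) (by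
      intro i j hij
      exact Subtype.ext (congrArg (fun x : s => x.1) hij))
    obtain ⟨Ψ, -, hΨ'⟩ := hΨ.isCoset N
    choose X hX1 hX using fun i : I => i.1.2.isCoset N
    obtain ⟨w, hw, hw'⟩ := IsCoset.exists_forall_notMem (hΨ' v) (hΨ' v') (fun i => hX i v)
      (fun i => hX i v') (by
        intro S
        refine h.iff (P := fun N u => ∃ x, (∀ θ ∈ pos, θ.1.Realize (M := ↥(TGMod.G (T := T) N))
          (Sum.elim u x)) ∧ ∀ i ∈ S, i.1.1.Realize (M := ↥(TGMod.G (T := T) N)) (Sum.elim u x)) ?_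
        refine AddR.ex (AddR.and (hΨ.congr fun N u => ?_) ((AddR.forall_mem S fun i _ =>
          i.1.2).congr fun N u => ?_))
        · rw [Sum.elim_comp_inl_inr]
        · rw [Sum.elim_comp_inl_inr]) ⟨fun _ => t, fun θ hθ => (Finset.mem_filter.1 hθ).2,
          fun i hi => i.2.2 hi⟩
    refine ⟨w, fun θ hθ => ?_⟩
    by_cases ht : θ.1.Realize (Sum.elim v (fun _ : Unit => t))
    · exact iff_of_true (hw θ (Finset.mem_filter.2 ⟨hθ, ht⟩)) ht
    · exact iff_of_false (hw' ⟨θ, hθ, ht⟩) ht)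
  refine ⟨N', f, w (), fun θ => ?_⟩
  have h1 := f.defR_iff (Elem.of θ.1) (Sum.elim v (fun _ => t))
  refine Iff.trans (Iff.trans (iff_of_eq (congrArg _ ?_)) h1) ((hw θ).symm.trans
    (iff_of_eq (congrArg _ ?_)))
  all_goals funext a; rcases a with a | a <;> rfl

/-- Quantifier elimination for modules up to additive formulas. -/
theorem SameA.realize_iff [Finite α] {n : ℕ} (φ : (vsLang ↥Rs).BoundedFormula α n)
    {N : TGMod Rs T} {v v' : α → ↥N.G} {xs xs' : Fin n → ↥N.G}
    (h : SameA N (Sum.elim v xs) (Sum.elim v' xs')) : φ.Realize v xs ↔ φ.Realize v' xs' := by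
  induction φ generalizing N with
  | falsum => exact Iff.rfl
  | equal t₁ t₂ =>
    exact h.iff (P := fun N u => t₁.realize u = t₂.realize u)
      (AddR.eq ⟨t₁, fun _ _ => rfl⟩ ⟨t₂, fun _ _ => rfl⟩)
  | rel R ts => exact (show PEmpty from R).elim
  | imp φ ψ ih₁ ih₂ => exact imp_congr (ih₁ h) (ih₂ h)
  | @all n φ ih =>
    have key : ∀ {v v' : α → ↥N.G} {xs xs' : Fin n → ↥N.G},
        SameA N (Sum.elim v xs) (Sum.elim v' xs') → φ.all.Realize v xs → φ.all.Realize v' xs' := by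
      intro v v' xs xs' h H x'
      obtain ⟨N', f, w, hw⟩ := h.symm.exists_realize x'
      have h1 := (f.resElem.map_boundedFormula φ.all v xs).2 H w
      rw [← f.resElem.map_boundedFormula]
      refine (ih ?_).1 h1
      let re : α ⊕ Fin (n + 1) → (α ⊕ Fin n) ⊕ Unit :=
        Sum.elim (Sum.inl ∘ Sum.inl) (Fin.snoc (α := fun _ => (α ⊕ Fin n) ⊕ Unit)
          (Sum.inl ∘ Sum.inr) (Sum.inr ()))
      convert hw.symm.comp re using 1 <;>
        (funext a; rcases a with a | a; rfl; refine Fin.lastCases ?_ (fun j => ?_) a <;> simp [re] <;> rfl)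
    exact ⟨key h, key h.symm⟩

theorem SameA.sameR [Finite α] {N : TGMod Rs T} {v v' : α → ↥N.G} (h : SameA N v v') :
    SameR N v v' := fun φ => by
  refine SameA.realize_iff φ ?_
  convert h.comp (Sum.elim id (fun i : Fin 0 => i.elim0)) using 1 <;>
    (funext a; rcases a with a | a; rfl; exact a.elim0)

end Additive

section Types

variable {𝔽 : Type u} [Field 𝔽] {L' : FirstOrder.Language.{u, u}}
variable {Rs : Subring 𝔽} {T : (fullLang 𝔽 L').Theory} {α β γ ι' κ' ι κ υ : Type}

/-- `x` and `x'` are linear combinations of `e` and `e'` with the same coefficients. -/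
def LinRel (N : TGMod Rs T) [Fintype β] (e e' : β → N.carrier) (x x' : N.carrier) : Prop :=
  ∃ l : β → 𝔽, x = ∑ b, l b • e b ∧ x' = ∑ b, l b • e' b

section LinRel

variable {N : TGMod Rs T} [Fintype β] [Fintype γ] {e e' : β → N.carrier}

theorem LinRel.var (b : β) : LinRel N e e' (e b) (e' b) := by
  classical
  exact ⟨Pi.single b 1, by simp [Pi.single_apply], by simp [Pi.single_apply]⟩

theorem LinRel.zero : LinRel N e e' 0 0 := ⟨0, by simp, by simp⟩

theorem LinRel.add {x x' y y' : N.carrier} (h : LinRel N e e' x x') (h' : LinRel N e e' y y') :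
    LinRel N e e' (x + y) (x' + y') := by
  obtain ⟨l, rfl, rfl⟩ := h
  obtain ⟨m, rfl, rfl⟩ := h'
  exact ⟨l + m, by simp [add_smul, Finset.sum_add_distrib],
    by simp [add_smul, Finset.sum_add_distrib]⟩

theorem LinRel.smul {x x' : N.carrier} (c : 𝔽) (h : LinRel N e e' x x') :
    LinRel N e e' (c • x) (c • x') := by
  obtain ⟨l, rfl, rfl⟩ := h
  exact ⟨c • l, by simp [Finset.smul_sum, mul_smul], by simp [Finset.smul_sum, mul_smul]⟩

theorem LinRel.sum {s : Finset α} {x x' : α → N.carrier}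
    (h : ∀ a ∈ s, LinRel N e e' (x a) (x' a)) :
    LinRel N e e' (∑ a ∈ s, x a) (∑ a ∈ s, x' a) := by
  classical
  induction s using Finset.induction_on with
  | empty => exact LinRel.zero
  | insert a s ha ih =>
    rw [Finset.sum_insert ha, Finset.sum_insert ha]
    exact (h a (Finset.mem_insert_self _ _)).add
      (ih fun b hb => h b (Finset.mem_insert_of_mem hb))

theorem LinRel.trans {d d' : γ → N.carrier} (hd : ∀ b, LinRel N d d' (e b) (e' b))
    {x x' : N.carrier} (h : LinRel N e e' x x') : LinRel N d d' x x' := by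
  obtain ⟨l, rfl, rfl⟩ := h
  exact LinRel.sum fun b _ => (hd b).smul _

theorem LinRel.map {N' : TGMod Rs T} (f : Ext N N') {x x' : N.carrier} (h : LinRel N e e' x x') :
    LinRel N' (fun b => f (e b)) (fun b => f (e' b)) (f x) (f x') := by
  obtain ⟨l, rfl, rfl⟩ := h
  exact ⟨l, by simp only [← f.lin_apply, map_sum, map_smul],
    by simp only [← f.lin_apply, map_sum, map_smul]⟩

end LinRel

theorem indepOver_unit {N : TGMod Rs T} [Fintype κ] {S : Submodule 𝔽 N.carrier}
    {c : κ → N.carrier} {d : N.carrier} (hc : IndepOver N S c) (hd : d ∉ S ⊔ N.sp c) :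
    IndepOver N S (Sum.elim c (fun _ : Unit => d)) := by
  have h : IndepOver N S (fun o : Option κ => o.elim d c) := indepOver_option.2 ⟨hc, hd⟩
  have := h.comp (g := Sum.elim some (fun _ : Unit => none)) (by
    rintro (a | a) (b | b) hab
    · exact congrArg _ (Option.some.inj hab)
    · exact (Option.some_ne_none _ hab).elim
    · exact (Option.some_ne_none _ hab.symm).elim
    · rfl)
  convert this using 1
  funext a
  rcases a with a | a <;> rfl

/-- A tuple together with a tuple of elements of the generic submodule. -/
abbrev joint {N : TGMod Rs T} (u : ι → N.carrier) (g : κ → ↥N.G) : ι ⊕ κ → N.carrier :=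
  Sum.elim u (fun j => (g j : N.carrier))

/-- Two good tuples of the same type. -/
structure SimB (N : TGMod Rs T) [Fintype ι] [Fintype κ] (u u' : ι → N.carrier)
    (g g' : κ → ↥N.G) : Prop where
  indep : IndepOver N N.W u
  indep' : IndepOver N N.W u'
  indepG : IndepOver N ⊥ (fun j => (g j : N.carrier))
  indepG' : IndepOver N ⊥ (fun j => (g' j : N.carrier))
  sameL : SameL N (joint u g) (joint u' g')
  sameR : SameR N g g'

theorem joint_map {N N' : TGMod Rs T} (f : Ext N N') (u : ι → N.carrier) (g : κ → ↥N.G) :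
    (fun a => f (joint u g a)) = joint (fun i => f (u i)) (fun j => f.res (g j)) := by
  funext a
  rcases a with a | a <;> rfl

section SimB

variable [Fintype ι] [Fintype κ]

theorem IndepOver.map_W {N N' : TGMod Rs T} (f : Ext N N') {u : ι → N.carrier}
    (h : IndepOver N N.W u) : IndepOver N' N'.W (fun i => f (u i)) := by
  have := IndepOver.map_sup f (A := (Empty.elim : Empty → N.carrier)) (c := u)
    (by rwa [N.sp_empty, bot_sup_eq])
  rwa [N'.sp_empty, bot_sup_eq] at this

theorem IndepOver.map_bot {N N' : TGMod Rs T} (f : Ext N N') {u : ι → N.carrier}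
    (h : IndepOver N ⊥ u) : IndepOver N' ⊥ (fun i => f (u i)) := by
  have := IndepOver.map f (A := (Empty.elim : Empty → N.carrier)) (c := u)
    (by rwa [N.sp_empty])
  rwa [N'.sp_empty] at this

theorem SimB.map {N N' : TGMod Rs T} (f : Ext N N') {u u' : ι → N.carrier} {g g' : κ → ↥N.G}
    (h : SimB N u u' g g') : SimB N' (fun i => f (u i)) (fun i => f (u' i))
      (fun j => f.res (g j)) (fun j => f.res (g' j)) where
  indep := h.indep.map_W f
  indep' := h.indep'.map_W f
  indepG := h.indepG.map_bot f
  indepG' := h.indepG'.map_bot f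
  sameL := by rw [← joint_map, ← joint_map]; exact h.sameL.map f
  sameR := h.sameR.map f

theorem SimB.symm {N : TGMod Rs T} {u u' : ι → N.carrier} {g g' : κ → ↥N.G}
    (h : SimB N u u' g g') : SimB N u' u g' g :=
  ⟨h.indep', h.indep, h.indepG', h.indepG, h.sameL.symm, h.sameR.symm⟩

end SimB

/-- Tuples spanned in the same way by good tuples of the same type. -/
def Sim (N : TGMod Rs T) (A A' : α → N.carrier) : Prop :=
  ∃ (ι κ : Type) (_ : Fintype ι) (_ : Fintype κ) (u u' : ι → N.carrier) (g g' : κ → ↥N.G),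
    SimB N u u' g g' ∧ ∀ a, LinRel N (joint u g) (joint u' g') (A a) (A' a)

theorem SimB.sim [Fintype ι] [Fintype κ] {N : TGMod Rs T} {u u' : ι → N.carrier} {g g' : κ → ↥N.G}
    (h : SimB N u u' g g') : Sim N (joint u g) (joint u' g') :=
  ⟨ι, κ, _, _, u, u', g, g', h, fun a => LinRel.var a⟩

section Sim

variable {N : TGMod Rs T} {A A' : α → N.carrier}

theorem Sim.symm (h : Sim N A A') : Sim N A' A := by
  obtain ⟨ι, κ, _, _, u, u', g, g', hB, h⟩ := h
  refine ⟨ι, κ, _, _, u', u, g', g, hB.symm, fun a => ?_⟩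
  obtain ⟨l, h1, h2⟩ := h a
  exact ⟨l, h2, h1⟩

theorem Sim.map {N' : TGMod Rs T} (f : Ext N N') (h : Sim N A A') :
    Sim N' (fun a => f (A a)) (fun a => f (A' a)) := by
  obtain ⟨ι, κ, _, _, u, u', g, g', hB, h⟩ := h
  refine ⟨ι, κ, _, _, _, _, _, _, hB.map f, fun a => ?_⟩
  rw [← joint_map, ← joint_map]
  exact (h a).map f

theorem Sim.comp (h : Sim N A A') (r : β → α) : Sim N (A ∘ r) (A' ∘ r) := by
  obtain ⟨ι, κ, _, _, u, u', g, g', hB, h⟩ := h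
  exact ⟨ι, κ, _, _, _, _, _, _, hB, fun a => h (r a)⟩

theorem Sim.defL (h : Sim N A A') {P : ∀ N : TGMod Rs T, (α → N.carrier) → Prop} (hP : DefL P) :
    P N A ↔ P N A' := by
  obtain ⟨ι, κ, _, _, u, u', g, g', hB, h⟩ := h
  choose l hl hl' using h
  have := hB.sameL.iff (P := fun N v => P N (fun a => ∑ b, l a b • v b))
    (Elem.subst hP fun a => TermL.sum _ fun b => TermL.smul _ (ElemT.var b))
  simpa only [← hl, ← hl'] using this

theorem Sim.term (h : Sim N A A') {t : β → ∀ N : TGMod Rs T, (α → N.carrier) → N.carrier}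
    (ht : ∀ b, TermL (t b)) : Sim N (fun b => t b N A) (fun b => t b N A') := by
  obtain ⟨ι, κ, _, _, u, u', g, g', hB, h⟩ := h
  choose l hl hl' using h
  refine ⟨ι, κ, _, _, _, _, _, _, hB, fun b => ?_⟩
  have hs : TermL (Rs := Rs) (T := T)
      (fun N (v : ι ⊕ κ → N.carrier) => t b N (fun a => ∑ b, l a b • v b)) :=
    ElemT.subst (ht b) fun a => TermL.sum _ fun b => TermL.smul _ (ElemT.var b)
  have hmem : t b N A ∈ N.sp (joint u g) := by
    by_contra hcon
    refine DefL1.infinite_of_notMem_span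
      (P := fun N v y => y = t b N (fun a => ∑ b, l a b • v b)) ?_ N (joint u g)
      (x := t b N A) ?_ hcon ?_
    · exact Elem.eq (ElemT.var _) (ElemT.subst hs fun a => ElemT.var _)
    · simp only [← hl]
    · exact Set.finite_singleton _
  obtain ⟨m, hm⟩ := (N.mem_sp_iff _).1 hmem
  refine ⟨m, hm, ?_⟩
  have := hB.sameL.iff (P := fun N v => t b N (fun a => ∑ b, l a b • v b) = ∑ b, m b • v b)
    (Elem.eq hs (TermL.sum _ fun b => TermL.smul _ (ElemT.var b)))
  simp only [← hl, ← hl'] at this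
  exact this.1 hm

theorem Sim.defR [Finite α] (h : Sim N A A') {P : ∀ N : TGMod Rs T, (α → ↥N.G) → Prop}
    (hP : DefR P) (hA : ∃ hv : ∀ a, A a ∈ N.G, P N (fun a => ⟨A a, hv a⟩)) :
    ∃ hv : ∀ a, A' a ∈ N.G, P N (fun a => ⟨A' a, hv a⟩) := by
  obtain ⟨ι, κ, _, _, u, u', g, g', hB, h⟩ := h
  choose l hl hl' using h
  obtain ⟨hA, hPA⟩ := hA
  have h0 : ∀ a i, l a (Sum.inl i) = 0 := by
    intro a
    refine congrFun (hB.indep (fun i => l a (Sum.inl i)) ?_)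
    have h1 := N.G_le_W (hA a)
    rw [hl, Fintype.sum_sum_type] at h1
    exact (Submodule.add_mem_iff_left _ (Submodule.sum_mem _ fun j _ =>
      Submodule.smul_mem _ _ (N.G_le_W (g j).2))).1 h1
  have hA1 : ∀ a, A a = ∑ j, l a (Sum.inr j) • (g j : N.carrier) := fun a => by
    rw [hl, Fintype.sum_sum_type]
    simp [h0]
  have hA1' : ∀ a, A' a = ∑ j, l a (Sum.inr j) • (g' j : N.carrier) := fun a => by
    rw [hl', Fintype.sum_sum_type]
    simp [h0]
  have h1 := fun a => N.exists_denominator (g := fun j => (g j : N.carrier)) (fun j => (g j).2)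
    (fun μ hμ => hB.indepG μ (by rw [hμ]; exact Submodule.zero_mem _))
    (μ := fun j => l a (Sum.inr j)) (by rw [← hA1]; exact hA a)
  choose r hr c hc using h1
  have hQ : DefR (Rs := Rs) (T := T) (fun N (v : κ → ↥N.G) => ∃ w : α → ↥N.G,
      (∀ a, r a • w a = ∑ j, c a j • v j) ∧ P N w) := by
    refine Elem.ex (Elem.and ?_ (Elem.relabel hP Sum.inr))
    obtain ⟨n, ⟨E⟩⟩ := Finite.exists_equiv_fin α
    have : Elem (vsLang ↥Rs) (C := fun N : TGMod Rs T => ↥N.G)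
      (fun N (v : κ ⊕ α → ↥N.G) => ∀ k : Fin n, r (E.symm k) • v (Sum.inr (E.symm k)) =
        ∑ j, c (E.symm k) j • v (Sum.inl j)) := Elem.forall_fin fun k =>
      Elem.eq (TermR.smul _ (ElemT.var _)) (TermR.sum _ fun j => TermR.smul _ (ElemT.var _))
    exact Elem.congr this fun N v => ⟨fun h k => h _, fun h a => by simpa using h (E a)⟩
  obtain ⟨w, hw, hPw⟩ := (hB.sameR.iff hQ).1 ⟨fun a => ⟨A a, hA a⟩, fun a => Subtype.ext (by
    rw [Submodule.coe_sum]
    change (r a : 𝔽) • A a = ∑ j, (c a j : 𝔽) • (g j : N.carrier)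
    rw [hA1, Finset.smul_sum]
    simp only [smul_smul, hc]), hPA⟩
  have hwA : ∀ a, (w a : N.carrier) = A' a := by
    intro a
    have hr' : (r a : 𝔽) ≠ 0 := fun h => hr a (Subtype.ext h)
    have h2 : (r a : 𝔽) • (w a : N.carrier) = ∑ j, (c a j : 𝔽) • (g' j : N.carrier) := by
      have := congrArg (fun x : ↥N.G => (x : N.carrier)) (hw a)
      rw [Submodule.coe_sum] at this
      exact this
    refine smul_right_injective _ hr' ?_
    change (r a : 𝔽) • (w a : N.carrier) = (r a : 𝔽) • A' a
    rw [h2, hA1', Finset.smul_sum]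
    simp only [smul_smul, hc]
  refine ⟨fun a => by rw [← hwA]; exact (w a).2, ?_⟩
  convert hPw using 1
  funext a
  exact Subtype.ext (hwA a).symm

end Sim

end Types

section Types

variable {𝔽 : Type u} [Field 𝔽] {L' : FirstOrder.Language.{u, u}}
variable {Rs : Subring 𝔽} {T : (fullLang 𝔽 L').Theory} {α β γ ι' κ' ι κ υ : Type}

variable {N : TGMod Rs T} {A A' : α → N.carrier}

theorem TGMod.sp_joint [Fintype κ] (N : TGMod Rs T) (g : κ → ↥N.G) :
    N.sp (fun j => (g j : N.carrier)) ≤ N.W :=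
  Submodule.span_le.2 (by rintro _ ⟨j, rfl⟩; exact N.G_le_W (g j).2)

theorem TGMod.notMem_sup_W [Fintype ι] [Fintype κ] (N : TGMod Rs T) {u : ι → N.carrier}
    {g : κ → ↥N.G} {c : N.carrier} (hc : c ∉ N.sp (joint u g) ⊔ N.W) : c ∉ N.W ⊔ N.sp u := by
  intro h
  apply hc
  rw [N.sp_elim, sup_assoc, sup_eq_right.2 (N.sp_joint g), sup_comm]
  exact h

section Step

variable [Fintype ι] [Fintype κ]

/-- Adding an element independent of the span of the generic submodule. -/
theorem SimB.exists_inl {u u' : ι → N.carrier} {g g' : κ → ↥N.G} (h : SimB N u u' g g')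
    {c : N.carrier} (hc : c ∉ N.sp (joint u g) ⊔ N.W) :
    ∃ (N' : TGMod Rs T) (f : Ext N N') (d : N'.carrier),
      SimB N' (Sum.elim (fun i => f (u i)) (fun _ : Unit => f c))
        (Sum.elim (fun i => f (u' i)) (fun _ : Unit => d))
        (fun j => f.res (g j)) (fun j => f.res (g' j)) := by
  obtain ⟨N', f, d, hd, hL⟩ := h.sameL.exists_notMem (fun h => hc (Submodule.mem_sup_left h))
    (joint u' g')
  have hm := h.map f
  refine ⟨N', f, d, ?_, ?_, hm.indepG, hm.indepG', ?_, hm.sameR⟩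
  · have := (indepOver_unit h.indep (N.notMem_sup_W hc)).map_W f
    convert this using 1
    funext a
    rcases a with a | a <;> rfl
  · refine indepOver_unit hm.indep' ?_
    rw [joint_map] at hd
    exact N'.notMem_sup_W hd
  · let re : (ι ⊕ Unit) ⊕ κ → (ι ⊕ κ) ⊕ Unit :=
      Sum.elim (Sum.elim (Sum.inl ∘ Sum.inl) Sum.inr) (Sum.inl ∘ Sum.inr)
    convert hL.comp re using 1 <;> (funext a; rcases a with (a | a) | a <;> rfl)

/-- Adding an element of the generic submodule. -/
theorem SimB.exists_inr {u u' : ι → N.carrier} {g g' : κ → ↥N.G} (h : SimB N u u' g g')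
    {t : ↥N.G} (ht : (t : N.carrier) ∉ N.sp (joint u g)) :
    ∃ (N' : TGMod Rs T) (f : Ext N N') (b : ↥N'.G),
      SimB N' (fun i => f (u i)) (fun i => f (u' i))
        (Sum.elim (fun j => f.res (g j)) (fun _ : Unit => f.res t))
        (Sum.elim (fun j => f.res (g' j)) (fun _ : Unit => b)) := by
  have ht' : (t : N.carrier) ∉ N.sp (fun j => (g j : N.carrier)) := fun h' => ht (by
    rw [N.sp_elim]
    exact Submodule.mem_sup_right h')
  obtain ⟨N', f, b, hL, hR⟩ := h.sameL.exists_realize_sameR_one ht h.sameR ht'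
  have hm := h.map f
  have h1 : IndepOver N' ⊥ (fun j : κ ⊕ Unit =>
      ((Sum.elim (fun j => f.res (g j)) (fun _ : Unit => f.res t) j : ↥N'.G) : N'.carrier)) := by
    have := (indepOver_unit h.indepG (d := (t : N.carrier)) (by rwa [bot_sup_eq])).map_bot f
    convert this using 1
    funext a
    rcases a with a | a <;> rfl
  have hL' : SameL N' (joint (fun i => f (u i))
      (Sum.elim (fun j => f.res (g j)) (fun _ : Unit => f.res t)))
      (joint (fun i => f (u' i)) (Sum.elim (fun j => f.res (g' j)) (fun _ : Unit => b))) := by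
    let re : ι ⊕ (κ ⊕ Unit) → (ι ⊕ κ) ⊕ Unit :=
      Sum.elim (Sum.inl ∘ Sum.inl) (Sum.elim (Sum.inl ∘ Sum.inr) Sum.inr)
    convert hL.comp re using 1 <;> (funext a; rcases a with a | a | a <;> rfl)
  refine ⟨N', f, b, hm.indep, hm.indep', h1, ?_, hL', hR⟩
  intro m hm
  refine h1 m ?_
  rw [Submodule.mem_bot] at hm ⊢
  exact (hL'.iff (P := fun N v => ∑ j, m j • v (Sum.inr j) = 0)
    (Elem.eq (TermL.sum _ fun b => TermL.smul _ (ElemT.var _)) TermL.zero)).2 hm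

end Step

theorem Sim.exists_realize_mem_G (h : Sim N A A') {t : N.carrier} (ht : t ∈ N.G) :
    ∃ (N' : TGMod Rs T) (f : Ext N N') (t' : N'.carrier),
      Sim N' (Sum.elim (fun a => f (A a)) (fun _ : Unit => f t))
        (Sum.elim (fun a => f (A' a)) (fun _ => t')) := by
  obtain ⟨ι, κ, _, _, u, u', g, g', hB, h⟩ := h
  by_cases hts : t ∈ N.sp (joint u g)
  · obtain ⟨l, hl⟩ := (N.mem_sp_iff _).1 hts
    refine ⟨N, Ext.refl N, ∑ b, l b • joint u' g' b, ι, κ, _, _, _, _, _, _, hB, ?_⟩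
    rintro (a | a)
    exacts [h a, ⟨l, hl, rfl⟩]
  · obtain ⟨N', f, b, hB'⟩ := hB.exists_inr (t := ⟨t, ht⟩) hts
    refine ⟨N', f, b, _, _, _, _, _, _, _, _, hB', ?_⟩
    rintro (a | a)
    · refine LinRel.trans ?_ ((h a).map f)
      rintro (b | b)
      exacts [LinRel.var (Sum.inl b), LinRel.var (Sum.inr (Sum.inl b))]
    · exact LinRel.var (Sum.inr (Sum.inr ()))

theorem Sim.exists_realize_sum {m : ℕ} (h : Sim N A A') (τ : Fin m → 𝔽) {t : Fin m → N.carrier}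
    (ht : ∀ k, t k ∈ N.G) :
    ∃ (N' : TGMod Rs T) (f : Ext N N') (x' : N'.carrier),
      Sim N' (Sum.elim (fun a => f (A a)) (fun _ : Unit => f (∑ k, τ k • t k)))
        (Sum.elim (fun a => f (A' a)) (fun _ => x')) := by
  induction m generalizing N α with
  | zero =>
    refine ⟨N, Ext.refl N, 0, ?_⟩
    convert h.term (t := Sum.elim (fun a N v => v a) (fun (_ : Unit) N v => 0))
      (by rintro (a | a); exacts [ElemT.var a, TermL.zero]) using 1 <;>
      (funext a; rcases a with a | a <;> simp)
  | succ m ih =>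
    obtain ⟨N₁, f₁, t', h₁⟩ := h.exists_realize_mem_G (ht 0)
    obtain ⟨N₂, f₂, y, h₂⟩ := ih h₁ (fun k => τ k.succ) (t := fun k => f₁ (t k.succ))
      (fun k => f₁.mem_G.2 (ht _))
    refine ⟨N₂, f₁.trans f₂, τ 0 • f₂ t' + y, ?_⟩
    convert h₂.term (t := Sum.elim (fun a N v => v (Sum.inl (Sum.inl a)))
      (fun (_ : Unit) N v => τ 0 • v (Sum.inl (Sum.inr ())) + v (Sum.inr ())))
      (by rintro (a | a); exacts [ElemT.var _, TermL.add (TermL.smul _ (ElemT.var _)) (ElemT.var _)])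
      using 1
    · funext a
      rcases a with a | a
      · rfl
      · simp only [Sum.elim_inr, Sum.elim_inl, Fin.sum_univ_succ, Ext.trans_apply]
        simp only [← Ext.lin_apply, map_add, map_sum, map_smul]
    · funext a
      rcases a with a | a <;> rfl

/-- The back-and-forth property. -/
theorem Sim.exists_realize (h : Sim N A A') (x : N.carrier) :
    ∃ (N' : TGMod Rs T) (f : Ext N N') (x' : N'.carrier),
      Sim N' (Sum.elim (fun a => f (A a)) (fun _ : Unit => f x))
        (Sum.elim (fun a => f (A' a)) (fun _ => x')) := by
  obtain ⟨ι, κ, _, _, u, u', g, g', hB, h⟩ := h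
  by_cases hx : x ∈ N.sp (joint u g) ⊔ N.W
  · obtain ⟨l, m, τ, t, ht, rfl⟩ := (N.mem_sp_sup_W_iff _).1 hx
    obtain ⟨N₁, f₁, y, h₁⟩ := Sim.exists_realize_sum
      (A := Sum.elim A (joint u g)) (A' := Sum.elim A' (joint u' g')) (by
        refine ⟨ι, κ, _, _, _, _, _, _, hB, ?_⟩
        rintro (a | a)
        exacts [h a, LinRel.var a]) τ ht
    refine ⟨N₁, f₁, ∑ b, l b • f₁ (joint u' g' b) + y, ?_⟩
    convert h₁.term (t := Sum.elim (fun a N v => v (Sum.inl (Sum.inl a)))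
      (fun (_ : Unit) N v => ∑ b, l b • v (Sum.inl (Sum.inr b)) + v (Sum.inr ())))
      (by
        rintro (a | a)
        exacts [ElemT.var _, TermL.add (TermL.sum _ fun _ => TermL.smul _ (ElemT.var _))
          (ElemT.var _)]) using 1
    · funext a
      rcases a with a | a
      · rfl
      · simp only [Sum.elim_inr, Sum.elim_inl]
        simp only [← Ext.lin_apply, map_add, map_sum, map_smul]
    · funext a
      rcases a with a | a <;> rfl
  · obtain ⟨N', f, d, hB'⟩ := hB.exists_inl hx
    refine ⟨N', f, d, _, _, _, _, _, _, _, _, hB', ?_⟩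
    rintro (a | a)
    · refine LinRel.trans ?_ ((h a).map f)
      rintro (b | b)
      exacts [LinRel.var (Sum.inl (Sum.inl b)), LinRel.var (Sum.inr b)]
    · exact LinRel.var (Sum.inl (Sum.inr ()))

/-- Tuples spanned in the same way by good tuples of the same type have the same `L_G`-type. -/
theorem Sim.realize_iff {n : ℕ} (φ : (genLang 𝔽 L' ↥Rs).BoundedFormula α n)
    {N : TGMod Rs T} {v v' : α → N.carrier} {xs xs' : Fin n → N.carrier}
    (h : Sim N (Sum.elim v xs) (Sum.elim v' xs')) : φ.Realize v xs ↔ φ.Realize v' xs' := by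
  induction φ generalizing N with
  | falsum => exact Iff.rfl
  | equal t₁ t₂ =>
    exact h.defL (P := fun N u => t₁.realize u = t₂.realize u)
      (Elem.eq (TermG.toL ⟨t₁, fun _ _ => rfl⟩) (TermG.toL ⟨t₂, fun _ _ => rfl⟩))
  | @rel n k R ts =>
    have hts := fun i => TermG.toL (Rs := Rs) (T := T)
      (t := fun N u => (ts i).realize u) ⟨ts i, fun _ _ => rfl⟩
    rcases R with R | R | θ
    · exact h.defL (P := fun N u => @Structure.RelMap (fullLang 𝔽 L') N.carrier _ _ R
        fun i => (ts i).realize u) (Elem.rel (L := fullLang 𝔽 L') R hts)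
    · obtain ⟨⟨rfl⟩⟩ := R
      have key : ∀ {v v' : α → N.carrier} {xs xs' : Fin n → N.carrier},
          Sim N (Sum.elim v xs) (Sum.elim v' xs') →
          (ts 0).realize (Sum.elim v xs) ∈ N.G → (ts 0).realize (Sum.elim v' xs') ∈ N.G := by
        intro v v' xs xs' h hG
        exact ((h.term (t := fun (_ : Unit) N u => (ts 0).realize u) (fun _ => hts 0)).defR
          (P := fun _ _ => True) (Elem.const _) ⟨fun _ => hG, trivial⟩).choose ()
      have hiff : ∀ (v : α → N.carrier) (xs : Fin n → N.carrier),
          (BoundedFormula.rel (Sum.inr (Sum.inl ⟨⟨rfl⟩⟩) : (genLang 𝔽 L' ↥Rs).Relations 1)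
            ts).Realize v xs ↔ (ts 0).realize (Sum.elim v xs) ∈ N.G := by
        intro v xs
        refine iff_of_eq ?_
        change Structure.RelMap (gSym 𝔽 L' ↥Rs) _ = Structure.RelMap (gSym 𝔽 L' ↥Rs) _
        congr 1
        funext i
        fin_cases i; rfl
      rw [hiff, hiff]
      exact ⟨key h, key h.symm⟩
    · have key : ∀ {v v' : α → N.carrier} {xs xs' : Fin n → N.carrier},
          Sim N (Sum.elim v xs) (Sum.elim v' xs') →
          Structure.RelMap (pSym 𝔽 L' ↥Rs θ) (fun i => (ts i).realize (Sum.elim v xs)) →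
          Structure.RelMap (pSym 𝔽 L' ↥Rs θ) (fun i => (ts i).realize (Sum.elim v' xs')) := by
        intro v v' xs xs' h hP
        rw [N.p_iff] at hP ⊢
        exact (h.term (t := fun i N u => (ts i).realize u) hts).defR (Elem.of θ) hP
      exact ⟨key h, key h.symm⟩
  | imp φ ψ ih₁ ih₂ => exact imp_congr (ih₁ h) (ih₂ h)
  | @all n φ ih =>
    have key : ∀ {v v' : α → N.carrier} {xs xs' : Fin n → N.carrier},
        Sim N (Sum.elim v xs) (Sum.elim v' xs') → φ.all.Realize v xs → φ.all.Realize v' xs' := by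
      intro v v' xs xs' h H x'
      obtain ⟨N', f, w, hw⟩ := h.symm.exists_realize x'
      have h1 := (f.map_boundedFormula φ.all v xs).2 H w
      rw [← f.map_boundedFormula]
      refine (ih ?_).1 h1
      let re : α ⊕ Fin (n + 1) → (α ⊕ Fin n) ⊕ Unit :=
        Sum.elim (Sum.inl ∘ Sum.inl) (Fin.snoc (α := fun _ => (α ⊕ Fin n) ⊕ Unit)
          (Sum.inl ∘ Sum.inr) (Sum.inr ()))
      convert hw.symm.comp re using 1 <;>
        (funext a; rcases a with a | a; rfl; refine Fin.lastCases ?_ (fun j => ?_) a <;> simp [re])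
    exact ⟨key h, key h.symm⟩

theorem Sim.iff (h : Sim N A A') {P : ∀ N : TGMod Rs T, (α → N.carrier) → Prop} (hP : DefG P) :
    P N A ↔ P N A' := by
  obtain ⟨φ, hφ⟩ := hP
  rw [hφ, hφ]
  refine Sim.realize_iff φ ?_
  convert h.comp (Sum.elim id (fun i : Fin 0 => i.elim0)) using 1 <;>
    (funext a; rcases a with a | a; rfl; exact a.elim0)

/-- Good tuples of the same `L`-type and additive type have the same `L_G`-type. -/
theorem SimB.of_good [Fintype ι] [Fintype κ] {e e' : ι ⊕ κ → N.carrier} (he : Good N e)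
    (he' : Good N e') (hL : SameL N e e')
    (hA : SameA N (fun j => (⟨e (Sum.inr j), he.1 j⟩ : ↥N.G)) (fun j => ⟨e' (Sum.inr j), he'.1 j⟩))
    {P : ∀ N : TGMod Rs T, (ι ⊕ κ → N.carrier) → Prop} (hP : DefG P) : P N e ↔ P N e' := by
  have hB : SimB N (e ∘ Sum.inl) (e' ∘ Sum.inl)
      (fun j => (⟨e (Sum.inr j), he.1 j⟩ : ↥N.G)) (fun j => ⟨e' (Sum.inr j), he'.1 j⟩) := by
    refine ⟨?_, ?_, he.2.2, he'.2.2, ?_, hA.sameR⟩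
    · simpa only [bot_sup_eq] using (goodOver_iff_indepOver.1 he.2).1
    · simpa only [bot_sup_eq] using (goodOver_iff_indepOver.1 he'.2).1
    · convert hL using 1 <;> (funext a; rcases a with a | a <;> rfl)
  convert hB.sim.iff hP using 2 <;> (funext a; rcases a with a | a <;> rfl)

end Types

section FiniteTypes

variable {𝔽 : Type u} [Field 𝔽] {L' : FirstOrder.Language.{u, u}}
variable {Rs : Subring 𝔽} {T : (fullLang 𝔽 L').Theory} {α β γ ι' κ' ι κ υ : Type}

/-- Compactness for finitely many variables, with approximate solutions in extensions. -/
theorem exists_ext_of_ext [Finite α] (N : TGMod Rs T) (e : β → N.carrier) {J : Type*}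
    (P : J → ∀ N : TGMod Rs T, (β ⊕ α → N.carrier) → Prop) (hP : ∀ j, DefG (P j))
    (hfin : ∀ s : Finset J, ∃ (N' : TGMod Rs T) (f : Ext N N') (v : α → N'.carrier),
      ∀ j ∈ s, P j N' (Sum.elim (fun b => f (e b)) v)) :
    ∃ (N' : TGMod Rs T) (f : Ext N N') (v : α → N'.carrier),
      ∀ j, P j N' (Sum.elim (fun b => f (e b)) v) := by
  refine exists_ext N e P hP fun s => ?_
  obtain ⟨N', f, v, hv⟩ := hfin s
  have hQ : DefG (fun (N : TGMod Rs T) (w : β → N.carrier) =>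
      ∃ v : α → N.carrier, ∀ j ∈ s, P j N (Sum.elim w v)) :=
    Elem.ex ((Elem.forall_mem s fun j _ => hP j).congr fun N v => by
      rw [show Sum.elim (v ∘ Sum.inl) (v ∘ Sum.inr) = v from Sum.elim_comp_inl_inr v])
  exact (f.defG_iff hQ e).1 ⟨v, hv⟩

/-- A tuple lies in the generic submodule and satisfies there an additive formula. -/
def AHolds (θ : AddForm T Rs κ) (N : TGMod Rs T) (e : κ → N.carrier) : Prop :=
  ∃ hv : ∀ j, e j ∈ N.G, θ.1.Realize (fun j => (⟨e j, hv j⟩ : ↥N.G))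

theorem AHolds.defG [Finite κ] (θ : AddForm T Rs κ) : DefG (AHolds θ) :=
  DefR.toG (t := fun a N v => v a) (Elem.of θ.1) fun a => ElemT.var a

theorem aHolds_iff (θ : AddForm T Rs κ) {N : TGMod Rs T} {e : κ → N.carrier}
    (he : ∀ j, e j ∈ N.G) : AHolds θ N e ↔ θ.1.Realize (fun j => (⟨e j, he j⟩ : ↥N.G)) :=
  ⟨fun ⟨_, h⟩ => h, fun h => ⟨he, h⟩⟩

theorem InG.defG [Finite κ] : DefG (fun (N : TGMod Rs T) (v : ι ⊕ κ → N.carrier) => InG N v) :=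
  Elem.forall_fin fun j => DefG.memG (ElemT.var (Sum.inr j))

theorem good_iff_forall_not_depHolds [Fintype ι] [Fintype κ] (N : TGMod Rs T)
    (e : ι ⊕ κ → N.carrier) :
    Good N e ↔ InG N e ∧ ∀ d : DepData 𝔽 ι κ Empty, ¬ DepHolds d N e Empty.elim := by
  rw [← goodOver_iff_forall_not_depHolds, N.sp_empty]
  rfl

theorem DepHolds.defG_empty [Fintype ι] [Fintype κ] (d : DepData 𝔽 ι κ Empty) :
    DefG (Rs := Rs) (T := T) (fun N (v : ι ⊕ κ → N.carrier) => DepHolds d N v Empty.elim) := by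
  have := (DepHolds.defG (Rs := Rs) (T := T) d).subst
    (s := Sum.elim (fun a N (v : ι ⊕ κ → N.carrier) => v a) (fun a => a.elim))
    (by rintro (a | a); exacts [ElemT.var a, a.elim])
  refine this.congr fun N v => iff_of_eq ?_
  congr 1
  funext a
  exact a.elim

/-- On good tuples, a definable property is decided by finitely many `L`-formulas and
finitely many additive formulas. -/
theorem exists_finite_types [Fintype ι] [Fintype κ] (N : TGMod Rs T)
    {P : ∀ N : TGMod Rs T, (ι ⊕ κ → N.carrier) → Prop} (hP : DefG P) :
    ∃ (FL : Finset ((fullLang 𝔽 L').Formula (ι ⊕ κ))) (FA : Finset (AddForm T Rs κ)),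
      ∀ (N' : TGMod Rs T) (f : Ext N N') (e e' : ι ⊕ κ → N'.carrier), Good N' e → Good N' e' →
        (∀ φ ∈ FL, φ.Realize e ↔ φ.Realize e') →
        (∀ θ ∈ FA, AHolds θ N' (e ∘ Sum.inr) ↔ AHolds θ N' (e' ∘ Sum.inr)) →
        P N' e → P N' e' := by
  classical
  by_contra! hcon
  let Q : (Unit ⊕ DepData 𝔽 ι κ Empty) ⊕ ((fullLang 𝔽 L').Formula (ι ⊕ κ) ⊕ AddForm T Rs κ) →
      ∀ N : TGMod Rs T, (Empty ⊕ ((ι ⊕ κ) ⊕ (ι ⊕ κ)) → N.carrier) → Prop :=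
    Sum.elim (Sum.elim
      (fun _ N v => (InG N (v ∘ Sum.inr ∘ Sum.inl) ∧ InG N (v ∘ Sum.inr ∘ Sum.inr)) ∧
        P N (v ∘ Sum.inr ∘ Sum.inl) ∧ ¬ P N (v ∘ Sum.inr ∘ Sum.inr))
      (fun d N v => ¬ DepHolds d N (v ∘ Sum.inr ∘ Sum.inl) Empty.elim ∧
        ¬ DepHolds d N (v ∘ Sum.inr ∘ Sum.inr) Empty.elim))
      (Sum.elim
      (fun φ N v => φ.Realize (v ∘ Sum.inr ∘ Sum.inl) ↔ φ.Realize (v ∘ Sum.inr ∘ Sum.inr))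
      (fun θ N v => AHolds θ N ((v ∘ Sum.inr ∘ Sum.inl) ∘ Sum.inr) ↔
        AHolds θ N ((v ∘ Sum.inr ∘ Sum.inr) ∘ Sum.inr)))
  obtain ⟨N', f, v, hv⟩ := exists_ext_of_ext N Empty.elim Q (by
      rintro ((_ | d) | (φ | θ))
      · exact ((InG.defG.relabel _).and (InG.defG.relabel _)).and
          ((hP.relabel _).and (hP.relabel _).not)
      · exact ((DepHolds.defG_empty d).relabel _).not.and ((DepHolds.defG_empty d).relabel _).not
      · exact (DefL.toG ((Elem.of φ).relabel _)).iff (DefL.toG ((Elem.of φ).relabel _))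
      · exact (((AHolds.defG θ).relabel _).relabel (Sum.inr ∘ Sum.inl)).iff
          (((AHolds.defG θ).relabel _).relabel (Sum.inr ∘ Sum.inr))) (fun s => by
      obtain ⟨N', f, e, e', he, he', h1, h2, h3, h4⟩ := hcon
        (s.preimage (Sum.inr ∘ Sum.inl) ((Sum.inr_injective.comp Sum.inl_injective).injOn))
        (s.preimage (Sum.inr ∘ Sum.inr) ((Sum.inr_injective.comp Sum.inr_injective).injOn))
      refine ⟨N', f, Sum.elim e e', ?_⟩
      rintro ((_ | d) | (φ | θ)) hj
      · exact ⟨⟨he.1, he'.1⟩, h3, h4⟩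
      · exact ⟨((good_iff_forall_not_depHolds _ _).1 he).2 d,
          ((good_iff_forall_not_depHolds _ _).1 he').2 d⟩
      · exact h1 φ (by simpa using hj)
      · exact h2 θ (by simpa using hj))
  obtain ⟨⟨g1, g2⟩, p1, p2⟩ := hv (Sum.inl (Sum.inl ()))
  have e1 := (good_iff_forall_not_depHolds _ _).2 ⟨g1, fun d => (hv (Sum.inl (Sum.inr d))).1⟩
  have e2 := (good_iff_forall_not_depHolds _ _).2 ⟨g2, fun d => (hv (Sum.inl (Sum.inr d))).2⟩
  refine p2 ((SimB.of_good e1 e2 (fun φ => hv (Sum.inr (Sum.inl φ))) (fun θ => ?_) hP).1 p1)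
  exact (aHolds_iff θ e1.1).symm.trans ((hv (Sum.inr (Sum.inr θ))).trans (aHolds_iff θ e2.1))

end FiniteTypes

section Trees

variable {𝔽 : Type u} [Field 𝔽] {L' : FirstOrder.Language.{u, u}}
variable {Rs : Subring 𝔽} {T : (fullLang 𝔽 L').Theory} {α β γ ι' κ' ι κ υ : Type}

/-- A tree witnessing the antichain tree property up to level `k`. -/
structure PreTree (k : ℕ) (Φ : ∀ N : TGMod Rs T, (α → N.carrier) → (β → N.carrier) → Prop)
    (N : TGMod Rs T) (a : List Bool → β → N.carrier) : Prop where
  cons : ∀ X : Finset (List Bool), IsTreeAntichain (X : Set (List Bool)) → X ⊆ lev k →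
    ∃ b, ∀ η ∈ X, Φ N b (a η)
  incons : ∀ η ∈ lev k, ∀ ν ∈ lev k, η ≠ ν → η <+: ν → ∀ b, Φ N b (a η) → Φ N b (a ν) → False

/-- A tree witnessing the antichain tree property. -/
def ATPTree (Φ : ∀ N : TGMod Rs T, (α → N.carrier) → (β → N.carrier) → Prop)
    (N : TGMod Rs T) (a : List Bool → β → N.carrier) : Prop :=
  ∀ k, PreTree k Φ N a

variable {Φ : ∀ N : TGMod Rs T, (α → N.carrier) → (β → N.carrier) → Prop} {N : TGMod Rs T}
  {a : List Bool → β → N.carrier}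

theorem subset_lev_sup (X : Finset (List Bool)) : X ⊆ lev (X.sup List.length) :=
  fun s hs => mem_lev.2 (Finset.le_sup (f := List.length) hs)

theorem ATPTree.cons (h : ATPTree Φ N a) (X : Finset (List Bool))
    (hX : IsTreeAntichain (X : Set (List Bool))) : ∃ b, ∀ η ∈ X, Φ N b (a η) :=
  (h _).cons X hX (subset_lev_sup X)

theorem ATPTree.incons (h : ATPTree Φ N a) (η ν : List Bool) (hne : η ≠ ν) (hp : η <+: ν) :
    ∀ b, Φ N b (a η) → Φ N b (a ν) → False :=
  (h _).incons η (mem_lev.2 hp.length_le) ν (mem_lev.2 le_rfl) hne hp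

theorem isTreeAntichain_singleton (η : List Bool) :
    IsTreeAntichain (({η} : Finset (List Bool)) : Set (List Bool)) := by
  intro s hs t ht hne
  simp only [Finset.coe_singleton, Set.mem_singleton_iff] at hs ht
  exact absurd (hs.trans ht.symm) hne

theorem ATPTree.comp (h : ATPTree Φ N a) {e : List Bool → List Bool} (he : StrongEmb e) :
    ATPTree Φ N (a ∘ e) := by
  classical
  refine fun k => ⟨fun X hX _ => ?_, fun η _ ν _ hne hp =>
    h.incons _ _ (fun h => hne (he.injective h)) (he.mono hp)⟩
  obtain ⟨b, hb⟩ := h.cons (X.image e) (by simpa using he.antichain hX)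
  exact ⟨b, fun η hη => hb _ (Finset.mem_image_of_mem _ hη)⟩

/-- Compactness for trees. -/
theorem exists_atpTree [Finite α] [Finite β] {J : Type*}
    (hΦ : DefG (fun N (v : α ⊕ β → N.carrier) => Φ N (v ∘ Sum.inl) (v ∘ Sum.inr)))
    (Δ : J → ∀ N : TGMod Rs T, (β → N.carrier) → Prop) (hΔ : ∀ j, DefG (Δ j))
    (h : ∀ k (s : Finset J), ∃ a, PreTree k Φ N a ∧ ∀ η ∈ lev k, ∀ j ∈ s, Δ j N (a η)) :
    ∃ (N' : TGMod Rs T) (f : Ext N N') (a' : List Bool → β → N'.carrier), ATPTree Φ N' a' ∧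
      ∀ η j, Δ j N' (a' η) := by
  classical
  let Q : ({X : Finset (List Bool) // IsTreeAntichain (X : Set (List Bool))} ⊕
      {p : List Bool × List Bool // p.1 ≠ p.2 ∧ p.1 <+: p.2}) ⊕ (List Bool × J) →
      ∀ N : TGMod Rs T, (Empty ⊕ (List Bool × β) → N.carrier) → Prop :=
    Sum.elim (Sum.elim (fun X N v => ∃ b, ∀ η ∈ X.1, Φ N b (fun i => v (Sum.inr (η, i))))
      (fun p N v => ∀ b, Φ N b (fun i => v (Sum.inr (p.1.1, i))) →
        Φ N b (fun i => v (Sum.inr (p.1.2, i))) → False))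
      (fun p N v => Δ p.2 N (fun i => v (Sum.inr (p.1, i))))
  have key : ∀ η, DefG (fun (N : TGMod Rs T) (v : (Empty ⊕ (List Bool × β)) ⊕ α → N.carrier) =>
      Φ N (v ∘ Sum.inr) (fun i => (v ∘ Sum.inl) (Sum.inr (η, i)))) := fun η =>
    (hΦ.relabel (Sum.elim Sum.inr (fun i => Sum.inl (Sum.inr (η, i)))))
  obtain ⟨N', f, v, hv⟩ := exists_ext N Empty.elim Q (by
      rintro ((X | p) | p)
      · exact Elem.ex (Elem.forall_mem _ fun η _ => key η)
      · exact Elem.all ((key _).imp ((key _).imp (Elem.const False)))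
      · exact (hΔ p.2).relabel _) (fun s => by
      obtain ⟨k, hk⟩ : ∃ k, ∀ j ∈ s, Sum.elim (Sum.elim
          (fun X : {X : Finset (List Bool) // IsTreeAntichain (X : Set (List Bool))} =>
            X.1.sup List.length)
          (fun p : {p : List Bool × List Bool // p.1 ≠ p.2 ∧ p.1 <+: p.2} => p.1.2.length))
          (fun p : List Bool × J => p.1.length) j ≤ k := ⟨_, fun j hj => Finset.le_sup hj⟩
      obtain ⟨a, ha, hd⟩ := h k (s.preimage (fun p => Sum.inr p) Sum.inr_injective.injOn
        |>.image Prod.snd)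
      refine ⟨fun p => a p.1 p.2, ?_⟩
      rintro ((X | p) | p) hj
      · exact ha.cons X.1 X.2 ((subset_lev_sup _).trans fun t ht =>
          mem_lev.2 ((mem_lev.1 ht).trans (hk _ hj)))
      · exact ha.incons _ (mem_lev.2 (p.2.2.length_le.trans (hk _ hj))) _
          (mem_lev.2 (hk _ hj)) p.2.1 p.2.2
      · exact hd p.1 (mem_lev.2 (hk _ hj)) p.2 (Finset.mem_image.2 ⟨p, by simpa using hj, rfl⟩))
  exact ⟨N', f, fun η i => v (η, i), fun k => ⟨fun X hX _ => hv (Sum.inl (Sum.inl ⟨X, hX⟩)),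
    fun η _ ν _ hne hp => hv (Sum.inl (Sum.inr ⟨(η, ν), hne, hp⟩))⟩, fun η j => hv (Sum.inr (η, j))⟩

/-- Passing to a subtree on which solutions have a fixed colour. -/
theorem ATPTree.exists_colour {K : Type*} [Finite K] (h : ATPTree Φ N a)
    (Ψ : K → (α → N.carrier) → (β → N.carrier) → Prop)
    (hc : ∀ X : Finset (List Bool), IsTreeAntichain (X : Set (List Bool)) →
      ∃ b, ∀ η ∈ X, Φ N b (a η) ∧ ∃ i, Ψ i b (a η)) :
    ∃ i, ∀ k, ∃ e, StrongEmb e ∧ ∀ X : Finset (List Bool),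
      IsTreeAntichain (X : Set (List Bool)) → X ⊆ lev k →
        ∃ b, ∀ η ∈ X, Φ N b (a (e η)) ∧ Ψ i b (a (e η)) := by
  classical
  choose b hb using hc
  have : Nonempty K := by
    obtain ⟨i, _⟩ := (hb {[]} (isTreeAntichain_singleton _) [] (by simp)).2
    exact ⟨i⟩
  let c : Finset (List Bool) → List Bool → K := fun X η =>
    if hX : ∃ hX : IsTreeAntichain (X : Set (List Bool)), η ∈ X then
      (hb X hX.1 η hX.2).2.choose else Classical.arbitrary K
  obtain ⟨i, hi⟩ := exists_homogeneous_strongEmb c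
  refine ⟨i, fun k => ?_⟩
  obtain ⟨e, he, hA⟩ := hi k
  refine ⟨e, he, fun X hX hk => ?_⟩
  obtain ⟨Y, hY, hXY, hcol⟩ := hA X hX hk
  refine ⟨b Y hY, fun η hη => ?_⟩
  have hmem : e η ∈ Y := hXY (Finset.mem_image_of_mem _ hη)
  refine ⟨(hb Y hY _ hmem).1, ?_⟩
  have := hcol η hη
  have h2 : ∃ hX : IsTreeAntichain (Y : Set (List Bool)), e η ∈ Y := ⟨hY, hmem⟩
  simp only [c] at this
  rw [dif_pos h2] at this
  rw [← this]
  exact (hb Y hY _ hmem).2.choose_spec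

/-- The nodes of a tree can be taken to be good tuples. -/
theorem ATPTree.exists_good [Finite α] (Q : ∀ N : TGMod Rs T, (α → N.carrier) → Prop) (p : ℕ) :
    ∀ (q : ℕ) {ι κ : Type} [Fintype ι] [Fintype κ], Fintype.card ι = p → Fintype.card κ = q →
    ∀ {Φ : ∀ N : TGMod Rs T, (α → N.carrier) → (ι ⊕ κ → N.carrier) → Prop}
      (hΦ : DefG (fun N (v : α ⊕ (ι ⊕ κ) → N.carrier) => Φ N (v ∘ Sum.inl) (v ∘ Sum.inr)))
      (hQ : ∀ N b y, Φ N b y → Q N b) {N : TGMod Rs T} {a : List Bool → ι ⊕ κ → N.carrier},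
      ATPTree Φ N a → (∀ η, InG N (a η)) →
    ∃ (ι' κ' : Type) (_ : Fintype ι') (_ : Fintype κ')
      (Φ' : ∀ N : TGMod Rs T, (α → N.carrier) → (ι' ⊕ κ' → N.carrier) → Prop),
      DefG (fun N (v : α ⊕ (ι' ⊕ κ') → N.carrier) => Φ' N (v ∘ Sum.inl) (v ∘ Sum.inr)) ∧
      (∀ N b y, Φ' N b y → Q N b) ∧
      ∃ (N' : TGMod Rs T) (a' : List Bool → ι' ⊕ κ' → N'.carrier), ATPTree Φ' N' a' ∧
        ∀ η, Good N' (a' η) := by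
  classical
  induction p using Nat.strong_induction_on with
  | _ p ihp =>
  intro q
  induction q using Nat.strong_induction_on with
  | _ q ihq =>
  intro ι κ _ _ hp hq Φ hΦ hQ N a ha hG
  by_cases hd : ∃ d : DepData 𝔽 ι κ Empty, ∀ k, ∃ e, StrongEmb e ∧
      ∀ η ∈ lev k, DepHolds d N (a (e η)) Empty.elim
  · obtain ⟨d, hd⟩ := hd
    obtain ⟨N', f, a', ha', hd'⟩ := exists_atpTree (N := N) hΦ (J := Unit)
      (fun _ N y => InG N y ∧ DepHolds d N y Empty.elim)
      (fun _ => InG.defG.and (DepHolds.defG_empty d)) (fun k s => by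
        obtain ⟨e, he, hk⟩ := hd k
        exact ⟨a ∘ e, ha.comp he k, fun η hη _ _ => ⟨hG _, hk η hη⟩⟩)
    obtain ⟨ι₁, κ₁, _, _, t, hcard, ht, hex⟩ := DepData.exists_smaller (Rs := Rs) (T := T) d
    choose y hy hyt using fun η => hex N' (a' η) Empty.elim (hd' η ()).1 (hd' η ()).2
    let Φ' : ∀ N : TGMod Rs T, (α → N.carrier) → (ι₁ ⊕ κ₁ → N.carrier) → Prop :=
      fun N b y => Φ N b (fun a => t a N (Sum.elim y Empty.elim))
    have hΦ' : DefG (fun N (v : α ⊕ (ι₁ ⊕ κ₁) → N.carrier) =>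
        Φ' N (v ∘ Sum.inl) (v ∘ Sum.inr)) := by
      have := hΦ.subst (s := Sum.elim (fun i N (v : α ⊕ (ι₁ ⊕ κ₁) → N.carrier) => v (Sum.inl i))
        (fun a N v => t a N (Sum.elim (v ∘ Sum.inr) Empty.elim))) (by
          rintro (i | a)
          · exact ElemT.var _
          · refine TermL.toG ((ElemT.subst (ht a) (s := Sum.elim (fun a N v => v (Sum.inr a))
              (fun a => a.elim)) (by rintro (i | i); exacts [ElemT.var _, i.elim])).congr
              fun N v => ?_)
            refine congrArg (t a N) (funext fun i => ?_)
            rcases i with i | i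
            · rfl
            · exact i.elim)
      exact this
    have ha₁ : ATPTree Φ' N' y := by
      have : ∀ η, a' η = fun a => t a N' (Sum.elim (y η) Empty.elim) := fun η => funext (hyt η)
      intro k
      refine ⟨fun X hX hk => ?_, fun η hη ν hν hne hp b h1 h2 => ?_⟩
      · obtain ⟨b, hb⟩ := (ha' k).cons X hX hk
        exact ⟨b, fun η hη => by have := hb η hη; rwa [‹∀ η, a' η = _› η] at this⟩
      · refine (ha' k).incons η hη ν hν hne hp b ?_ ?_
        · rw [this η]; exact h1
        · rw [this ν]; exact h2
    rcases hcard with hcard | ⟨hcard, hcard'⟩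
    · exact ihp _ (hp ▸ hcard) _ rfl rfl hΦ' (fun N b y h => hQ _ _ _ h) ha₁ hy
    · exact ihq _ (hq ▸ hcard') (hcard.trans hp) rfl hΦ' (fun N b y h => hQ _ _ _ h) ha₁ hy
  · push Not at hd
    obtain ⟨N', f, a', ha', hd'⟩ := exists_atpTree (N := N) hΦ (J := Option (DepData 𝔽 ι κ Empty))
      (fun d N y => d.elim (InG N y) (fun d => ¬ DepHolds d N y Empty.elim))
      (fun d => by
        rcases d with _ | d
        · exact InG.defG
        · exact (DepHolds.defG_empty d).not) (fun k s => by
        have : Finite {d : DepData 𝔽 ι κ Empty // some d ∈ s} :=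
          Finite.of_injective (β := s) (fun d => ⟨some d.1, d.2⟩) fun d d' h => by
            simpa [Subtype.ext_iff] using h
        obtain ⟨i, hi⟩ := ha.exists_colour (K := Option {d // some d ∈ s})
          (fun i b y => i.elim (∀ d, some d ∈ s → ¬ DepHolds d N y Empty.elim)
            (fun d => DepHolds d.1 N y Empty.elim)) (fun X hX => by
            obtain ⟨b, hb⟩ := ha.cons X hX
            refine ⟨b, fun η hη => ⟨hb η hη, ?_⟩⟩
            by_cases h : ∀ d, some d ∈ s → ¬ DepHolds d N (a η) Empty.elim
            · exact ⟨none, h⟩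
            · push Not at h
              obtain ⟨d, hd, h⟩ := h
              exact ⟨some ⟨d, hd⟩, h⟩)
        rcases i with _ | d
        · obtain ⟨e, he, hk⟩ := hi k
          refine ⟨a ∘ e, ha.comp he k, fun η hη j hj => ?_⟩
          rcases j with _ | d
          · exact hG _
          · obtain ⟨b, hb⟩ := hk {η} (isTreeAntichain_singleton η) (by simpa using hη)
            exact (hb η (by simp)).2 d hj
        · exfalso
          obtain ⟨k, hk⟩ := hd d.1
          obtain ⟨e, he, hke⟩ := hi k
          obtain ⟨η, hη, hn⟩ := hk e he
          obtain ⟨b, hb⟩ := hke {η} (isTreeAntichain_singleton η) (by simpa using hη)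
          exact hn (hb η (by simp)).2)
    exact ⟨ι, κ, _, _, Φ, hΦ, hQ, N', a', ha', fun η => (good_iff_forall_not_depHolds _ _).2
      ⟨hd' η none, fun d => hd' η (some d)⟩⟩

end Trees

section GenTrees

variable {𝔽 : Type u} [Field 𝔽] {L' : FirstOrder.Language.{u, u}}
variable {Rs : Subring 𝔽} {T : (fullLang 𝔽 L').Theory} {α β γ ι' κ' ι κ υ : Type}

/-- A tree of good tuples witnessing the antichain tree property by solutions which are good
over the parameters. -/
structure GenTree (Φ : ∀ N : TGMod Rs T, (ι ⊕ κ → N.carrier) → (ι' ⊕ κ' → N.carrier) → Prop)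
    [Fintype ι] [Fintype κ] [Fintype ι'] [Fintype κ']
    (N : TGMod Rs T) (a : List Bool → ι' ⊕ κ' → N.carrier) : Prop where
  good : ∀ η, Good N (a η)
  cons : ∀ X : Finset (List Bool), IsTreeAntichain (X : Set (List Bool)) →
    ∃ b, InG N b ∧ GoodOver N (N.sp fun p : X × (ι' ⊕ κ') => a p.1 p.2) b ∧ ∀ η ∈ X, Φ N b (a η)
  incons : ∀ η ν : List Bool, η ≠ ν → η <+: ν → ∀ b, Φ N b (a η) → Φ N b (a ν) → False

theorem GenTree.of_forall [Fintype ι] [Fintype κ] [Fintype ι'] [Fintype κ']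
    {Φ : ∀ N : TGMod Rs T, (ι ⊕ κ → N.carrier) → (ι' ⊕ κ' → N.carrier) → Prop}
    (hΦ : DefG (fun N (v : (ι ⊕ κ) ⊕ (ι' ⊕ κ') → N.carrier) => Φ N (v ∘ Sum.inl) (v ∘ Sum.inr)))
    (hG : ∀ N b y, Φ N b y → InG N b) {N : TGMod Rs T} {a : List Bool → ι' ⊕ κ' → N.carrier}
    (hgood : ∀ η, Good N (a η))
    (hin : ∀ η ν : List Bool, η ≠ ν → η <+: ν → ∀ b, Φ N b (a η) → Φ N b (a ν) → False)
    (hA : ∀ X : Finset (List Bool), IsTreeAntichain (X : Set (List Bool)) →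
      ∀ S : Finset (DepData 𝔽 ι κ (X × (ι' ⊕ κ'))), ∃ b, InG N b ∧ (∀ η ∈ X, Φ N b (a η)) ∧
        ∀ d ∈ S, ¬ DepHolds d N b (fun p => a p.1 p.2)) :
    ∃ (N' : TGMod Rs T) (a' : List Bool → ι' ⊕ κ' → N'.carrier), GenTree Φ N' a' := by
  classical
  let AC := {X : Finset (List Bool) // IsTreeAntichain (X : Set (List Bool))}
  let Q : (Σ X : AC, Option (DepData 𝔽 ι κ (X.1 × (ι' ⊕ κ')))) → ∀ N : TGMod Rs T,
      ((List Bool × (ι' ⊕ κ')) ⊕ (AC × (ι ⊕ κ)) → N.carrier) → Prop := fun j N v =>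
    j.2.elim (InG N (fun i => v (Sum.inr (j.1, i))) ∧
      ∀ η ∈ j.1.1, Φ N (fun i => v (Sum.inr (j.1, i))) (fun i => v (Sum.inl (η, i))))
      (fun d => ¬ DepHolds d N (fun i => v (Sum.inr (j.1, i))) (fun p => v (Sum.inl (p.1, p.2))))
  obtain ⟨N', f, v, hv⟩ := exists_ext N (fun p : List Bool × (ι' ⊕ κ') => a p.1 p.2) Q (by
      rintro ⟨X, _ | d⟩
      · exact (InG.defG.relabel (fun i => Sum.inr (X, i))).and (Elem.forall_mem _ fun η _ =>
          hΦ.relabel (Sum.elim (fun i => Sum.inr (X, i)) (fun i => Sum.inl (η, i))))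
      · exact ((DepHolds.defG d).relabel (Sum.elim (fun i => Sum.inr (X, i))
          (fun p => Sum.inl ((p.1 : List Bool), p.2)))).not) (fun s => by
      choose b hb using fun X : AC => hA X.1 X.2
        (s.preimage (fun d => ⟨X, some d⟩) (fun d _ d' _ h => by simpa using h))
      refine ⟨fun p => b p.1 p.2, ?_⟩
      rintro ⟨X, _ | d⟩ hj
      · exact ⟨(hb X).1, (hb X).2.1⟩
      · exact (hb X).2.2 d (Finset.mem_preimage.2 hj))
  refine ⟨N', fun η i => f (a η i), fun η => (hgood η).map f, fun X hX => ?_,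
    fun η ν hne hp b h1 h2 => ?_⟩
  · refine ⟨fun i => v (⟨X, hX⟩, i), (hv ⟨⟨X, hX⟩, none⟩).1, ?_, (hv ⟨⟨X, hX⟩, none⟩).2⟩
    rw [goodOver_iff_forall_not_depHolds]
    exact fun d => hv ⟨⟨X, hX⟩, some d⟩
  · have hD : DefG (fun (N : TGMod Rs T) (w : (ι' ⊕ κ') ⊕ (ι' ⊕ κ') → N.carrier) =>
        ∃ b, Φ N b (w ∘ Sum.inl) ∧ Φ N b (w ∘ Sum.inr)) :=
      Elem.ex ((hΦ.relabel (Sum.elim Sum.inr (Sum.inl ∘ Sum.inl))).and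
        (hΦ.relabel (Sum.elim Sum.inr (Sum.inl ∘ Sum.inr))))
    obtain ⟨b, h1, h2⟩ := (f.defG_iff hD (Sum.elim (a η) (a ν))).1 ⟨b, h1, h2⟩
    exact hin η ν hne hp b h1 h2

/-- From a tree one obtains a tree with generic solutions. -/
theorem ATPTree.exists_genTree (p : ℕ) :
    ∀ (q : ℕ) {ι κ β : Type} [Fintype ι] [Fintype κ] [Fintype β],
      Fintype.card ι = p → Fintype.card κ = q →
    ∀ {Φ : ∀ N : TGMod Rs T, (ι ⊕ κ → N.carrier) → (β → N.carrier) → Prop}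
      (hΦ : DefG (fun N (v : (ι ⊕ κ) ⊕ β → N.carrier) => Φ N (v ∘ Sum.inl) (v ∘ Sum.inr)))
      (hG : ∀ N b y, Φ N b y → InG N b) {N : TGMod Rs T} {a : List Bool → β → N.carrier},
      ATPTree Φ N a →
    ∃ (ι κ ι' κ' : Type) (_ : Fintype ι) (_ : Fintype κ) (_ : Fintype ι') (_ : Fintype κ')
      (Φ' : ∀ N : TGMod Rs T, (ι ⊕ κ → N.carrier) → (ι' ⊕ κ' → N.carrier) → Prop),
      DefG (fun N (v : (ι ⊕ κ) ⊕ (ι' ⊕ κ') → N.carrier) => Φ' N (v ∘ Sum.inl) (v ∘ Sum.inr)) ∧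
      ∃ (N' : TGMod Rs T) (a' : List Bool → ι' ⊕ κ' → N'.carrier), GenTree Φ' N' a' := by
  classical
  induction p using Nat.strong_induction_on with
  | _ p ihp =>
  intro q
  induction q using Nat.strong_induction_on with
  | _ q ihq =>
  intro ι κ β₀ _ _ _ hp hq Φ₀ hΦ₀ hG₀ N₀ a₀ ha₀
  obtain ⟨ι', κ', _, _, Φ, hΦ, hG, N, a, ha, hgood⟩ := ATPTree.exists_good
    (fun N => InG N) _ _ (ι := β₀) (κ := Empty) rfl rfl
    (Φ := fun N b y => Φ₀ N b (y ∘ Sum.inl))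
    (hΦ₀.relabel (Sum.elim Sum.inl (Sum.inr ∘ Sum.inl))) (fun N b y h => hG₀ N b _ h)
    (N := N₀) (a := fun η => Sum.elim (a₀ η) Empty.elim)
    (fun k => ⟨(ha₀ k).cons, (ha₀ k).incons⟩) (fun η j => j.elim)
  by_cases hA : ∀ X : Finset (List Bool), IsTreeAntichain (X : Set (List Bool)) →
      ∀ S : Finset (DepData 𝔽 ι κ (X × (ι' ⊕ κ'))), ∃ b, InG N b ∧
        (∀ η ∈ X, Φ N b (a (false :: η))) ∧
        ∀ d ∈ S, ¬ DepHolds d N b (fun p => a (false :: p.1) p.2)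
  · obtain ⟨N', a', h⟩ := GenTree.of_forall hΦ hG (fun η => hgood (false :: η))
      (fun η ν hne hp => ha.incons _ _ (by simpa using hne) (by simpa using hp)) hA
    exact ⟨ι, κ, ι', κ', _, _, _, _, Φ, hΦ, N', a', h⟩
  push Not at hA
  obtain ⟨X₀, hX₀, S, hS⟩ := hA
  let A : X₀ × (ι' ⊕ κ') → N.carrier := fun p => a (false :: p.1) p.2
  let Φ₂ : ∀ N : TGMod Rs T, (ι ⊕ κ → N.carrier) →
      ((X₀ × (ι' ⊕ κ')) ⊕ (ι' ⊕ κ') → N.carrier) → Prop := fun N b z =>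
    (∀ η : X₀, Φ N b (fun i => z (Sum.inl (η, i)))) ∧ Φ N b (z ∘ Sum.inr)
  let a₂ : List Bool → (X₀ × (ι' ⊕ κ')) ⊕ (ι' ⊕ κ') → N.carrier := fun η =>
    Sum.elim A (a (true :: η))
  have hsol : ∀ X : Finset (List Bool), IsTreeAntichain (X : Set (List Bool)) →
      ∃ b, ∀ η ∈ X₀.image (List.cons false) ∪ X.image (List.cons true), Φ N b (a η) := by
    intro X hX
    refine ha.cons _ ?_
    intro s hs t ht hne
    simp only [Finset.coe_union, Finset.coe_image, Set.mem_union, Set.mem_image] at hs ht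
    rcases hs with ⟨s, hs, rfl⟩ | ⟨s, hs, rfl⟩ <;> rcases ht with ⟨t, ht, rfl⟩ | ⟨t, ht, rfl⟩
    · simpa [TreeComparable] using hX₀ s hs t ht (by simpa using hne)
    · simp [TreeComparable]
    · simp [TreeComparable]
    · simpa [TreeComparable] using hX s hs t ht (by simpa using hne)
  have ha₂ : ATPTree Φ₂ N a₂ := by
    refine fun k => ⟨fun X hX _ => ?_, fun η _ ν _ hne hp b h1 h2 => ?_⟩
    · obtain ⟨b, hb⟩ := hsol X hX
      exact ⟨b, fun η hη => ⟨fun ζ => hb (false :: ζ) (by simp), hb _ (by simp [hη])⟩⟩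
    · exact ha.incons _ _ (by simpa using hne) (by simpa using hp) b h1.2 h2.2
  obtain ⟨d, hd⟩ := ha₂.exists_colour (K := S) (fun d b z => DepHolds d.1 N b A) (fun X hX => by
    obtain ⟨b, hb⟩ := hsol X hX
    refine ⟨b, fun η hη => ⟨⟨fun ζ => hb (false :: ζ) (by simp), hb _ (by simp [hη])⟩, ?_⟩⟩
    obtain ⟨d, hd, h⟩ := hS b (hG _ _ _ (hb (true :: η) (by simp [hη])))
      (fun ζ hζ => hb _ (by simp [hζ]))
    exact ⟨⟨d, hd⟩, h⟩)
  obtain ⟨ι₁, κ₁, _, _, t, hcard, ht, hex⟩ := DepData.exists_smaller (Rs := Rs) (T := T) d.1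
  let tt : ∀ N : TGMod Rs T, (ι₁ ⊕ κ₁ → N.carrier) →
      ((X₀ × (ι' ⊕ κ')) ⊕ (ι' ⊕ κ') → N.carrier) → ι ⊕ κ → N.carrier := fun N b z i =>
    t i N (Sum.elim b (z ∘ Sum.inl))
  let Φ₄ : ∀ N : TGMod Rs T, (ι₁ ⊕ κ₁ → N.carrier) →
      ((X₀ × (ι' ⊕ κ')) ⊕ (ι' ⊕ κ') → N.carrier) → Prop := fun N b z =>
    InG N b ∧ Φ₂ N (tt N b z) z
  have hΦ₂ : DefG (fun N (v : (ι ⊕ κ) ⊕ ((X₀ × (ι' ⊕ κ')) ⊕ (ι' ⊕ κ')) → N.carrier) =>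
      Φ₂ N (v ∘ Sum.inl) (v ∘ Sum.inr)) :=
    (Elem.forall_fin fun η => hΦ.relabel
      (Sum.elim Sum.inl (fun i => Sum.inr (Sum.inl (η, i))))).and
      (hΦ.relabel (Sum.elim Sum.inl (Sum.inr ∘ Sum.inr)))
  have hΦ₄ : DefG (fun N (v : (ι₁ ⊕ κ₁) ⊕ ((X₀ × (ι' ⊕ κ')) ⊕ (ι' ⊕ κ')) → N.carrier) =>
      Φ₄ N (v ∘ Sum.inl) (v ∘ Sum.inr)) := by
    refine (InG.defG.relabel Sum.inl).and ?_
    have := hΦ₂.subst (s := Sum.elim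
      (fun i N (v : (ι₁ ⊕ κ₁) ⊕ ((X₀ × (ι' ⊕ κ')) ⊕ (ι' ⊕ κ')) → N.carrier) =>
        tt N (v ∘ Sum.inl) (v ∘ Sum.inr) i) (fun i N v => v (Sum.inr i))) (by
        rintro (i | i)
        · refine TermL.toG ((ElemT.relabel (ht i)
            (Sum.elim Sum.inl (Sum.inr ∘ Sum.inl))).congr fun N v => ?_)
          refine congrArg (t i N) (funext fun j => ?_)
          rcases j with j | j <;> rfl
        · exact ElemT.var _)
    exact this
  obtain ⟨N', f, a', ha', -⟩ := exists_atpTree (N := N) hΦ₄ (J := Empty) (fun j => j.elim)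
    (fun j => j.elim) (fun k s => by
      obtain ⟨e, he, hk⟩ := hd k
      refine ⟨a₂ ∘ e, ⟨fun X hX hXk => ?_, fun η _ ν _ hne hp b h1 h2 => ?_⟩, fun η hη j => j.elim⟩
      · obtain ⟨b, hb⟩ := hk X hX hXk
        by_cases hemp : X.Nonempty
        · obtain ⟨η₀, hη₀⟩ := hemp
          obtain ⟨b₁, hb₁, hbt⟩ := hex N b A (hG _ _ _ (hb _ hη₀).1.2) (hb _ hη₀).2
          refine ⟨b₁, fun η hη => ⟨hb₁, ?_⟩⟩
          have : tt N b₁ ((a₂ ∘ e) η) = b := funext fun i => (hbt i).symm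
          rw [this]
          exact (hb η hη).1
        · exact ⟨fun _ => 0, fun η hη => absurd ⟨η, hη⟩ hemp⟩
      · exact ha₂.incons (e η) (e ν) (fun h => hne (he.injective h)) (he.mono hp) _ h1.2 h2.2)
  rcases hcard with hcard | ⟨hcard, hcard'⟩
  · exact ihp _ (hp ▸ hcard) _ rfl rfl hΦ₄ (fun N b y h => h.1) ha'
  · exact ihq _ (hq ▸ hcard') (hcard.trans hp) rfl hΦ₄ (fun N b y h => h.1) ha'

end GenTrees

section Patterns

variable {𝔽 : Type u} [Field 𝔽] {L' : FirstOrder.Language.{u, u}}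
variable {Rs : Subring 𝔽} {T : (fullLang 𝔽 L').Theory} {α β γ ι' κ' ι κ υ : Type}

/-- The concatenation of two tuples with a distinguished part. -/
def joinTuple {M : Type*} (b : ι ⊕ κ → M) (y : ι' ⊕ κ' → M) : (ι ⊕ ι') ⊕ (κ ⊕ κ') → M :=
  Sum.elim (Sum.elim (b ∘ Sum.inl) (y ∘ Sum.inl)) (Sum.elim (b ∘ Sum.inr) (y ∘ Sum.inr))

/-- A pattern of additive formulas. -/
def APat (FA : Finset (AddForm T Rs (κ ⊕ κ'))) (D : Set (AddForm T Rs (κ ⊕ κ')))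
    (N : TGMod Rs T) (b : κ → N.carrier) (y : κ' → N.carrier) : Prop :=
  ∀ θ ∈ FA, AHolds θ N (Sum.elim b y) ↔ θ ∈ D

theorem APat.defG [Finite κ] [Finite κ'] (FA : Finset (AddForm T Rs (κ ⊕ κ')))
    (D : Set (AddForm T Rs (κ ⊕ κ'))) :
    DefG (fun N (v : κ ⊕ κ' → N.carrier) => APat FA D N (v ∘ Sum.inl) (v ∘ Sum.inr)) := by
  refine Elem.forall_mem _ fun θ _ => ((AHolds.defG θ).iff (Elem.const (θ ∈ D))).congr fun N v => ?_
  rw [Sum.elim_comp_inl_inr]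

/-- A tree with generic solutions yields one whose solutions are described by an `L`-formula
and additive formulas. -/
theorem GenTree.exists_pattern [Fintype ι] [Fintype κ] [Fintype ι'] [Fintype κ']
    {Φ : ∀ N : TGMod Rs T, (ι ⊕ κ → N.carrier) → (ι' ⊕ κ' → N.carrier) → Prop}
    (hΦ : DefG (fun N (v : (ι ⊕ κ) ⊕ (ι' ⊕ κ') → N.carrier) => Φ N (v ∘ Sum.inl) (v ∘ Sum.inr)))
    {N : TGMod Rs T} {a : List Bool → ι' ⊕ κ' → N.carrier} (h : GenTree Φ N a) :
    ∃ (χ : ∀ N : TGMod Rs T, (ι ⊕ κ → N.carrier) → (ι' ⊕ κ' → N.carrier) → Prop)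
      (FA : Finset (AddForm T Rs (κ ⊕ κ'))) (D : Set (AddForm T Rs (κ ⊕ κ'))),
      DefL (fun N (v : (ι ⊕ κ) ⊕ (ι' ⊕ κ') → N.carrier) => χ N (v ∘ Sum.inl) (v ∘ Sum.inr)) ∧
      (∀ k, ∃ e, StrongEmb e ∧ ∀ X : Finset (List Bool), IsTreeAntichain (X : Set (List Bool)) →
        X ⊆ lev k → ∃ b, InG N b ∧
          GoodOver N (N.sp fun p : X × (ι' ⊕ κ') => a (e p.1) p.2) b ∧
          ∀ η ∈ X, χ N b (a (e η)) ∧ APat FA D N (b ∘ Sum.inr) (a (e η) ∘ Sum.inr)) ∧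
      ∀ (N' : TGMod Rs T) (f : Ext N N') (η ν : List Bool), η ≠ ν → η <+: ν → ∀ b, InG N' b →
        GoodOver N' (N'.sp (Sum.elim (fun i => f (a η i)) (fun i => f (a ν i)))) b →
        χ N' b (fun i => f (a η i)) → APat FA D N' (b ∘ Sum.inr) (fun i => f (a η (Sum.inr i))) →
        χ N' b (fun i => f (a ν i)) → APat FA D N' (b ∘ Sum.inr) (fun i => f (a ν (Sum.inr i))) →
        False := by
  classical
  let P : ∀ N : TGMod Rs T, ((ι ⊕ ι') ⊕ (κ ⊕ κ') → N.carrier) → Prop := fun N v =>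
    Φ N (Sum.elim (fun i => v (Sum.inl (Sum.inl i))) (fun i => v (Sum.inr (Sum.inl i))))
      (Sum.elim (fun i => v (Sum.inl (Sum.inr i))) (fun i => v (Sum.inr (Sum.inr i))))
  have hP : DefG P := by
    refine (hΦ.relabel (Sum.elim
      (Sum.elim (fun i => Sum.inl (Sum.inl i)) (fun i => Sum.inr (Sum.inl i)))
      (Sum.elim (fun i => Sum.inl (Sum.inr i)) (fun i => Sum.inr (Sum.inr i))))).congr
      fun N v => iff_of_eq ?_
    simp only [P]
    congr 1 <;> (funext i; rcases i with i | i <;> rfl)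
  have hPj : ∀ (N : TGMod Rs T) b y, P N (joinTuple b y) ↔ Φ N b y := by
    intro N b y
    refine iff_of_eq ?_
    simp only [P]
    congr 1 <;> (funext i; rcases i with i | i <;> rfl)
  obtain ⟨FL, FA, hF⟩ := exists_finite_types N hP
  let pat : (ι ⊕ κ → N.carrier) → (ι' ⊕ κ' → N.carrier) → Set FL × Set FA := fun b y =>
    ({φ | φ.1.Realize (joinTuple b y)},
      {θ | AHolds θ.1 N (Sum.elim (b ∘ Sum.inr) (y ∘ Sum.inr))})
  choose b hbG hbgood hbΦ using h.cons
  obtain ⟨⟨C, D⟩, hCD⟩ := exists_homogeneous_strongEmb fun X η =>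
    if hX : IsTreeAntichain (X : Set (List Bool)) then pat (b X hX) (a η) else (∅, ∅)
  let χ : ∀ N : TGMod Rs T, (ι ⊕ κ → N.carrier) → (ι' ⊕ κ' → N.carrier) → Prop :=
    fun N b y => ∀ φ ∈ FL, φ.Realize (joinTuple b y) ↔ φ ∈ Subtype.val '' C
  have hpat : ∀ b y, pat b y = (C, D) →
      χ N b y ∧ APat FA (Subtype.val '' D) N (b ∘ Sum.inr) (y ∘ Sum.inr) := by
    intro b y hp
    obtain ⟨rfl, rfl⟩ := Prod.mk.inj hp
    exact ⟨fun φ hφ => by simp [hφ], fun θ hθ => by simp [hθ]⟩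
  have hsol : ∀ k, ∃ e, StrongEmb e ∧ ∀ X : Finset (List Bool),
      IsTreeAntichain (X : Set (List Bool)) → X ⊆ lev k → ∃ b, InG N b ∧
        GoodOver N (N.sp fun p : X × (ι' ⊕ κ') => a (e p.1) p.2) b ∧
        (∀ η ∈ X, Φ N b (a (e η))) ∧
        ∀ η ∈ X, χ N b (a (e η)) ∧
          APat FA (Subtype.val '' D) N (b ∘ Sum.inr) (a (e η) ∘ Sum.inr) := by
    intro k
    obtain ⟨e, he, hA⟩ := hCD k
    refine ⟨e, he, fun X hX hk => ?_⟩
    obtain ⟨Y, hY, hXY, hcol⟩ := hA X hX hk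
    have hmem : ∀ η ∈ X, e η ∈ Y := fun η hη => hXY (Finset.mem_image_of_mem _ hη)
    refine ⟨b Y hY, hbG Y hY, (hbgood Y hY).mono (Submodule.span_mono ?_),
      fun η hη => hbΦ Y hY _ (hmem η hη), fun η hη => hpat _ _ ?_⟩
    · rintro _ ⟨p, rfl⟩
      exact ⟨(⟨e p.1, hmem _ p.1.2⟩, p.2), rfl⟩
    · have := hcol η hη
      rwa [dif_pos hY] at this
  refine ⟨χ, FA, Subtype.val '' D, ?_, fun k => ?_, ?_⟩
  · refine Elem.forall_mem _ fun φ _ => (((Elem.of φ).relabel (Sum.elim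
      (Sum.elim (fun i => Sum.inl (Sum.inl i)) (fun i => Sum.inr (Sum.inl i)))
      (Sum.elim (fun i => Sum.inl (Sum.inr i)) (fun i => Sum.inr (Sum.inr i))))).congr
      fun N v => iff_of_eq ?_).iff (Elem.const _)
    refine congrArg φ.Realize (funext fun i => ?_)
    rcases i with (i | i) | (i | i) <;> rfl
  · obtain ⟨e, he, hA⟩ := hsol k
    refine ⟨e, he, fun X hX hk => ?_⟩
    obtain ⟨b, h1, h2, -, h3⟩ := hA X hX hk
    exact ⟨b, h1, h2, h3⟩
  intro N' f η ν hne hp b₁ hb₁ hgood hχη hAη hχν hAν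
  obtain ⟨e, he, hA⟩ := hsol 0
  obtain ⟨b₀, h1, h2, h3, h4⟩ := hA {[]} (isTreeAntichain_singleton _) (by simp [mem_lev])
  specialize h3 [] (by simp)
  specialize h4 [] (by simp)
  have hg0 := Good.append (h.good (e [])) h1 (h2.mono (Submodule.span_mono (by
    rintro _ ⟨i, rfl⟩
    exact ⟨(⟨[], by simp⟩, i), rfl⟩)))
  have hg0' := hg0.map f
  have hcases : ∀ ζ, (ζ = η ∨ ζ = ν) → χ N' b₁ (fun i => f (a ζ i)) →
      APat FA (Subtype.val '' D) N' (b₁ ∘ Sum.inr) (fun i => f (a ζ (Sum.inr i))) →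
      Φ N' b₁ (fun i => f (a ζ i)) := by
    intro ζ hζ hχ hA
    have hg1 := Good.append ((h.good ζ).map f) hb₁ (hgood.mono (Submodule.span_mono (by
      rintro _ ⟨i, rfl⟩
      rcases hζ with rfl | rfl
      · exact ⟨Sum.inl i, rfl⟩
      · exact ⟨Sum.inr i, rfl⟩)))
    rw [← hPj]
    refine hF N' f _ _ hg0' hg1 (fun φ hφ => ?_) (fun θ hθ => ?_)
      ((f.defG_iff hP (joinTuple b₀ (a (e [])))).2 ((hPj _ _ _).2 h3))
    · refine ((f.defG_iff (DefL.toG (Elem.of φ)) (joinTuple b₀ (a (e [])))).trans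
        (h4.1 φ hφ)).trans (hχ φ hφ).symm
    · refine Iff.trans ?_ ((h4.2 θ hθ).trans (hA θ hθ).symm)
      refine Iff.trans ?_ (f.defG_iff (AHolds.defG θ)
        (Sum.elim (b₀ ∘ Sum.inr) (a (e []) ∘ Sum.inr)))
      exact iff_of_eq (congrArg (AHolds θ N') (funext fun i => by rcases i with i | i <;> rfl))
  have hD : DefG (fun (N : TGMod Rs T) (w : (ι' ⊕ κ') ⊕ (ι' ⊕ κ') → N.carrier) =>
      ∃ b, Φ N b (w ∘ Sum.inl) ∧ Φ N b (w ∘ Sum.inr)) :=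
    Elem.ex ((hΦ.relabel (Sum.elim Sum.inr (Sum.inl ∘ Sum.inl))).and
      (hΦ.relabel (Sum.elim Sum.inr (Sum.inl ∘ Sum.inr))))
  obtain ⟨b, h1, h2⟩ := (f.defG_iff hD (Sum.elim (a η) (a ν))).1
    ⟨b₁, hcases η (Or.inl rfl) hχη hAη, hcases ν (Or.inr rfl) hχν hAν⟩
  exact h.incons η ν hne hp b h1 h2

end Patterns

section CosetPatterns

variable {𝔽 : Type u} [Field 𝔽] {L' : FirstOrder.Language.{u, u}}
variable {Rs : Subring 𝔽} {T : (fullLang 𝔽 L').Theory} {α β γ ι' κ' ι κ υ : Type}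

theorem AddForm.isCoset (θ : AddForm T Rs (κ ⊕ κ')) (N : TGMod Rs T) :
    ∃ X : AddSubgroup (κ → ↥N.G),
      (∀ x, x ∈ X ↔ θ.1.Realize (Sum.elim x (0 : κ' → ↥N.G))) ∧
      ∀ h : κ' → ↥N.G, IsCoset X {z | θ.1.Realize (Sum.elim z h)} := by
  have h1 : AddR (T := T) fun (N : TGMod Rs T) (v : κ' ⊕ κ → ↥N.G) => θ.1.Realize (v ∘ Sum.swap) :=
    θ.2.subst fun b => ElemT.var (Sum.swap b)
  obtain ⟨X, hX, hC⟩ := h1.isCoset N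
  have key : ∀ (h : κ' → ↥N.G) (z : κ → ↥N.G), Sum.elim h z ∘ Sum.swap = Sum.elim z h :=
    fun h z => funext fun i => by rcases i with i | i <;> rfl
  simp only [key] at hX hC
  exact ⟨X, hX, hC⟩

/-- A coset of an additively definable group which contains an independent tuple contains,
up to translation, a nonzero element in each coordinate direction. -/
theorem exists_single_ne_zero [Fintype κ] [DecidableEq κ] [Fintype κ'] {N : TGMod Rs T}
    {g : κ → ↥N.G} {h : κ' → ↥N.G}
    (hg : IndepOver N (N.sp fun i => (h i : N.carrier)) (fun j => (g j : N.carrier)))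
    (F : Finset (AddForm T Rs (κ ⊕ κ'))) (hF : ∀ θ ∈ F, θ.1.Realize (Sum.elim g h)) (i₀ : κ) :
    ∃ x : ↥N.G, x ≠ 0 ∧ ∀ θ ∈ F, θ.1.Realize (Sum.elim (Pi.single i₀ x) (0 : κ' → ↥N.G)) := by
  have hnot : ∀ S : Submodule 𝔽 N.carrier, S ≤ N.sp (Sum.elim (fun i => (h i : N.carrier))
      (fun j : {j // j ≠ i₀} => (g j : N.carrier))) → (g i₀ : N.carrier) ∉ S := by
    intro S hS hmem
    rw [N.sp_elim] at hS
    obtain ⟨y, hy, z, hz, hyz⟩ := Submodule.mem_sup.1 (hS hmem)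
    obtain ⟨ν, rfl⟩ := (N.mem_sp_iff _).1 hz
    have := hg (fun j => if hj : j = i₀ then 1 else - ν ⟨j, hj⟩) (by
      rw [Fintype.sum_eq_add_sum_subtype_ne _ i₀]
      simp only [dite_true, one_smul]
      rw [Finset.sum_congr rfl (g := fun j : {j // j ≠ i₀} => - (ν j • (g j : N.carrier)))
        (fun j _ => by rw [dif_neg j.2, neg_smul]), Finset.sum_neg_distrib, ← hyz]
      simpa using hy)
    have := congrFun this i₀
    simp at this
  obtain ⟨N', f, d, hd, hds, -⟩ := (SameL.refl (N := N) (Empty.elim : Empty → N.carrier)).exists_divisible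
    (c := (g i₀ : N.carrier)) (by rw [N.sp_empty]; exact hnot _ bot_le) 0
    (Sum.elim (fun i => (h i : N.carrier)) (fun j => (g j : N.carrier)))
  obtain ⟨d', hd'G, hd'⟩ := hd 1 one_ne_zero
  obtain rfl : d' = d := by simpa using hd'
  let S : Submodule 𝔽 N'.carrier := N'.sp (fun a => f (Sum.elim (fun i => (h i : N.carrier))
      (fun j : {j // j ≠ i₀} => (g j : N.carrier)) a))
  have hsh := sameR_shear N' (S := S) (w := f.res (g i₀)) (d := ⟨d', hd'G⟩)
    (by
      rw [Ext.coe_res, Ext.mem_sp_iff]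
      exact hnot _ le_rfl) hd (by
      refine fun hmem => hds ((sup_le ?_ ?_ : S ⊔ _ ≤ _) hmem)
      · refine Submodule.span_mono ?_
        rintro _ ⟨i | j, rfl⟩
        · exact ⟨Sum.inl i, rfl⟩
        · exact ⟨Sum.inr j, rfl⟩
      · rw [Submodule.span_singleton_le_iff_mem, Ext.coe_res]
        exact Submodule.subset_span ⟨Sum.inr i₀, rfl⟩)
    (o := Sum.elim (fun i => f.res (h i)) (fun j : {j // j ≠ i₀} => f.res (g j))) (by
      rintro (i | j)
      · exact Submodule.subset_span ⟨Sum.inl i, by simp [Ext.coe_res]⟩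
      · exact Submodule.subset_span ⟨Sum.inr j, by simp [Ext.coe_res]⟩)
  have h2 := hsh.comp (Sum.elim (fun j : κ => if hj : j = i₀ then Sum.inr ()
    else Sum.inl (Sum.inr ⟨j, hj⟩)) (fun i : κ' => Sum.inl (Sum.inl i)))
  have hQ : DefR (fun (N : TGMod Rs T) (_ : Empty → ↥N.G) => ∃ w : Unit → ↥N.G, w () ≠ 0 ∧
      ∀ θ ∈ F, θ.1.Realize (Sum.elim (Pi.single i₀ (w ())) (0 : κ' → ↥N.G))) := by
    refine Elem.ex (P := fun (N : TGMod Rs T) (_ : Empty → ↥N.G) (w : Unit → ↥N.G) => w () ≠ 0 ∧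
      ∀ θ ∈ F, θ.1.Realize (Sum.elim (Pi.single i₀ (w ())) (0 : κ' → ↥N.G))) ?_
    refine ((Elem.eq (ElemT.var (Sum.inr ())) TermR.zero).not).and
      (Elem.forall_mem _ fun θ _ => ?_)
    refine ((Elem.of θ.1).subst (s := Sum.elim
      (fun j N v => if j = i₀ then v (Sum.inr ()) else 0) (fun i N v => 0)) ?_).congr
      fun N v => iff_of_eq (congrArg θ.1.Realize (funext fun i => ?_))
    · rintro (j | i)
      · by_cases hj : j = i₀
        · simp only [hj, Sum.elim_inl, if_true]; exact ElemT.var _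
        · simp only [hj, Sum.elim_inl, if_false]; exact TermR.zero
      · exact TermR.zero
    · rcases i with j | i
      · simp [Pi.single_apply]
      · rfl
  have hres : ∀ v : Empty → ↥N'.G, ∃ w : Unit → ↥N'.G, w () ≠ 0 ∧
      ∀ θ ∈ F, θ.1.Realize (Sum.elim (Pi.single i₀ (w ())) (0 : κ' → ↥N'.G)) := by
    refine fun _ => ⟨fun _ => ⟨d', hd'G⟩, fun h0 => hds ?_, fun θ hθ => ?_⟩
    · rw [show d' = 0 from congrArg Subtype.val h0]; exact zero_mem _
    obtain ⟨X, hX, hC⟩ := θ.isCoset N'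
    have h3 := (h2.iff (Elem.of θ.1)).1 (by
      have := (f.defR_iff (Elem.of θ.1) _).2 (hF θ hθ)
      convert this using 1
      funext i
      rcases i with j | i
      · by_cases hj : j = i₀
        · subst hj; simp
        · simp [hj]
      · rfl)
    have h4 := (f.defR_iff (Elem.of θ.1) _).2 (hF θ hθ)
    have h5 : (fun j => f.res (g j)) ∈ {z | θ.1.Realize (Sum.elim z fun i => f.res (h i))} := by
      show θ.1.Realize _
      convert h4 using 1
      funext i
      rcases i with j | i <;> rfl
    have h6 : ((fun j => f.res (g j)) + Pi.single i₀ ⟨d', hd'G⟩ : κ → ↥N'.G) ∈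
        {z | θ.1.Realize (Sum.elim z fun i => f.res (h i))} := by
      show θ.1.Realize _
      convert h3 using 1
      funext i
      rcases i with j | i
      · by_cases hj : j = i₀
        · subst hj; simp
        · simp [hj]
      · rfl
    have := (hC _ _ h5 _).1 h6
    rw [add_sub_cancel_left] at this
    exact (hX _).1 this
  obtain ⟨w, hw, hw'⟩ := (f.defR_iff hQ Empty.elim).1 (hres fun i => i.elim)
  exact ⟨w (), hw, hw'⟩

theorem relIndex_eq_zero_of_sum_eq_zero [CharZero 𝔽] [Fintype κ] [Fintype κ'] {N : TGMod Rs T}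
    {g : κ → ↥N.G} {h : κ' → ↥N.G}
    (hg : IndepOver N (N.sp fun i => (h i : N.carrier)) (fun j => (g j : N.carrier)))
    (F : Finset (AddForm T Rs (κ ⊕ κ'))) (hF : ∀ θ ∈ F, θ.1.Realize (Sum.elim g h))
    {Z Y : AddSubgroup (κ → ↥N.G)}
    (hZ : ∀ z, z ∈ Z ↔ ∀ θ ∈ F, θ.1.Realize (Sum.elim z (0 : κ' → ↥N.G)))
    {m : κ → 𝔽} (hm : m ≠ 0) (hY : ∀ z ∈ Y, ∑ j, m j • (z j : N.carrier) = 0) :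
    Y.relIndex Z = 0 := by
  classical
  by_contra hne
  obtain ⟨i₀, hi₀⟩ := Function.ne_iff.1 hm
  obtain ⟨x, hx, hxF⟩ := exists_single_ne_zero hg F hF i₀
  obtain ⟨n, hn, -, hnm⟩ := AddSubgroup.exists_nsmul_mem_of_relIndex_ne_zero hne ((hZ _).2 hxF)
  have h1 := hY _ hnm.1
  rw [Finset.sum_eq_single i₀ (fun j _ hj => by simp [hj]) (by simp)] at h1
  have hn' : (n : 𝔽) ≠ 0 := Nat.cast_ne_zero.2 hn.ne'
  have h2 : m i₀ • (n : 𝔽) • (x : N.carrier) = 0 := by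
    rw [Nat.cast_smul_eq_nsmul]
    simpa using h1
  rw [smul_eq_zero, smul_eq_zero] at h2
  rcases h2 with h2 | h2 | h2
  · exact hi₀ h2
  · exact hn' h2
  · exact hx (Subtype.ext h2)

/-- A finite index subgroup contained in all members of a finite family which have finite
index. -/
theorem exists_relIndex_ne_zero_le {A I : Type*} [AddCommGroup A] [Finite I] (Z : AddSubgroup A)
    (X : I → AddSubgroup A) : ∃ H ≤ Z, H.relIndex Z ≠ 0 ∧
      ∀ i, (X i).relIndex Z ≠ 0 → H ≤ X i := by
  refine ⟨Z ⊓ ⨅ i : {i // (X i).relIndex Z ≠ 0}, X i, inf_le_left, ?_, fun i hi =>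
    inf_le_right.trans (iInf_le (fun i : {i // (X i).relIndex Z ≠ 0} => X i) ⟨i, hi⟩)⟩
  rw [AddSubgroup.inf_relIndex_left]
  exact AddSubgroup.relIndex_iInf_ne_zero fun i => i.2

/-- Two congruent realizations of an additive pattern yield a common generic realization. -/
theorem APat.exists_indep [Fintype κ] [Fintype κ'] [Fintype υ] {N : TGMod Rs T}
    {FA : Finset (AddForm T Rs (κ ⊕ κ'))} {D : Set (AddForm T Rs (κ ⊕ κ'))}
    {Z H : AddSubgroup (κ → ↥N.G)} {X : AddForm T Rs (κ ⊕ κ') → AddSubgroup (κ → ↥N.G)}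
    (hZ : ∀ z, z ∈ Z ↔ ∀ θ ∈ FA, θ ∈ D → θ.1.Realize (Sum.elim z (0 : κ' → ↥N.G)))
    (hX : ∀ θ (h : κ' → ↥N.G), IsCoset (X θ) {z | θ.1.Realize (Sum.elim z h)})
    (hX0 : ∀ θ x, x ∈ X θ ↔ θ.1.Realize (Sum.elim x (0 : κ' → ↥N.G)))
    (hHZ : H ≤ Z) (hH : H.relIndex Z ≠ 0)
    (hHX : ∀ θ ∈ FA, (X θ).relIndex Z ≠ 0 → H ≤ X θ)
    (hY : ∀ (m : κ → 𝔽) (Y : AddSubgroup (κ → ↥N.G)), m ≠ 0 →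
      (∀ z ∈ Y, ∑ j, m j • (z j : N.carrier) = 0) → Y.relIndex Z = 0)
    {g₁ g₂ : κ → ↥N.G} {h₁ h₂ : κ' → ↥N.G}
    (hg₁ : APat FA D N (fun j => g₁ j) (fun i => h₁ i))
    (hg₂ : APat FA D N (fun j => g₂ j) (fun i => h₂ i)) (hsub : g₁ - g₂ ∈ H) (A : υ → N.carrier) :
    ∃ (N' : TGMod Rs T) (f : Ext N N') (g : κ → ↥N'.G),
      IndepOver N' (N'.sp fun a => f (A a)) (fun j => (g j : N'.carrier)) ∧
      APat FA D N' (fun j => g j) (fun i => f (h₁ i)) ∧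
      APat FA D N' (fun j => g j) (fun i => f (h₂ i)) := by
  classical
  have hpat : ∀ (z : κ → ↥N.G) (h : κ' → ↥N.G), APat FA D N (fun j => z j) (fun i => h i) ↔
      ∀ θ ∈ FA, θ.1.Realize (Sum.elim z h) ↔ θ ∈ D := by
    intro z h
    refine forall₂_congr fun θ _ => iff_congr ?_ Iff.rfl
    rw [aHolds_iff θ (by rintro (j | i); exacts [(z j).2, (h i).2])]
    exact iff_of_eq (congrArg θ.1.Realize (funext fun i => by rcases i with i | i <;> rfl))
  rw [hpat] at hg₁ hg₂
  let Q : Option {p : (κ → 𝔽) × (υ → 𝔽) // p.1 ≠ 0} → ∀ N : TGMod Rs T,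
      ((υ ⊕ (κ' ⊕ κ')) ⊕ κ → N.carrier) → Prop := fun p N v =>
    p.elim ((∀ j, v (Sum.inr j) ∈ N.G) ∧
      APat FA D N (fun j => v (Sum.inr j)) (fun i => v (Sum.inl (Sum.inr (Sum.inl i)))) ∧
      APat FA D N (fun j => v (Sum.inr j)) (fun i => v (Sum.inl (Sum.inr (Sum.inr i)))))
    (fun p => ∑ j, p.1.1 j • v (Sum.inr j) ≠ ∑ k, p.1.2 k • v (Sum.inl (Sum.inl k)))
  obtain ⟨N', f, g, hg⟩ := exists_ext N (Sum.elim A (Sum.elim (fun i => (h₁ i : N.carrier))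
      (fun i => (h₂ i : N.carrier)))) Q (by
    rintro (_ | p)
    · exact (Elem.forall_fin fun j => DefG.memG (ElemT.var (Sum.inr j))).and
        (((APat.defG FA D).relabel (Sum.elim Sum.inr (fun i => Sum.inl (Sum.inr (Sum.inl i))))).and
        ((APat.defG FA D).relabel (Sum.elim Sum.inr (fun i => Sum.inl (Sum.inr (Sum.inr i))))))
    · exact DefL.toG (Elem.eq (TermL.sum _ fun j => TermL.smul _ (ElemT.var _))
        (TermL.sum _ fun j => TermL.smul _ (ElemT.var _))).not) (fun s => by
    let I := ({θ // θ ∈ FA ∧ θ ∉ D} × Bool) ⊕ {p // some p ∈ s}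
    have : Finite {p // some p ∈ s} := Finite.of_injective (β := s) (fun d => ⟨some d.1, d.2⟩)
      fun d d' h => by simpa [Subtype.ext_iff] using h
    have : Finite {θ // θ ∈ FA ∧ θ ∉ D} := Finite.of_injective (β := FA) (fun d => ⟨d.1, d.2.1⟩)
      fun d d' h => by simpa [Subtype.ext_iff] using h
    let hh : Bool → κ' → ↥N.G := fun b => if b then h₁ else h₂
    let Y : (κ → 𝔽) → AddSubgroup (κ → ↥N.G) := fun m =>
      (AddMonoidHom.mk' (fun z : κ → ↥N.G => ∑ j, m j • (z j : N.carrier)) fun z w => by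
        simp [smul_add, Finset.sum_add_distrib]).ker
    have hYmem : ∀ m z, z ∈ Y m ↔ ∑ j, m j • (z j : N.carrier) = 0 := fun m z => Iff.rfl
    let XX : I → AddSubgroup (κ → ↥N.G) := Sum.elim (fun i => X i.1.1) (fun p => Y p.1.1.1)
    let C : I → Set (κ → ↥N.G) := Sum.elim (fun i => {z | i.1.1.1.Realize (Sum.elim z (hh i.2))})
      (fun p => {z | ∑ j, p.1.1.1 j • (z j : N.carrier) = ∑ k, p.1.1.2 k • A k})
    have hC : ∀ i, IsCoset (XX i) (C i) := by
      rintro (⟨θ, b⟩ | p)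
      · exact hX θ.1 _
      · intro z hz y
        show _ = _ ↔ y - z ∈ Y _
        rw [hYmem, ← sub_eq_zero, ← show _ = _ from hz, ← Finset.sum_sub_distrib]
        simp [smul_sub]
    obtain ⟨z, hz, hav⟩ : ∃ z ∈ H, ∀ i, g₁ + z ∉ C i := by
      by_contra! hcov
      obtain ⟨i, hi, hmem⟩ := IsCoset.exists_relIndex_ne_zero hC H g₁ hcov 0 H.zero_mem
      rw [add_zero] at hmem
      have hi' := AddSubgroup.relIndex_ne_zero_trans hi hH
      rcases i with ⟨θ, b⟩ | p
      · cases b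
        · have h2 : g₂ ∈ {z | θ.1.1.Realize (Sum.elim z h₂)} := (hX θ.1 h₂ _ hmem g₂).2
            (neg_sub g₁ g₂ ▸ (X θ.1).neg_mem (hHX _ θ.2.1 hi' hsub))
          exact θ.2.2 ((hg₂ _ θ.2.1).1 h2)
        · exact θ.2.2 ((hg₁ _ θ.2.1).1 hmem)
      · exact hi' (hY p.1.1.1 _ p.1.2 fun z hz => hz)
    have hin : ∀ b, ∀ θ ∈ FA, θ ∈ D → θ.1.Realize (Sum.elim (g₁ + z) (hh b)) := by
      intro b θ hθ hD
      obtain ⟨g', hg', hg'z⟩ : ∃ g', θ.1.Realize (Sum.elim g' (hh b)) ∧ g₁ + z - g' ∈ Z := by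
        cases b
        · refine ⟨g₂, (hg₂ θ hθ).2 hD, hHZ ?_⟩
          rw [add_sub_right_comm]
          exact H.add_mem hsub hz
        · exact ⟨g₁, (hg₁ θ hθ).2 hD, hHZ (by rwa [add_sub_cancel_left])⟩
      exact (hX θ (hh b) g' hg' _).2 ((hX0 _ _).2 ((hZ _).1 hg'z θ hθ hD))
    have hall : ∀ b, ∀ θ ∈ FA, θ.1.Realize (Sum.elim (g₁ + z) (hh b)) ↔ θ ∈ D := fun b θ hθ =>
      ⟨fun h => by
        by_contra hD
        exact hav (Sum.inl (⟨θ, hθ, hD⟩, b)) h, hin b θ hθ⟩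
    refine ⟨fun j => ((g₁ + z) j : ↥N.G), ?_⟩
    rintro (_ | p) hp
    · exact ⟨fun j => ((g₁ + z) j).2, (hpat _ _).2 (hall true), (hpat _ _).2 (hall false)⟩
    · exact hav (Sum.inr ⟨p, hp⟩))
  obtain ⟨hgG, hp1, hp2⟩ := hg none
  refine ⟨N', f, fun j => ⟨g j, hgG j⟩, fun m hm => ?_, hp1, hp2⟩
  by_contra hne
  obtain ⟨ν, hν⟩ := (N'.mem_sp_iff _).1 hm
  exact hg (some ⟨(m, ν), hne⟩) hν

end CosetPatterns

section RemovePatterns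

variable {𝔽 : Type u} [Field 𝔽] {L' : FirstOrder.Language.{u, u}}
variable {Rs : Subring 𝔽} {T : (fullLang 𝔽 L').Theory} {α β γ ι' κ' ι κ υ : Type}

/-- A tuple in an extension has a copy in an extension of any other extension. -/
theorem Ext.exists_copy [Finite α] {N N' N'' : TGMod Rs T} (f : Ext N N') (f' : Ext N N'')
    (A : υ → N.carrier) (e : α → N'.carrier) :
    ∃ (N₃ : TGMod Rs T) (f₃ : Ext N'' N₃) (v : α → N₃.carrier),
      ∀ P : ∀ N : TGMod Rs T, (υ ⊕ α → N.carrier) → Prop, DefG P →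
        P N' (Sum.elim (fun a => f (A a)) e) → P N₃ (Sum.elim (fun a => f₃ (f' (A a))) v) := by
  let J := {φ : (genLang 𝔽 L' ↥Rs).Formula (υ ⊕ α) // φ.Realize (Sum.elim (fun a => f (A a)) e)}
  obtain ⟨N₃, f₃, v, hv⟩ := exists_ext N'' (fun a => f' (A a)) (J := J)
    (fun φ N v => φ.1.Realize v) (fun φ => Elem.of φ.1) (fun s => by
      have hD : DefG (fun (N : TGMod Rs T) (w : υ → N.carrier) =>
          ∃ v : α → N.carrier, ∀ φ ∈ s, φ.1.Realize (Sum.elim w v)) :=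
        Elem.ex ((Elem.forall_mem s fun φ _ => Elem.of φ.1).congr fun N v => by
          rw [show Sum.elim (v ∘ Sum.inl) (v ∘ Sum.inr) = v from Sum.elim_comp_inl_inr v])
      exact (f'.defG_iff hD A).2 ((f.defG_iff hD A).1 ⟨e, fun φ _ => φ.2⟩))
  refine ⟨N₃, f₃, v, fun P hP h => ?_⟩
  obtain ⟨φ, hφ⟩ := hP
  rw [hφ] at h ⊢
  exact hv ⟨φ, h⟩

theorem indepOver_iff_forall_ne [Fintype κ] [Fintype υ] {N : TGMod Rs T} {A : υ → N.carrier}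
    {c : κ → N.carrier} : IndepOver N (N.sp A) c ↔
      ∀ (m : κ → 𝔽) (ν : υ → 𝔽), m ≠ 0 → ∑ j, m j • c j ≠ ∑ k, ν k • A k := by
  constructor
  · exact fun h m ν hm heq => hm (h m ((N.mem_sp_iff A).2 ⟨ν, heq⟩))
  · intro h m hm
    by_contra hne
    obtain ⟨ν, hν⟩ := (N.mem_sp_iff A).1 hm
    exact h m ν hne hν

/-- The additive patterns can be removed from a tree with generic solutions, at the cost of
restricting to finite levels. -/
theorem exists_subtree_without_pattern [CharZero 𝔽] [Fintype ι] [Fintype κ] [Fintype ι']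
    [Fintype κ'] {χ : ∀ N : TGMod Rs T, (ι ⊕ κ → N.carrier) → (ι' ⊕ κ' → N.carrier) → Prop}
    {FA : Finset (AddForm T Rs (κ ⊕ κ'))} {D : Set (AddForm T Rs (κ ⊕ κ'))}
    (hχ : DefL (fun N (v : (ι ⊕ κ) ⊕ (ι' ⊕ κ') → N.carrier) => χ N (v ∘ Sum.inl) (v ∘ Sum.inr)))
    {N : TGMod Rs T} {a : List Bool → ι' ⊕ κ' → N.carrier} (haG : ∀ η, InG N (a η))
    (hsol : ∀ k, ∃ e, StrongEmb e ∧ ∀ X : Finset (List Bool),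
      IsTreeAntichain (X : Set (List Bool)) → X ⊆ lev k → ∃ b, InG N b ∧
        GoodOver N (N.sp fun p : X × (ι' ⊕ κ') => a (e p.1) p.2) b ∧
        ∀ η ∈ X, χ N b (a (e η)) ∧ APat FA D N (b ∘ Sum.inr) (a (e η) ∘ Sum.inr))
    (hin : ∀ (N' : TGMod Rs T) (f : Ext N N') (η ν : List Bool), η ≠ ν → η <+: ν → ∀ b, InG N' b →
        GoodOver N' (N'.sp (Sum.elim (fun i => f (a η i)) (fun i => f (a ν i)))) b →
        χ N' b (fun i => f (a η i)) → APat FA D N' (b ∘ Sum.inr) (fun i => f (a η (Sum.inr i))) →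
        χ N' b (fun i => f (a ν i)) → APat FA D N' (b ∘ Sum.inr) (fun i => f (a ν (Sum.inr i))) →
        False) (k : ℕ) :
    ∃ e, StrongEmb e ∧ (∀ X : Finset (List Bool), IsTreeAntichain (X : Set (List Bool)) →
        X ⊆ lev k → ∃ b, IndepOver N (N.sp fun p : X × (ι' ⊕ κ') => a (e p.1) p.2) b ∧
          ∀ η ∈ X, χ N b (a (e η))) ∧
      ∀ η ∈ lev k, ∀ ν ∈ lev k, η ≠ ν → η <+: ν → ∀ (N' : TGMod Rs T) (f : Ext N N') b,
        IndepOver N' (N'.sp (Sum.elim (fun i => f (a (e η) i)) (fun i => f (a (e ν) i)))) b →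
        χ N' b (fun i => f (a (e η) i)) → χ N' b (fun i => f (a (e ν) i)) → False := by
  classical
  let h : List Bool → κ' → ↥N.G := fun η i => ⟨a η (Sum.inr i), haG η i⟩
  choose X hX0 hX using fun θ : AddForm T Rs (κ ⊕ κ') => θ.isCoset N
  let Z : AddSubgroup (κ → ↥N.G) := ⨅ θ : {θ // θ ∈ FA ∧ θ ∈ D}, X θ
  have hZX : ∀ z, z ∈ Z ↔ ∀ θ ∈ FA, θ ∈ D → z ∈ X θ := fun z => by
    rw [AddSubgroup.mem_iInf]
    exact ⟨fun h θ h1 h2 => h ⟨θ, h1, h2⟩, fun h θ => h _ θ.2.1 θ.2.2⟩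
  have hZ : ∀ z, z ∈ Z ↔ ∀ θ ∈ FA, θ ∈ D → θ.1.Realize (Sum.elim z (0 : κ' → ↥N.G)) := fun z =>
    (hZX z).trans (forall₃_congr fun θ _ _ => hX0 θ z)
  obtain ⟨H, hHZ, hH, hHX⟩ := exists_relIndex_ne_zero_le Z (fun θ : FA => X θ)
  have : (H.addSubgroupOf Z).FiniteIndex := ⟨hH⟩
  obtain ⟨K, hK⟩ := exists_mono_strongEmb (κ := ↥Z ⧸ H.addSubgroupOf Z) k
  obtain ⟨e, he, hA⟩ := hsol (K + 1)
  have hz : ∀ s : List Bool, ∃ z : κ → ↥N.G, s.length ≤ K →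
      APat FA D N (fun j => z j) (fun i => h (e [false]) i) ∧
      APat FA D N (fun j => z j) (fun i => h (e (true :: s)) i) ∧
      IndepOver N (N.sp fun i => (h (e [false]) i : N.carrier)) (fun j => (z j : N.carrier)) := by
    intro s
    by_cases hs : s.length ≤ K
    · obtain ⟨b, hbG, hb, hbA⟩ := hA {[false], true :: s} (by
        intro x hx y hy hne
        simp only [Finset.coe_insert, Finset.coe_singleton, Set.mem_insert_iff,
          Set.mem_singleton_iff] at hx hy
        rcases hx with rfl | rfl <;> rcases hy with rfl | rfl <;>
          simp [TreeComparable] at hne ⊢) (by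
        intro x hx
        simp only [Finset.mem_insert, Finset.mem_singleton] at hx
        rcases hx with rfl | rfl <;> simp [mem_lev, hs])
      refine ⟨fun j => ⟨b (Sum.inr j), hbG j⟩, fun _ => ⟨(hbA [false] (by simp)).2,
        (hbA (true :: s) (by simp)).2, fun m hm => hb.2 m (Submodule.span_mono ?_ hm)⟩⟩
      rintro _ ⟨i, rfl⟩
      exact ⟨(⟨[false], by simp⟩, Sum.inr i), rfl⟩
    · exact ⟨0, fun h => absurd h hs⟩
  choose z hz using hz
  have hreal : ∀ s : List Bool, s.length ≤ K → ∀ θ ∈ FA, θ ∈ D →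
      θ.1.Realize (Sum.elim (z s) (h (e [false]))) := by
    intro s hs θ hθ hD
    have := ((hz s hs).1 θ hθ).2 hD
    rw [aHolds_iff θ (by rintro (j | i); exacts [(z s j).2, (h _ i).2])] at this
    convert this using 1
    funext i
    rcases i with i | i <;> rfl
  have hzZ : ∀ s : List Bool, s.length ≤ K → z s - z [] ∈ Z := fun s hs =>
    (hZX _).2 fun θ hθ hD => (hX θ (h (e [false])) (z []) (hreal [] (by simp) θ hθ hD) (z s)).1
      (hreal s hs θ hθ hD)
  have hY : ∀ (m : κ → 𝔽) (Y : AddSubgroup (κ → ↥N.G)), m ≠ 0 →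
      (∀ z ∈ Y, ∑ j, m j • (z j : N.carrier) = 0) → Y.relIndex Z = 0 := fun m Y hm hY =>
    relIndex_eq_zero_of_sum_eq_zero (hz [] (by simp)).2.2 (FA.filter (· ∈ D))
      (fun θ hθ => hreal [] (by simp) θ (Finset.mem_filter.1 hθ).1 (Finset.mem_filter.1 hθ).2)
      (fun z => (hZ z).trans ⟨fun h θ hθ => h θ (Finset.mem_filter.1 hθ).1 (Finset.mem_filter.1 hθ).2,
        fun h θ h1 h2 => h θ (Finset.mem_filter.2 ⟨h1, h2⟩)⟩) hm hY
  obtain ⟨e₁, he₁, hlen, q, hq⟩ := hK fun s => if hs : s.length ≤ K then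
    QuotientAddGroup.mk (⟨z s - z [], hzZ s hs⟩ : ↥Z) else 0
  have hzH : ∀ η ∈ lev k, ∀ ν ∈ lev k, z (e₁ η) - z (e₁ ν) ∈ H := by
    intro η hη ν hν
    have h1 := (hq ν (mem_lev.1 hν)).trans (hq η (mem_lev.1 hη)).symm
    rw [dif_pos (hlen _ (mem_lev.1 hη)), dif_pos (hlen _ (mem_lev.1 hν)), QuotientAddGroup.eq,
      AddSubgroup.mem_addSubgroupOf] at h1
    convert h1 using 1
    simp
  have hee : StrongEmb (fun s => e (true :: e₁ s)) := he.comp ((strongEmb_cons true).comp he₁)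
  refine ⟨fun s => e (true :: e₁ s), hee, fun Y hYa hYk => ?_,
    fun η hη ν hν hne hp N' f b hb hb1 hb2 => ?_⟩
  · obtain ⟨b, hbG, hb, hbA⟩ := hA (Y.image fun s => true :: e₁ s)
      (((strongEmb_cons true).comp he₁).antichain hYa) (by
        intro s hs
        obtain ⟨t, ht, rfl⟩ := Finset.mem_image.1 hs
        have := hlen t (mem_lev.1 (hYk ht))
        simpa [mem_lev] using this)
    refine ⟨b, fun m hm => hb.eq_zero hbG (Submodule.span_mono ?_ hm),
      fun η hη => (hbA _ (Finset.mem_image_of_mem _ hη)).1⟩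
    rintro _ ⟨p, rfl⟩
    exact ⟨(⟨_, Finset.mem_image_of_mem _ p.1.2⟩, p.2), rfl⟩
  obtain ⟨N₂, f₂, g, hg, hg1, hg2⟩ := APat.exists_indep hZ hX hX0 hHZ hH
    (fun θ hθ => hHX ⟨θ, hθ⟩) hY (hz (e₁ η) (hlen _ (mem_lev.1 hη))).2.1
    (hz (e₁ ν) (hlen _ (mem_lev.1 hν))).2.1 (hzH η hη ν hν)
    (Sum.elim (fun i => (h (e (true :: e₁ η)) i : N.carrier)) (fun i => h (e (true :: e₁ ν)) i))
  let A : (ι' ⊕ κ') ⊕ (ι' ⊕ κ') → N.carrier := Sum.elim (a (e (true :: e₁ η))) (a (e (true :: e₁ ν)))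
  obtain ⟨N₃, f₃, v, hv⟩ := f.exists_copy f₂ A b
  have hvind : IndepOver N₃ (N₃.sp fun i => f₃ (f₂ (A i))) v := by
    rw [indepOver_iff_forall_ne]
    intro m ν' hm
    refine hv (fun N w => ∑ j, m j • w (Sum.inr j) ≠ ∑ k, ν' k • w (Sum.inl k)) ?_ ?_
    · exact DefL.toG (Elem.eq (TermL.sum _ fun j => TermL.smul _ (ElemT.var _))
        (TermL.sum _ fun j => TermL.smul _ (ElemT.var _))).not
    · rw [show Sum.elim (fun i => f (a (e (true :: e₁ η)) i))
        (fun i => f (a (e (true :: e₁ ν)) i)) = fun i => f (A i) from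
          funext (by rintro (i | i) <;> rfl)] at hb
      exact indepOver_iff_forall_ne.1 hb m ν' hm
  have hv1 : χ N₃ v (fun i => f₃ (f₂ (a (e (true :: e₁ η)) i))) :=
    hv (fun N w => χ N (fun i => w (Sum.inr i)) (fun i => w (Sum.inl (Sum.inl i))))
      (DefL.toG (hχ.relabel (Sum.elim Sum.inr (fun i => Sum.inl (Sum.inl i))))) hb1
  have hv2 : χ N₃ v (fun i => f₃ (f₂ (a (e (true :: e₁ ν)) i))) :=
    hv (fun N w => χ N (fun i => w (Sum.inr i)) (fun i => w (Sum.inl (Sum.inr i))))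
      (DefL.toG (hχ.relabel (Sum.elim Sum.inr (fun i => Sum.inl (Sum.inr i))))) hb2
  let hh : κ' ⊕ κ' → ↥N.G := Sum.elim (h (e (true :: e₁ η))) (h (e (true :: e₁ ν)))
  obtain ⟨N₄, f₄, b', hb'G, hL, hR, hgood⟩ := (SameL.refl (fun i => f₃ (f₂ (A i)))).exists_realize
    hvind (SameR.refl (fun i => f₃.res (f₂.res (hh i)))) (g := fun j => f₃.res (g j)) (by
      have h0 := hg.map f₃
      rwa [show (fun a => f₃ (f₂ (Sum.elim (fun i => (h (e (true :: e₁ η)) i : N.carrier))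
        (fun i => h (e (true :: e₁ ν)) i) a))) = fun a => ((f₃.res (f₂.res (hh a)) : ↥N₃.G) :
          N₃.carrier) from funext (by rintro (i | i) <;> rfl)] at h0)
  have hpatG : ∀ (p : κ' → κ' ⊕ κ'), APat FA D N₂ (fun j => g j) (fun i => f₂ (hh (p i))) →
      APat FA D N₄ (b' ∘ Sum.inr) (fun i => f₄ (f₃ (f₂ (hh (p i))))) := by
    intro p hp θ hθ
    rw [← hp θ hθ]
    have h1 := (f₃.trans f₄).defG_iff (AHolds.defG θ)
      (Sum.elim (fun j => (g j : N₂.carrier)) (fun i => f₂ (hh (p i))))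
    rw [← h1]
    have h2 := (hR.comp (Sum.elim Sum.inr (fun i => Sum.inl (p i)))) θ.1
    rw [aHolds_iff θ (by
        rintro (j | i)
        · exact hb'G j
        · exact (f₄.res (f₃.res (f₂.res (hh (p i))))).2), aHolds_iff θ (by
        rintro (j | i)
        · exact (f₄.res (f₃.res (g j))).2
        · exact (f₄.res (f₃.res (f₂.res (hh (p i))))).2)]
    convert h2.symm using 2
    · funext i; rcases i with i | i <;> rfl
    · funext i; rcases i with i | i <;> rfl
  have hchi : ∀ p : ι' ⊕ κ' → (ι' ⊕ κ') ⊕ (ι' ⊕ κ'), χ N₃ v (fun i => f₃ (f₂ (A (p i)))) →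
      χ N₄ b' (fun i => f₄ (f₃ (f₂ (A (p i))))) := by
    intro p hp
    refine (hL.iff (P := fun N w => χ N (fun i => w (Sum.inr i)) (fun i => w (Sum.inl (p i))))
      (hχ.relabel (Sum.elim Sum.inr (fun i => Sum.inl (p i))))).1 ?_
    exact (f₄.defG_iff (DefL.toG hχ) (Sum.elim v (fun i => f₃ (f₂ (A (p i)))))).2 hp
  refine hin N₄ ((f₂.trans f₃).trans f₄) (e (true :: e₁ η)) (e (true :: e₁ ν))
    (fun heq => hne (hee.injective heq)) (hee.mono hp) b' hb'G ?_ (hchi Sum.inl hv1)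
    (hpatG Sum.inl hg1) (hchi Sum.inr hv2) (hpatG Sum.inr hg2)
  convert hgood using 2
  funext i
  rcases i with i | i <;> rfl

end RemovePatterns

section GenericVariables

variable {𝔽 : Type u} [Field 𝔽] {L' : FirstOrder.Language.{u, u}}
variable {Rs : Subring 𝔽} {T : (fullLang 𝔽 L').Theory} {α β γ ι' κ' ι κ υ μ : Type}

/-- A tree of height `k` whose antichains have solutions with the variables in `ι` generic, and
whose chains do not. -/
structure LTree [Fintype ι] (k : ℕ)
    (χ : ∀ N : TGMod Rs T, (ι → N.carrier) → (μ → N.carrier) → (β → N.carrier) → Prop)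
    (N : TGMod Rs T) (a : List Bool → β → N.carrier) : Prop where
  cons : ∀ X : Finset (List Bool), IsTreeAntichain (X : Set (List Bool)) → X ⊆ lev k →
    ∃ b u, IndepOver N (N.sp fun p : X × β => a p.1 p.2) b ∧ ∀ η ∈ X, χ N b u (a η)
  incons : ∀ η ∈ lev k, ∀ ν ∈ lev k, η ≠ ν → η <+: ν → ∀ (N' : TGMod Rs T) (f : Ext N N') b u,
    IndepOver N' (N'.sp (Sum.elim (fun i => f (a η i)) (fun i => f (a ν i)))) b →
      χ N' b u (fun i => f (a η i)) → χ N' b u (fun i => f (a ν i)) → False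

theorem exists_ext_notMem [Fintype β] {P : ∀ N : TGMod Rs T, (β → N.carrier) → N.carrier → Prop}
    (hP : DefL1 P) (N : TGMod Rs T) (e : β → N.carrier) (h : {y | P N e y}.Infinite) :
    ∃ (N' : TGMod Rs T) (f : Ext N N') (x : N'.carrier), P N' (fun b => f (e b)) x ∧
      x ∉ N'.sp (fun b => f (e b)) := by
  classical
  obtain ⟨N', f, x, hx⟩ := exists_ext_one N e (J := β → 𝔽)
    (fun c N e x => P N e x ∧ x ≠ ∑ b, c b • e b)
    (fun c => (DefL.toG hP).and (DefL.toG (Elem.eq (ElemT.var _)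
      (TermL.sum _ fun j => TermL.smul _ (ElemT.var _))).not))
    (fun s => by
      obtain ⟨x, hx, hxs⟩ := (h.sdiff (s.image fun c => ∑ b, c b • e b).finite_toSet).nonempty
      exact ⟨x, fun c hc => ⟨hx, fun heq => hxs (Finset.mem_coe.2
        (Finset.mem_image.2 ⟨c, hc, heq.symm⟩))⟩⟩)
  refine ⟨N', f, x, (hx 0).1, fun hmem => ?_⟩
  obtain ⟨c, hc⟩ := (N'.mem_sp_iff _).1 hmem
  exact (hx c).2 hc

/-- A generic variable can be replaced by sufficiently many distinct realizations. -/
theorem LTree.exists_eliminate [Fintype ι] [Finite μ] [Fintype β]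
    {χ : ∀ N : TGMod Rs T, (Option ι → N.carrier) → (μ → N.carrier) → (β → N.carrier) → Prop}
    (hχ : DefL (fun N (v : (Option ι ⊕ μ) ⊕ β → N.carrier) =>
      χ N (fun i => v (Sum.inl (Sum.inl i))) (fun i => v (Sum.inl (Sum.inr i)))
        (fun i => v (Sum.inr i)))) (N : TGMod Rs T) :
    ∃ (n : ℕ) (χ' : ∀ N : TGMod Rs T, (ι → N.carrier) → (Fin n ⊕ Fin n × μ → N.carrier) →
      (β → N.carrier) → Prop),
      DefL (fun N (v : (ι ⊕ (Fin n ⊕ Fin n × μ)) ⊕ β → N.carrier) =>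
        χ' N (fun i => v (Sum.inl (Sum.inl i))) (fun i => v (Sum.inl (Sum.inr i)))
          (fun i => v (Sum.inr i))) ∧
      ∀ k a, LTree k χ N a → LTree k χ' N a := by
  classical
  have hT := N.facts
  have key : ∀ {δ : Type} (x : ι → δ) (x₀ : δ) (u : μ → δ) (y : β → δ),
      DefL (fun (N : TGMod Rs T) (v : δ → N.carrier) =>
        χ N (fun o => o.elim (v x₀) (fun i => v (x i))) (fun i => v (u i)) (fun i => v (y i))) := by
    intro δ x x₀ u y
    refine (hχ.relabel (Sum.elim (Sum.elim (fun o => o.elim x₀ x) u) y)).congr fun N v => ?_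
    rw [iff_iff_eq]
    congr 1
    funext o
    cases o <;> rfl
  have hQ : DefL1 (β := ι ⊕ (β ⊕ β)) (fun (N : TGMod Rs T) e x => ∃ u : μ → N.carrier,
      χ N (fun o => o.elim x (fun i => e (Sum.inl i))) u (fun i => e (Sum.inr (Sum.inl i))) ∧
      χ N (fun o => o.elim x (fun i => e (Sum.inl i))) u (fun i => e (Sum.inr (Sum.inr i)))) :=
    Elem.ex ((key (fun i => Sum.inl (Sum.inl (Sum.inl i))) (Sum.inl (Sum.inr ())) Sum.inr
        (fun i => Sum.inl (Sum.inl (Sum.inr (Sum.inl i))))).and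
      (key (fun i => Sum.inl (Sum.inl (Sum.inl i))) (Sum.inl (Sum.inr ())) Sum.inr
        (fun i => Sum.inl (Sum.inl (Sum.inr (Sum.inr i))))))
  obtain ⟨n, hn⟩ := hQ.exists_many_iff hT
  refine ⟨n, fun N x w y => (Function.Injective fun i => w (Sum.inl i)) ∧ ∀ i : Fin n,
    χ N (fun o => o.elim (w (Sum.inl i)) x) (fun j => w (Sum.inr (i, j))) y, ?_, ?_⟩
  · refine Elem.and ?_ (Elem.forall_fin fun i => key (fun i => Sum.inl (Sum.inl i)) _
      (fun j => Sum.inl (Sum.inr (Sum.inr (i, j)))) Sum.inr)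
    exact Elem.forall_fin fun i => Elem.forall_fin fun j =>
      (Elem.eq (ElemT.var _) (ElemT.var _)).imp (Elem.const (i = j))
  intro k a ha
  refine ⟨fun X hX hk => ?_, fun η hη ν hν hne hp N' f b w hb h1 h2 => ?_⟩
  · obtain ⟨b, u, hb, hu⟩ := ha.cons X hX hk
    rw [indepOver_option] at hb
    have hP : DefL1 (β := ι ⊕ (X × β)) (fun (N : TGMod Rs T) e x => ∃ u : μ → N.carrier,
        ∀ η : X, χ N (fun o => o.elim x (fun i => e (Sum.inl i))) u
          (fun i => e (Sum.inr (η, i)))) :=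
      Elem.ex (Elem.forall_fin fun η => key (fun i => Sum.inl (Sum.inl (Sum.inl i)))
        (Sum.inl (Sum.inr ())) Sum.inr (fun i => Sum.inl (Sum.inl (Sum.inr (η, i)))))
    have hinf := hP.infinite_of_notMem_span N
      (Sum.elim (fun i => b (some i)) (fun p : X × β => a p.1 p.2)) (x := b none)
      ⟨u, fun η => by
        have h1 := hu η.1 η.2
        rwa [← show (fun o : Option ι => o.elim (b none) (fun i => b (some i))) = b from
          funext (by rintro (_ | _) <;> rfl)] at h1⟩ (fun hmem => hb.2 (by
        rw [sup_comm, ← TGMod.sp_elim]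
        exact hmem))
    obtain ⟨w, hw, hw'⟩ := exists_injective_of_infinite hinf n
    choose u' hu' using hw'
    exact ⟨fun i => b (some i), Sum.elim w (fun p => u' p.1 p.2), hb.1,
      fun η hη => ⟨hw, fun i => hu' i ⟨η, hη⟩⟩⟩
  · have hinf := (hn N' (Sum.elim b (Sum.elim (fun i => f (a η i)) (fun i => f (a ν i))))).1
      ⟨fun i => w (Sum.inl i), h1.1, fun i => ⟨fun j => w (Sum.inr (i, j)), h1.2 i, h2.2 i⟩⟩
    obtain ⟨N₂, f₂, x, ⟨u, hx1, hx2⟩, hx⟩ := exists_ext_notMem hQ N' _ hinf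
    refine ha.incons η hη ν hν hne hp N₂ (f.trans f₂)
      (fun o => o.elim x (fun i => f₂ (b i))) u ?_ hx1 hx2
    rw [indepOver_option]
    have hAB : (fun i => f₂ (Sum.elim (fun i => f (a η i)) (fun i => f (a ν i)) i)) =
        Sum.elim (fun i => (f.trans f₂) (a η i)) (fun i => (f.trans f₂) (a ν i)) :=
      funext (by rintro (i | i) <;> rfl)
    have hbAB : (fun i => f₂ (Sum.elim b (Sum.elim (fun i => f (a η i)) (fun i => f (a ν i))) i)) =
        Sum.elim (fun i => f₂ (b i))
          (Sum.elim (fun i => (f.trans f₂) (a η i)) (fun i => (f.trans f₂) (a ν i))) :=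
      funext (by rintro (i | i | i) <;> rfl)
    refine ⟨?_, fun hmem => hx ?_⟩
    · have h3 := hb.map f₂
      rwa [hAB] at h3
    · rw [hbAB, TGMod.sp_elim, sup_comm]
      exact hmem

end GenericVariables

section Transfer

variable {𝔽 : Type u} [Field 𝔽] {L' : FirstOrder.Language.{u, u}}
variable {Rs : Subring 𝔽} {T : (fullLang 𝔽 L').Theory} {α β γ ι' κ' ι κ υ μ : Type}

theorem ATPTree.hasATP [Finite α] [Finite β]
    {χ : ∀ N : TGMod Rs T, (α → N.carrier) → (β → N.carrier) → Prop}
    (hχ : DefL (fun N (v : α ⊕ β → N.carrier) => χ N (v ∘ Sum.inl) (v ∘ Sum.inr)))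
    {N : TGMod Rs T} {a : List Bool → β → N.carrier} (h : ATPTree χ N a) : T.HasATP := by
  obtain ⟨n, ⟨E⟩⟩ := Finite.exists_equiv_fin α
  obtain ⟨m, ⟨F⟩⟩ := Finite.exists_equiv_fin β
  obtain ⟨φ, hφ⟩ := hχ.relabel (Sum.map E F)
  have hφ' : ∀ (b : Fin n → N.carrier) (y : β → N.carrier),
      φ.Realize (Sum.elim b (y ∘ F.symm)) ↔ χ N (b ∘ E) y := by
    intro b y
    rw [← hφ]
    refine iff_of_eq (congrArg₂ (χ N) rfl ?_)
    funext i
    simp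
  have : Nonempty N.carrier := ⟨0⟩
  have := N.models
  refine ⟨Theory.ModelType.of T N.carrier, n, m, φ, fun η => a η ∘ F.symm,
    fun X hX => ?_, fun η ν hne hc ⟨b, h1, h2⟩ => ?_⟩
  · obtain ⟨b, hb⟩ := h.cons X hX
    refine ⟨b ∘ E.symm, fun η hη => (hφ' _ _).2 ?_⟩
    convert hb η hη using 1
    funext i
    simp
  · replace h1 := (hφ' _ _).1 h1
    replace h2 := (hφ' _ _).1 h2
    rcases hc with hc | hc
    · exact h.incons η ν hne hc _ h1 h2
    · exact h.incons ν η hne.symm hc _ h2 h1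

theorem LTree.hasATP [hι : Finite ι] : ∀ [Fintype ι] {μ : Type} [Finite μ] [Fintype β]
    {χ : ∀ N : TGMod Rs T, (ι → N.carrier) → (μ → N.carrier) → (β → N.carrier) → Prop}
    (hχ : DefL (fun N (v : (ι ⊕ μ) ⊕ β → N.carrier) =>
      χ N (fun i => v (Sum.inl (Sum.inl i))) (fun i => v (Sum.inl (Sum.inr i)))
        (fun i => v (Sum.inr i)))) (N : TGMod Rs T) (h : ∀ k, ∃ a, LTree k χ N a), T.HasATP := by
  induction ι using Finite.induction_empty_option with
  | @of_equiv ι ι' e ih =>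
    intro _ μ _ _ χ hχ N h
    have := Fintype.ofEquiv _ e.symm
    refine ih (χ := fun N b => χ N (b ∘ e.symm)) (hχ.relabel
      (Sum.map (Sum.map e.symm id) id)) N fun k => ?_
    obtain ⟨a, ha⟩ := h k
    refine ⟨a, fun X hX hk => ?_, fun η hη ν hν hne hp N' f b u hb h1 h2 =>
      ha.incons η hη ν hν hne hp N' f (b ∘ e.symm) u (hb.comp e.symm.injective) h1 h2⟩
    obtain ⟨b, u, hb, hu⟩ := ha.cons X hX hk
    refine ⟨b ∘ e, u, hb.comp e.injective, fun η hη => ?_⟩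
    convert hu η hη using 1
    funext i
    simp
  | h_empty =>
    intro _ μ _ _ χ hχ N h
    have hind : ∀ (N : TGMod Rs T) (S : Submodule 𝔽 N.carrier) (b : PEmpty → N.carrier),
        IndepOver N S b := fun N S b m _ => funext fun i => i.elim
    have hχ' : DefL (fun N (v : μ ⊕ β → N.carrier) =>
        χ N PEmpty.elim (v ∘ Sum.inl) (v ∘ Sum.inr)) := by
      refine (hχ.relabel (Sum.elim (Sum.elim PEmpty.elim Sum.inl) Sum.inr)).congr fun N v => ?_
      rw [iff_iff_eq, Subsingleton.elim PEmpty.elim _]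
      rfl
    obtain ⟨N', f, a', ha', -⟩ := exists_atpTree (N := N) (DefL.toG hχ') (J := Empty)
      (fun j => j.elim) (fun j => j.elim) (fun k s => by
        obtain ⟨a, ha⟩ := h k
        refine ⟨a, ⟨fun X hX hk => ?_, fun η hη ν hν hne hp u h1 h2 =>
          ha.incons η hη ν hν hne hp N (Ext.refl N) PEmpty.elim u (hind _ _ _) h1 h2⟩,
          fun η _ j => j.elim⟩
        obtain ⟨b, u, -, hu⟩ := ha.cons X hX hk
        exact ⟨u, fun η hη => by rw [Subsingleton.elim PEmpty.elim b]; exact hu η hη⟩)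
    exact ha'.hasATP hχ'
  | @h_option ι hι ih =>
    intro _ μ _ _ χ hχ N h
    have := Fintype.ofFinite ι
    obtain ⟨n, χ', hχ', hk⟩ := LTree.exists_eliminate (ι := ι) hχ N
    exact ih hχ' N fun k => (h k).imp fun a ha => hk k a (by convert ha)

theorem completeTheory_isNATP [CharZero 𝔽] (hT : TFacts T) (hnatp : T.IsNATP) (M : Type u)
    [(genLang 𝔽 L' ↥Rs).Structure M] [Nonempty M] (hM : IsTGModel Rs T M) :
    ((genLang 𝔽 L' ↥Rs).completeTheory M).IsNATP := by
  rintro ⟨M₀, n, m, φ, a, hcons, hincons⟩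
  apply hnatp
  have hM₀ : IsTGModel Rs T M₀ := hM.of_completeTheory_eq hT (by
    refine Set.Subset.antisymm (fun ψ hψ => M₀.is_model.realize_of_mem ψ hψ) fun ψ hψ => ?_
    by_contra hn
    exact (Sentence.realize_not M₀).1 (M₀.is_model.realize_of_mem ψ.not
      (mem_completeTheory.2 ((Sentence.realize_not M).2 fun h => hn (mem_completeTheory.2 h))))
      (mem_completeTheory.1 hψ))
  let N : TGMod Rs T := ⟨M₀, inferInstance, hT, hM₀⟩
  obtain ⟨ι, κ, ι', κ', _, _, _, _, Φ, hΦ, N₁, a₁, h₁⟩ := ATPTree.exists_genTree _ _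
    (ι := Fin n) (κ := Empty) (β := Fin m) rfl rfl
    (Φ := fun (N : TGMod Rs T) b y => φ.Realize (Sum.elim (fun i => b (Sum.inl i)) y))
    ((Elem.of φ).relabel (Sum.elim (fun i => Sum.inl (Sum.inl i)) Sum.inr) |>.congr fun N v => by
      rw [iff_iff_eq]
      congr 1
      funext i
      rcases i with i | i <;> rfl)
    (fun N b y _ i => i.elim) (N := N) (a := a)
    (fun k => ⟨fun X hX _ => (hcons X hX).imp' (fun b => Sum.elim b Empty.elim) fun b hb => hb,
      fun η _ ν _ hne hp b h1 h2 => hincons η ν hne (Or.inl hp) ⟨_, h1, h2⟩⟩)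
  obtain ⟨χ, FA, D, hχ, hsol, hin⟩ := h₁.exists_pattern hΦ
  refine LTree.hasATP (ι := ι ⊕ κ) (μ := Empty) (β := ι' ⊕ κ') (χ := fun N b _ y => χ N b y)
    (hχ.relabel (Sum.map Sum.inl id)) N₁ fun k => ?_
  obtain ⟨e, he, hcons, hincons⟩ :=
    exists_subtree_without_pattern hχ (fun η => (h₁.good η).1) hsol hin k
  refine ⟨fun η => a₁ (e η), fun X hX hk => ?_, fun η hη ν hν hne hp N' f b _ =>
    hincons η hη ν hν hne hp N' f b⟩
  obtain ⟨b, hb, hX⟩ := hcons X hX hk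
  exact ⟨b, Empty.elim, hb, hX⟩

end Transfer

section TG

variable {𝔽 : Type u} [Field 𝔽] [CharZero 𝔽] {L' : FirstOrder.Language.{u, u}}
variable (Rs : Subring 𝔽) (T : (fullLang 𝔽 L').Theory)

/-- **Proposition 3.8** (after Berenstein–d'Elbée–Vassiliev): Let `𝔽` be a field of
characteristic `0`, `R ⊆ 𝔽` a subring, and `T` an `L`-theory (`L ⊇ L₀`) with quantifier
elimination and elimination of `∃^∞`, all of whose models are `𝔽`-vector spaces and in which
`acl` is the `𝔽`-linear span.  If `T` is NATP, then the dense/co-dense generic expansion `T_G`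
(axioms (A)–(D)) is NATP (i.e., the complete theory of every model of `T_G` is NATP). -/
theorem vector_space_generic_submodule_preserves_NATP
    (hqe : HasQE T) (hee : EliminatesExInf T)
    (hvs : ∀ (N : Type u) [(fullLang 𝔽 L').Structure N], N ⊨ T →
      @VSAxioms 𝔽 N ((LHom.sumInl : vsLang 𝔽 →ᴸ fullLang 𝔽 L').reduct N) _)
    (hacl : ∀ (N : Type u) [(fullLang 𝔽 L').Structure N], N ⊨ T →
      ∀ A : Set N, acl (fullLang 𝔽 L') N A =
        @vspan 𝔽 N ((LHom.sumInl : vsLang 𝔽 →ᴸ fullLang 𝔽 L').reduct N) A)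
    (hnatp : T.IsNATP) :
    ∀ (M : Type u) [(genLang 𝔽 L' ↥Rs).Structure M] [Nonempty M],
      IsTGModel Rs T M → ((genLang 𝔽 L' ↥Rs).completeTheory M).IsNATP := by
  intro M _ _ hM
  exact completeTheory_isNATP ⟨hee, hvs, hacl⟩ hnatp M hM

end TG

end NATPPaper
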